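/- (Orowan's law) Assume (W), N = 1, g ≡ 1/π and σ ≡ 0, and let p0, L0 ∈ ℝ. Then the effective Hamiltonian H̄ defined by the ergodicity theorem satisfies H̄(δp0, δL0)/δ² → c0 |p0| L0 as δ → 0⁺, where c0 = (∫_ℝ (φ')²)^{−1}. -/

import Mathlib

open MeasureTheory Set Filter Topology Metric

noncomputable section

/-- `I1^{1,r}[U,x]` in dimension one with `g ≡ 1/π` (half-Laplacian). -/
def J1 (r : ℝ) (U : ℝ → ℝ) (x : ℝ) : ℝ :=
  ∫ z in {z : ℝ | |z| ≤ r}, (U (x + z) - U x - deriv U x * z) / (Real.pi * z ^ 2)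

/-- `I1^{2,r}[U,x]` in dimension one with `g ≡ 1/π`. -/
def J2 (r : ℝ) (U : ℝ → ℝ) (x : ℝ) : ℝ :=
  ∫ z in {z : ℝ | r < |z|}, (U (x + z) - U x) / (Real.pi * z ^ 2)

/-- The one-dimensional operator `I1 = -(-Δ)^{1/2}`. -/
def halfLap (U : ℝ → ℝ) (x : ℝ) : ℝ := J1 1 U x + J2 1 U x

/-- Assumption (W): `W ∈ C^{4,β}`, 1-periodic, vanishing exactly on ℤ, with `W''(0) > 0`. -/
def AssumptionW (W : ℝ → ℝ) : Prop :=
  (∃ β ∈ Ioo (0:ℝ) 1, ContDiff ℝ 4 W ∧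
    ∃ Kβ : ℝ, ∀ a b : ℝ, |iteratedDeriv 4 W a - iteratedDeriv 4 W b| ≤ Kβ * |a - b| ^ β) ∧
  (∀ v : ℝ, W (v + 1) = W v) ∧
  (∀ k : ℤ, W (k : ℝ) = 0) ∧
  (∀ v : ℝ, (∀ k : ℤ, v ≠ (k : ℝ)) → 0 < W v) ∧
  0 < deriv (deriv W) 0

/-- The phase transition `φ`: solution of `I1[φ] = W'(φ)`, `φ(−∞)=0`, `φ(+∞)=1`,
`φ(0)=1/2`, `φ' > 0` (it is of class `C^{4,β}`, with bounded derivatives). -/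
def IsPhi (W φ : ℝ → ℝ) : Prop :=
  ContDiff ℝ 4 φ ∧
  (∀ x : ℝ, halfLap φ x = deriv W (φ x)) ∧
  Tendsto φ atBot (𝓝 0) ∧ Tendsto φ atTop (𝓝 1) ∧
  φ 0 = 1 / 2 ∧ (∀ x : ℝ, 0 < deriv φ x)

/-- `u ∈ C_b(ℝ⁺×ℝ)`. -/
def Cb1 (u : ℝ → ℝ → ℝ) : Prop :=
  ContinuousOn (Function.uncurry u) {p : ℝ × ℝ | 0 ≤ p.1} ∧
  ∀ T > (0:ℝ), ∃ M : ℝ, ∀ t ∈ Ioo (0:ℝ) T, ∀ x : ℝ, |u t x| ≤ M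

/-- `r`-viscosity subsolution testing inequalities in dimension one (with `g ≡ 1/π`) for
`∂ₜ u = F(t, y, u, ∂_y u, I1[u(t,·)])`. -/
def SubSolAtR1 (F : ℝ → ℝ → ℝ → ℝ → ℝ → ℝ) (u : ℝ → ℝ → ℝ) (r : ℝ) : Prop :=
  ∀ (t0 y0 τ : ℝ) (φ : ℝ → ℝ → ℝ),
    0 < t0 → 0 < τ → τ < t0 →
    ContDiff ℝ 2 (Function.uncurry φ) →
    (∀ t ∈ Ioo (t0 - τ) (t0 + τ), ∀ y ∈ ball y0 r,
      u t y - φ t y ≤ u t0 y0 - φ t0 y0) →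
    deriv (fun s => φ s y0) t0 ≤
      F t0 y0 (u t0 y0) (deriv (φ t0) y0) (J1 r (φ t0) y0 + J2 r (u t0) y0)

/-- `r`-viscosity supersolution testing inequalities in dimension one. -/
def SuperSolAtR1 (F : ℝ → ℝ → ℝ → ℝ → ℝ → ℝ) (u : ℝ → ℝ → ℝ) (r : ℝ) : Prop :=
  ∀ (t0 y0 τ : ℝ) (φ : ℝ → ℝ → ℝ),
    0 < t0 → 0 < τ → τ < t0 →
    ContDiff ℝ 2 (Function.uncurry φ) →
    (∀ t ∈ Ioo (t0 - τ) (t0 + τ), ∀ y ∈ ball y0 r,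
      u t y - φ t y ≥ u t0 y0 - φ t0 y0) →
    deriv (fun s => φ s y0) t0 ≥
      F t0 y0 (u t0 y0) (deriv (φ t0) y0) (J1 r (φ t0) y0 + J2 r (u t0) y0)

/-- Bounded continuous viscosity solution with zero initial datum, in dimension one. -/
def IsSol1 (F : ℝ → ℝ → ℝ → ℝ → ℝ → ℝ) (u : ℝ → ℝ → ℝ) : Prop :=
  Cb1 u ∧ (∀ y : ℝ, u 0 y = 0) ∧
  (∀ r > (0:ℝ), SubSolAtR1 F u r) ∧ (∀ r > (0:ℝ), SuperSolAtR1 F u r)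

/-- Nonlinearity of the one-dimensional cell problem (1.5) with `σ ≡ 0`:
`∂τ w = I1[w] + L − W'(w + p·y)`. -/
def Fcell1 (W : ℝ → ℝ) (p L : ℝ) : ℝ → ℝ → ℝ → ℝ → ℝ → ℝ :=
  fun _τ y v _q ℓ => ℓ + L - deriv W (v + p * y)

/-- `w(τ,y)/τ → lam` as `τ → +∞`, locally uniformly in `y`. -/
def ErgodicLimit1 (w : ℝ → ℝ → ℝ) (lam : ℝ) : Prop :=
  ∀ R > (0:ℝ), ∀ δ > (0:ℝ), ∃ T : ℝ, ∀ τ ≥ T, ∀ y : ℝ, |y| ≤ R →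
    |w τ y / τ - lam| ≤ δ

/-- Symmetric second difference of `u` at `x` with step `z`. -/
def d2 (u : ℝ → ℝ) (x z : ℝ) : ℝ := u (x + z) + u (x - z) - 2 * u x

/-- The half-Laplacian written with symmetric second differences. -/
def hl (u : ℝ → ℝ) (x : ℝ) : ℝ := ∫ z, d2 u x z / (2 * Real.pi * z ^ 2)

theorem d2_neg (u : ℝ → ℝ) (x z : ℝ) : d2 u x (-z) = d2 u x z := by
  unfold d2; rw [sub_neg_eq_add, ← sub_eq_add_neg]; ring

theorem abs_d2_le_mul_sq {u : ℝ → ℝ} (hu : ContDiff ℝ 2 u) {M x z : ℝ}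
    (h : ∀ y, |y - x| ≤ |z| → |deriv (deriv u) y| ≤ M) : |d2 u x z| ≤ M * z ^ 2 := by
  wlog hz : 0 ≤ z generalizing z
  · have := this (z := -z) (by simpa using h) (by linarith)
    simpa [d2_neg] using this
  rw [abs_of_nonneg hz] at h
  have hu1 : Differentiable ℝ u := hu.differentiable (by norm_num)
  have hu' : ContDiff ℝ 1 (deriv u) := by
    have : ContDiff ℝ (1 + 1) u := by norm_num; exact hu
    exact (contDiff_succ_iff_deriv.1 this).2.2
  have hd' : Differentiable ℝ (deriv u) := hu'.differentiable (by norm_num)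
  have hder : ∀ t, HasDerivAt (fun t => d2 u x t) (deriv u (x + t) - deriv u (x - t)) t := by
    intro t
    have h1 : HasDerivAt (fun t => u (x + t)) (deriv u (x + t)) t := by
      simpa using (hu1 (x + t)).hasDerivAt.comp_const_add x t
    have h2 : HasDerivAt (fun t => u (x - t)) (-deriv u (x - t)) t := by
      simpa using (hu1 (x - t)).hasDerivAt.comp_const_sub x t
    simpa [d2, sub_eq_add_neg] using (h1.add h2).sub_const (2 * u x)
  have key := image_norm_le_of_norm_deriv_right_le_deriv_boundary
    (f := fun t => d2 u x t) (f' := fun t => deriv u (x + t) - deriv u (x - t)) (a := 0) (b := z)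
    (B := fun t => M * t ^ 2) (B' := fun t => 2 * M * t)
    (fun t _ => (hder t).continuousAt.continuousWithinAt)
    (fun t _ => (hder t).hasDerivWithinAt)
    (by simp [d2]; ring)
    (by intro t; simpa [mul_comm, mul_left_comm, mul_assoc] using (hasDerivAt_pow 2 t).const_mul M)
    (by
      intro t ht
      have := (convex_Icc (x - t) (x + t)).norm_image_sub_le_of_norm_deriv_le
        (f := deriv u) (C := M) (x := x - t) (y := x + t) (fun y _ => hd' y)
        (fun y hy => by
          rw [Real.norm_eq_abs]; apply h; rw [abs_le]; constructor <;> linarith [hy.1, hy.2, ht.2])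
        ⟨le_rfl, by linarith [ht.1]⟩ ⟨by linarith [ht.1], le_rfl⟩
      refine this.trans (le_of_eq ?_)
      rw [Real.norm_eq_abs, abs_of_nonneg (by linarith [ht.1])]; ring)
  have := key ⟨hz, le_rfl⟩
  simpa using this

theorem continuous_d2 {u : ℝ → ℝ} (hu : Continuous u) : Continuous fun p : ℝ × ℝ => d2 u p.1 p.2 := by
  unfold d2; fun_prop

theorem measurable_d2_div {u : ℝ → ℝ} (hu : Continuous u) :
    Measurable fun p : ℝ × ℝ => d2 u p.1 p.2 / (2 * Real.pi * p.2 ^ 2) :=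
  (continuous_d2 hu).measurable.div (by fun_prop)

theorem measurable_d2_div_right {u : ℝ → ℝ} (hu : Continuous u) (x : ℝ) :
    Measurable fun z : ℝ => d2 u x z / (2 * Real.pi * z ^ 2) :=
  (measurable_d2_div hu).comp measurable_prodMk_left

theorem measurable_hl {u : ℝ → ℝ} (hu : Continuous u) : Measurable (hl u) :=
  ((measurable_d2_div hu).stronglyMeasurable.integral_prod_right).measurable

theorem abs_d2_div_le {a C z : ℝ} (h1 : |a| ≤ C * z ^ 2) (h2 : |a| ≤ C) :
    |a / (2 * Real.pi * z ^ 2)| ≤ C / Real.pi * (1 + z ^ 2)⁻¹ := by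
  have hpi := Real.pi_pos
  rcases eq_or_ne z 0 with rfl | hz
  · simp; exact div_nonneg ((abs_nonneg _).trans h2) hpi.le
  have hz2 : 0 < z ^ 2 := by positivity
  rw [abs_div, abs_of_pos (show 0 < 2 * Real.pi * z ^ 2 by positivity), ← div_eq_mul_inv, div_div,
    div_le_div_iff₀ (by positivity) (by positivity)]
  nlinarith [mul_le_mul_of_nonneg_left h2 hz2.le]

theorem integrable_d2_of_bound {u : ℝ → ℝ} (hu : Continuous u) {x C : ℝ}
    (h1 : ∀ z, |d2 u x z| ≤ C * z ^ 2) (h2 : ∀ z, |d2 u x z| ≤ C) :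
    Integrable fun z => d2 u x z / (2 * Real.pi * z ^ 2) := by
  refine (integrable_inv_one_add_sq.const_mul (C / Real.pi)).mono'
    (measurable_d2_div_right hu x).aestronglyMeasurable (Eventually.of_forall fun z => ?_)
  exact abs_d2_div_le (h1 z) (h2 z)

theorem abs_hl_le {u : ℝ → ℝ} {x C : ℝ}
    (h1 : ∀ z, |d2 u x z| ≤ C * z ^ 2) (h2 : ∀ z, |d2 u x z| ≤ C) : |hl u x| ≤ C := by
  have := norm_integral_le_of_norm_le (integrable_inv_one_add_sq.const_mul (C / Real.pi))
    (f := fun z => d2 u x z / (2 * Real.pi * z ^ 2))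
    (Eventually.of_forall fun z => abs_d2_div_le (h1 z) (h2 z))
  rw [integral_const_mul, integral_univ_inv_one_add_sq, div_mul_cancel₀ _ Real.pi_ne_zero] at this
  exact this

theorem abs_d2_le_of_abs_le {u : ℝ → ℝ} {M : ℝ} (h : ∀ x, |u x| ≤ M) (x z : ℝ) :
    |d2 u x z| ≤ 4 * M := by
  have h1 := abs_le.1 (h (x + z)); have h2 := abs_le.1 (h (x - z)); have h3 := abs_le.1 (h x)
  unfold d2; rw [abs_le]; constructor <;> linarith

theorem ContDiff.deriv_of_two {u : ℝ → ℝ} (hu : ContDiff ℝ 2 u) : ContDiff ℝ 1 (deriv u) := by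
  have : ContDiff ℝ (1 + 1) u := by norm_num; exact hu
  exact (contDiff_succ_iff_deriv.1 this).2.2

theorem ContDiff.continuous_deriv_deriv {u : ℝ → ℝ} (hu : ContDiff ℝ 2 u) :
    Continuous (deriv (deriv u)) := hu.deriv_of_two.continuous_deriv (by norm_num)

/-- Second differences of a bounded `C²` function are bounded by `min (z²) 1`, locally uniformly. -/
theorem exists_d2_bound {u : ℝ → ℝ} (hu : ContDiff ℝ 2 u) {M : ℝ} (h : ∀ x, |u x| ≤ M) (R : ℝ) :
    ∃ C, 0 ≤ C ∧ ∀ x, |x| ≤ R → ∀ z, |d2 u x z| ≤ C * z ^ 2 ∧ |d2 u x z| ≤ C := by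
  obtain ⟨K, hK⟩ := (isCompact_Icc (a := -R - 1) (b := R + 1)).exists_bound_of_continuousOn
    hu.continuous_deriv_deriv.continuousOn
  have hM : 0 ≤ M := (abs_nonneg _).trans (h 0)
  refine ⟨max K (4 * M), le_max_of_le_right (by linarith), fun x hx z => ?_⟩
  have hb := abs_d2_le_of_abs_le h x z
  refine ⟨?_, hb.trans (le_max_right _ _)⟩
  rcases le_total |z| 1 with hz | hz
  · refine (abs_d2_le_mul_sq hu (M := K) fun y hy => hK y ?_).trans ?_
    · have := abs_le.1 hx; have := abs_le.1 (hy.trans hz); constructor <;> linarith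
    · exact mul_le_mul_of_nonneg_right (le_max_left _ _) (sq_nonneg _)
  · have hz2 : 1 ≤ z ^ 2 := by rw [← sq_abs]; nlinarith
    refine hb.trans ?_
    have h4 := le_max_right K (4 * M)
    nlinarith

theorem integrable_d2 {u : ℝ → ℝ} (hu : ContDiff ℝ 2 u) {M : ℝ} (h : ∀ x, |u x| ≤ M) (x : ℝ) :
    Integrable fun z => d2 u x z / (2 * Real.pi * z ^ 2) := by
  obtain ⟨C, -, hC⟩ := exists_d2_bound hu h |x|
  exact integrable_d2_of_bound hu.continuous (fun z => (hC x le_rfl z).1) fun z => (hC x le_rfl z).2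

theorem hl_add {u v : ℝ → ℝ} {x : ℝ} (hu : Integrable fun z => d2 u x z / (2 * Real.pi * z ^ 2))
    (hv : Integrable fun z => d2 v x z / (2 * Real.pi * z ^ 2)) :
    hl (fun y => u y + v y) x = hl u x + hl v x := by
  unfold hl; rw [← integral_add hu hv]; congr 1; ext z; unfold d2; ring

theorem hl_sub {u v : ℝ → ℝ} {x : ℝ} (hu : Integrable fun z => d2 u x z / (2 * Real.pi * z ^ 2))
    (hv : Integrable fun z => d2 v x z / (2 * Real.pi * z ^ 2)) :
    hl (fun y => u y - v y) x = hl u x - hl v x := by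
  unfold hl; rw [← integral_sub hu hv]; congr 1; ext z; unfold d2; ring

theorem hl_const_mul (c : ℝ) (u : ℝ → ℝ) (x : ℝ) : hl (fun y => c * u y) x = c * hl u x := by
  unfold hl; rw [← integral_const_mul]; congr 1; ext z; unfold d2; ring

theorem hl_neg (u : ℝ → ℝ) (x : ℝ) : hl (fun y => -u y) x = -hl u x := by
  simpa using hl_const_mul (-1) u x

theorem hl_add_const (u : ℝ → ℝ) (c x : ℝ) : hl (fun y => u y + c) x = hl u x := by
  unfold hl; congr 1; ext z; unfold d2; ring

theorem hl_comp_add (u : ℝ → ℝ) (h x : ℝ) : hl (fun y => u (y + h)) x = hl u (x + h) := by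
  unfold hl; congr 1; ext z; unfold d2; ring_nf

theorem hl_comp_neg (u : ℝ → ℝ) (x : ℝ) : hl (fun y => u (-y)) x = hl u (-x) := by
  unfold hl; congr 1; ext z; unfold d2; ring_nf

theorem hl_nonpos_of_forall_le {u : ℝ → ℝ} {x : ℝ} (h : ∀ y, u y ≤ u x) : hl u x ≤ 0 := by
  refine integral_nonpos fun z => ?_
  refine div_nonpos_of_nonpos_of_nonneg ?_ (by positivity)
  unfold d2; linarith [h (x + z), h (x - z)]

theorem setIntegral_eq_half_symm {S : Set ℝ} (hS : MeasurableSet S) (hsymm : ∀ z, -z ∈ S ↔ z ∈ S)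
    {f : ℝ → ℝ} (hf : IntegrableOn f S) :
    IntegrableOn (fun z => (f z + f (-z)) / 2) S ∧ ∫ z in S, f z = ∫ z in S, (f z + f (-z)) / 2 := by
  have hind : ∀ z, S.indicator f (-z) = S.indicator (fun z => f (-z)) z := by
    intro z; by_cases hz : z ∈ S
    · rw [indicator_of_mem hz, indicator_of_mem ((hsymm z).2 hz)]
    · rw [indicator_of_notMem hz, indicator_of_notMem (fun h => hz ((hsymm z).1 h))]
  have hf' : IntegrableOn (fun z => f (-z)) S := by
    rw [← integrable_indicator_iff hS] at hf ⊢
    have := hf.comp_neg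
    simpa only [hind] using this
  have heq : ∫ z in S, f (-z) = ∫ z in S, f z := by
    rw [← integral_indicator hS, ← integral_indicator hS, ← integral_neg_eq_self (S.indicator f)]
    simp only [hind]
  refine ⟨(hf.add hf').div_const 2, ?_⟩
  rw [integral_div, integral_add hf hf', heq]; ring

theorem integrableOn_J2 {u : ℝ → ℝ} (hu : Continuous u) {M : ℝ} (h : ∀ x, |u x| ≤ M) (x : ℝ) :
    IntegrableOn (fun z => (u (x + z) - u x) / (Real.pi * z ^ 2)) {z : ℝ | 1 < |z|} := by
  have hS : MeasurableSet {z : ℝ | 1 < |z|} := measurableSet_lt measurable_const (by fun_prop)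
  have hpi := Real.pi_pos
  refine ((integrable_inv_one_add_sq.const_mul (4 * M / Real.pi)).integrableOn).mono'
    (Measurable.aestronglyMeasurable (by fun_prop)) ?_
  refine (ae_restrict_mem hS).mono fun z hz => ?_
  have hz2 : 1 < z ^ 2 := by rw [← sq_abs]; nlinarith [show 1 < |z| from hz]
  rw [Real.norm_eq_abs, abs_div, abs_of_pos (show 0 < Real.pi * z ^ 2 by positivity),
    ← div_eq_mul_inv, div_div, div_le_div_iff₀ (by positivity) (by positivity)]
  have h1 : |u (x + z) - u x| ≤ 2 * M := by
    have h1 := abs_le.1 (h (x + z)); have h3 := abs_le.1 (h x)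
    rw [abs_le]; constructor <;> linarith
  have hM : 0 ≤ M := (abs_nonneg _).trans (h 0)
  calc |u (x + z) - u x| * (Real.pi * (1 + z ^ 2)) ≤ 2 * M * (Real.pi * (z ^ 2 + z ^ 2)) := by gcongr
    _ = _ := by ring

theorem integrableOn_J1 {u : ℝ → ℝ} (hu : ContDiff ℝ 2 u) (x : ℝ) :
    IntegrableOn (fun z => (u (x + z) - u x - deriv u x * z) / (Real.pi * z ^ 2))
      {z : ℝ | |z| ≤ 1} := by
  have hS : MeasurableSet {z : ℝ | |z| ≤ 1} := measurableSet_le (by fun_prop) measurable_const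
  have hpi := Real.pi_pos
  have hu0 := hu.continuous
  obtain ⟨K, hK⟩ := (isCompact_Icc (a := x - 1) (b := x + 1)).exists_bound_of_continuousOn
    hu.continuous_deriv_deriv.continuousOn
  have hd : Differentiable ℝ (deriv u) := hu.deriv_of_two.differentiable (by norm_num)
  have hu1 : Differentiable ℝ u := hu.differentiable (by norm_num)
  have hfin : volume {z : ℝ | |z| ≤ 1} < ⊤ := by
    have : {z : ℝ | |z| ≤ 1} = Icc (-1) 1 := by ext z; simp [abs_le]
    rw [this]; exact measure_Icc_lt_top
  refine Measure.integrableOn_of_bounded (M := K / Real.pi) hfin.ne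
    (Measurable.aestronglyMeasurable (by fun_prop)) ?_
  refine (ae_restrict_mem hS).mono fun z hz => ?_
  have hz1 : |z| ≤ 1 := hz
  have hK0 : 0 ≤ K := (norm_nonneg _).trans (hK x ⟨by linarith, by linarith⟩)
  have hder : ∀ t, HasDerivAt (fun t => u (x + t) - u x - deriv u x * t)
      (deriv u (x + t) - deriv u x) t := by
    intro t
    have h1 : HasDerivAt (fun t => u (x + t)) (deriv u (x + t)) t := by
      simpa using (hu1 (x + t)).hasDerivAt.comp_const_add x t
    have h3 := (h1.sub_const (u x)).sub ((hasDerivAt_id t).const_mul (deriv u x))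
    rw [mul_one] at h3
    exact h3
  have hb : |u (x + z) - u x - deriv u x * z| ≤ K * |z| * |z| := by
    have := (convex_uIcc 0 z).norm_image_sub_le_of_norm_hasDerivWithin_le
      (f := fun t => u (x + t) - u x - deriv u x * t) (C := K * |z|) (x := 0) (y := z)
      (fun t _ => (hder t).hasDerivWithinAt) (fun t ht => by
        have htz : |t| ≤ |z| := by simpa using abs_sub_left_of_mem_uIcc ht
        have := (convex_Icc (x - 1) (x + 1)).norm_image_sub_le_of_norm_deriv_le
          (f := deriv u) (C := K) (x := x) (y := x + t) (fun y _ => hd y) hK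
          ⟨by linarith, by linarith⟩ (by
            have := abs_le.1 (htz.trans hz1); constructor <;> linarith)
        refine this.trans ?_
        simp only [add_sub_cancel_left, Real.norm_eq_abs]; gcongr)
      left_mem_uIcc right_mem_uIcc
    simpa using this
  rcases eq_or_ne z 0 with rfl | hz0
  · simp; positivity
  have : 0 < z ^ 2 := by positivity
  rw [Real.norm_eq_abs, abs_div, abs_of_pos (show 0 < Real.pi * z ^ 2 by positivity),
    div_le_div_iff₀ (by positivity) (by positivity)]
  calc _ ≤ K * |z| * |z| * Real.pi := by gcongr
    _ = K * (Real.pi * z ^ 2) := by rw [← sq_abs]; ring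

theorem J1_add_J2_eq_hl {u : ℝ → ℝ} (hu : ContDiff ℝ 2 u) {M : ℝ} (h : ∀ x, |u x| ≤ M) (x : ℝ) :
    J1 1 u x + J2 1 u x = hl u x := by
  have hS : MeasurableSet {z : ℝ | |z| ≤ 1} := measurableSet_le (by fun_prop) measurable_const
  have hSc : {z : ℝ | 1 < |z|} = {z : ℝ | |z| ≤ 1}ᶜ := by ext z; simp
  have hInt := integrable_d2 hu h x
  unfold hl
  rw [← integral_add_compl hS hInt]
  congr 1
  · rw [J1, (setIntegral_eq_half_symm hS (by simp) (integrableOn_J1 hu x)).2]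
    refine integral_congr_ae (Eventually.of_forall fun z => ?_)
    simp only [d2, ← sub_eq_add_neg, neg_sq]
    rw [← add_div, div_div, mul_comm _ (2 : ℝ), ← mul_assoc]; ring
  · rw [J2, (setIntegral_eq_half_symm (hSc ▸ hS.compl) (by simp)
      (integrableOn_J2 hu.continuous h x)).2, hSc]
    refine integral_congr_ae (Eventually.of_forall fun z => ?_)
    simp only [d2, ← sub_eq_add_neg, neg_sq]
    rw [← add_div, div_div, mul_comm _ (2 : ℝ), ← mul_assoc]; ring

/-- The algebraic bump `1 / (b² + x²)`. -/
def bump (b x : ℝ) : ℝ := (b ^ 2 + x ^ 2)⁻¹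

theorem bump_pos {b : ℝ} (hb : 0 < b) (x : ℝ) : 0 < bump b x := by unfold bump; positivity

theorem bump_le {b : ℝ} (hb : 0 < b) (x : ℝ) : bump b x ≤ (b ^ 2)⁻¹ := by
  unfold bump; gcongr; nlinarith [sq_nonneg x]

theorem contDiff_bump {b : ℝ} (hb : 0 < b) {n : WithTop ℕ∞} : ContDiff ℝ n (bump b) := by
  unfold bump
  exact ContDiff.inv (by fun_prop) fun x => by positivity

theorem bump_eq {b : ℝ} (hb : 0 < b) (x : ℝ) : bump b x = (b ^ 2)⁻¹ * (1 + (x / b) ^ 2)⁻¹ := by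
  unfold bump; rw [← mul_inv]; congr 1; field_simp

theorem integrable_bump {b : ℝ} (hb : 0 < b) : Integrable (bump b) := by
  have := (integrable_inv_one_add_sq.comp_div hb.ne').const_mul (b ^ 2)⁻¹
  exact this.congr (Eventually.of_forall fun x => (bump_eq hb x).symm)

theorem integral_bump {b : ℝ} (hb : 0 < b) : ∫ x, bump b x = Real.pi / b := by
  simp_rw [bump_eq hb]
  rw [integral_const_mul, Measure.integral_comp_div (fun x : ℝ => (1 + x ^ 2)⁻¹),
    integral_univ_inv_one_add_sq, abs_of_pos hb, smul_eq_mul]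
  field_simp

theorem tendsto_bump_atTop (b : ℝ) : Tendsto (bump b) atTop (𝓝 0) :=
  tendsto_inv_atTop_zero.comp (tendsto_atTop_add_const_left _ _ (tendsto_pow_atTop (by norm_num)))

theorem bump_neg (b x : ℝ) : bump b (-x) = bump b x := by simp [bump]

theorem tendsto_bump_atBot (b : ℝ) : Tendsto (bump b) atBot (𝓝 0) := by
  have := (tendsto_bump_atTop b).comp tendsto_neg_atBot_atTop
  simpa [Function.comp_def, bump_neg] using this

/-- Translates of the bump have total mass independent of the centre. -/
theorem integral_bump_pair {b : ℝ} (hb : 0 < b) (x : ℝ) :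
    Integrable (fun z => bump b (x + z) + bump b (x - z)) ∧
      ∫ z, (bump b (x + z) + bump b (x - z)) = 2 * (Real.pi / b) := by
  have h1 := (integrable_bump hb).comp_add_left x
  have h2 := (integrable_bump hb).comp_sub_left x
  refine ⟨h1.add h2, ?_⟩
  rw [integral_add h1 h2, integral_add_left_eq_self (bump b), integral_sub_left_eq_self (bump b),
    integral_bump hb]; ring

theorem d2_bump_bounds {b : ℝ} (hb : 0 < b) (x z : ℝ) :
    d2 (bump b) x z ≤ 8 * z ^ 2 * (bump b x * (bump b (x + z) + bump b (x - z))) ∧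
    -(z ^ 2 * (bump b x * (bump b (x + z) + bump b (x - z)))) ≤ d2 (bump b) x z := by
  have e1 : 0 < b ^ 2 + x ^ 2 := by positivity
  have e2 : 0 < b ^ 2 + (x + z) ^ 2 := by positivity
  have e3 : 0 < b ^ 2 + (x - z) ^ 2 := by positivity
  unfold d2 bump
  constructor
  · rw [← sub_nonneg]
    have : 8 * z ^ 2 * ((b ^ 2 + x ^ 2)⁻¹ * ((b ^ 2 + (x + z) ^ 2)⁻¹ + (b ^ 2 + (x - z) ^ 2)⁻¹)) -
        ((b ^ 2 + (x + z) ^ 2)⁻¹ + (b ^ 2 + (x - z) ^ 2)⁻¹ - 2 * (b ^ 2 + x ^ 2)⁻¹) =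
        z ^ 2 * (16 * (b ^ 2 + x ^ 2 + z ^ 2) - 2 * (4 * x ^ 2 - (b ^ 2 + x ^ 2) - z ^ 2)) /
        ((b ^ 2 + x ^ 2) * (b ^ 2 + (x + z) ^ 2) * (b ^ 2 + (x - z) ^ 2)) := by
      field_simp; ring
    rw [this]
    refine div_nonneg (mul_nonneg (sq_nonneg z) ?_) (by positivity)
    nlinarith [sq_nonneg b, sq_nonneg x, sq_nonneg z]
  · rw [← sub_nonneg]
    have : ((b ^ 2 + (x + z) ^ 2)⁻¹ + (b ^ 2 + (x - z) ^ 2)⁻¹ - 2 * (b ^ 2 + x ^ 2)⁻¹) -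
        -(z ^ 2 * ((b ^ 2 + x ^ 2)⁻¹ * ((b ^ 2 + (x + z) ^ 2)⁻¹ + (b ^ 2 + (x - z) ^ 2)⁻¹))) =
        z ^ 2 * (8 * x ^ 2) /
        ((b ^ 2 + x ^ 2) * (b ^ 2 + (x + z) ^ 2) * (b ^ 2 + (x - z) ^ 2)) := by
      field_simp; ring
    rw [this]; positivity

theorem hl_bump_bounds {b : ℝ} (hb : 0 < b) (x : ℝ) :
    hl (bump b) x ≤ 8 / b * bump b x ∧ -(1 / b * bump b x) ≤ hl (bump b) x := by
  have hpi := Real.pi_pos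
  obtain ⟨hi, he⟩ := integral_bump_pair hb x
  have hInt := integrable_d2 (contDiff_bump hb) (M := (b ^ 2)⁻¹)
    (fun x => by rw [abs_of_pos (bump_pos hb x)]; exact bump_le hb x) x
  have hb0 := bump_pos hb x
  constructor
  · have : hl (bump b) x ≤
        ∫ z, 8 * bump b x / (2 * Real.pi) * (bump b (x + z) + bump b (x - z)) := by
      refine integral_mono hInt (hi.const_mul _) fun z => ?_
      rcases eq_or_ne z 0 with rfl | hz
      · simp; have := bump_pos hb x; positivity
      have hz2 : 0 < z ^ 2 := by positivity
      simp only
      rw [div_le_iff₀ (by positivity)]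
      refine (d2_bump_bounds hb x z).1.trans (le_of_eq ?_)
      field_simp
    rw [integral_const_mul, he] at this
    refine this.trans (le_of_eq ?_); field_simp
  · have : ∫ z, -(bump b x / (2 * Real.pi)) * (bump b (x + z) + bump b (x - z)) ≤ hl (bump b) x := by
      refine integral_mono (hi.const_mul _) hInt fun z => ?_
      rcases eq_or_ne z 0 with rfl | hz
      · simp; have := bump_pos hb x; positivity
      have hz2 : 0 < z ^ 2 := by positivity
      simp only
      rw [le_div_iff₀ (by positivity)]
      refine (le_of_eq ?_).trans (d2_bump_bounds hb x z).2
      field_simp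
    rw [integral_const_mul, he] at this
    refine (le_of_eq ?_).trans this; field_simp

/-- Comparison with the algebraic barrier: a function vanishing at infinity which is, where positive
and far from the origin, a strict subsolution up to a quadratically decaying source, decays
quadratically. -/
theorem exists_decay_of_barrier {R a0 K M : ℝ} (ha0 : 0 < a0) (hK : 0 ≤ K) (hM : 0 ≤ M) :
    ∃ C, 0 ≤ C ∧ ∀ v : ℝ → ℝ, ContDiff ℝ 2 v → Tendsto v atTop (𝓝 0) → Tendsto v atBot (𝓝 0) →
      (∃ B, ∀ x, |v x| ≤ B) → (∀ x, |x| ≤ R → v x ≤ M) →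
      (∀ x, R < |x| → 0 < v x → a0 * v x - K / (1 + x ^ 2) ≤ hl v x) →
      ∀ x, v x ≤ C / (1 + x ^ 2) := by
  set b : ℝ := 16 / a0 with hb_def
  have hb : 0 < b := by positivity
  set C' : ℝ := M * (b ^ 2 + R ^ 2) + (2 / a0) * K * (1 + b ^ 2) with hC'
  have hC'0 : 0 ≤ C' := by positivity
  refine ⟨C' * (1 + (b ^ 2)⁻¹), by positivity, fun v hv htop hbot ⟨B, hB⟩ hin hout => ?_⟩
  have hmain : ∀ x, v x ≤ C' * bump b x := by
    by_contra! hcon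
    obtain ⟨x1, hx1⟩ := hcon
    set u : ℝ → ℝ := fun x => v x - C' * bump b x with hu
    have hucont : Continuous u := hv.continuous.sub ((contDiff_bump hb (n := 0)).continuous.const_mul C')
    have hu0 : Tendsto u (cocompact ℝ) (𝓝 0) := by
      rw [cocompact_eq_atBot_atTop, tendsto_sup]
      constructor
      · simpa using hbot.sub ((tendsto_bump_atBot b).const_mul C')
      · simpa using htop.sub ((tendsto_bump_atTop b).const_mul C')
    obtain ⟨x0, hx0⟩ := hucont.exists_forall_ge' x1 (by
      have : 0 < u x1 := by simp only [hu]; linarith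
      exact (hu0.eventually (gt_mem_nhds this)).mono fun x hx => hx.le)
    have hpos : 0 < u x0 := lt_of_lt_of_le (by simp only [hu]; linarith) (hx0 x1)
    have hb0 := bump_pos hb x0
    have hvpos : C' * bump b x0 < v x0 := by simp only [hu] at hpos; linarith
    rcases le_or_gt |x0| R with hR | hR
    · have h1 := hin x0 hR
      have h2 : M ≤ C' * bump b x0 := by
        unfold bump
        rw [← div_eq_mul_inv, le_div_iff₀ (by positivity)]
        have : x0 ^ 2 ≤ R ^ 2 := by rw [← sq_abs]; gcongr
        have h3 : 0 ≤ (2 / a0) * K * (1 + b ^ 2) := by positivity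
        nlinarith
      linarith
    · have h1 := hout x0 hR (by nlinarith)
      have h2 : hl u x0 ≤ 0 := hl_nonpos_of_forall_le hx0
      have hib : Integrable fun z => d2 (fun y => C' * bump b y) x0 z / (2 * Real.pi * z ^ 2) := by
        refine integrable_d2 (contDiff_const.mul (contDiff_bump hb)) (M := C' * (b ^ 2)⁻¹) ?_ x0
        intro x
        rw [abs_of_nonneg (mul_nonneg hC'0 (bump_pos hb x).le)]
        gcongr; exact bump_le hb x
      rw [hu, hl_sub (integrable_d2 hv hB x0) hib, hl_const_mul] at h2
      have h3 := (hl_bump_bounds hb x0).1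
      have h4 : 8 / b = a0 / 2 := by rw [hb_def]; field_simp; norm_num
      rw [h4] at h3
      have h5 : K / (1 + x0 ^ 2) ≤ a0 / 2 * (C' * bump b x0) := by
        unfold bump
        rw [← div_eq_mul_inv, ← mul_div_assoc, div_le_div_iff₀ (by positivity) (by positivity)]
        have e1 : a0 / 2 * C' = a0 / 2 * (M * (b ^ 2 + R ^ 2)) + K * (1 + b ^ 2) := by
          rw [hC']; field_simp
        rw [e1]
        have : 0 ≤ a0 / 2 * (M * (b ^ 2 + R ^ 2)) := by positivity
        have : K * (b ^ 2 + x0 ^ 2) ≤ K * (1 + b ^ 2) * (1 + x0 ^ 2) := by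
          rw [mul_assoc]; gcongr; nlinarith [mul_nonneg (sq_nonneg b) (sq_nonneg x0)]
        nlinarith [sq_nonneg x0]
      have h6 := mul_le_mul_of_nonneg_left h3 hC'0
      have h7 := mul_lt_mul_of_pos_left hvpos ha0
      linarith
  intro x
  refine (hmain x).trans ?_
  rw [mul_div_assoc]
  gcongr
  unfold bump
  rw [inv_eq_one_div, div_le_div_iff₀ (by positivity) (by positivity)]
  have : (1 + (b ^ 2)⁻¹) * (b ^ 2 + x ^ 2) = b ^ 2 + x ^ 2 + 1 + (b ^ 2)⁻¹ * x ^ 2 := by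
    field_simp; ring
  rw [this]
  have : 0 ≤ (b ^ 2)⁻¹ * x ^ 2 := by positivity
  nlinarith [sq_nonneg b]

/-- Quantitative properties of the periodic force `F = W'`. -/
structure ForceBound (F : ℝ → ℝ) (α K : ℝ) : Prop where
  smooth : ContDiff ℝ 3 F
  periodic : ∀ v, F (v + 1) = F v
  zero : F 0 = 0
  deriv_zero : deriv F 0 = α
  pos : 0 < α
  bound1 : ∀ v, |deriv F v| ≤ K
  bound2 : ∀ v, |deriv (deriv F) v| ≤ K

namespace ForceBound

variable {F : ℝ → ℝ} {α K : ℝ}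

theorem nonneg (h : ForceBound F α K) : 0 ≤ K := (abs_nonneg _).trans (h.bound1 0)

theorem differentiable (h : ForceBound F α K) : Differentiable ℝ F := h.smooth.differentiable (by norm_num)

theorem contDiff_deriv (h : ForceBound F α K) : ContDiff ℝ 2 (deriv F) := by
  have : ContDiff ℝ (2 + 1) F := by norm_num; exact h.smooth
  exact (contDiff_succ_iff_deriv.1 this).2.2

theorem differentiable_deriv (h : ForceBound F α K) : Differentiable ℝ (deriv F) :=
  h.contDiff_deriv.differentiable (by norm_num)

theorem lipschitz (h : ForceBound F α K) (a b : ℝ) : |F a - F b| ≤ K * |a - b| := by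
  simpa using convex_univ.norm_image_sub_le_of_norm_deriv_le (f := F) (C := K) (x := b) (y := a)
    (fun x _ => h.differentiable x) (fun x _ => h.bound1 x) (mem_univ _) (mem_univ _)

theorem lipschitz_deriv (h : ForceBound F α K) (a b : ℝ) : |deriv F a - deriv F b| ≤ K * |a - b| := by
  simpa using convex_univ.norm_image_sub_le_of_norm_deriv_le (f := deriv F) (C := K) (x := b) (y := a)
    (fun x _ => h.differentiable_deriv x) (fun x _ => h.bound2 x) (mem_univ _) (mem_univ _)

theorem taylor (h : ForceBound F α K) (a s : ℝ) : |F (a + s) - F a - deriv F a * s| ≤ K * s ^ 2 := by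
  have hder : ∀ t, HasDerivAt (fun t => F (a + t) - F a - deriv F a * t)
      (deriv F (a + t) - deriv F a) t := by
    intro t
    have h1 : HasDerivAt (fun t => F (a + t)) (deriv F (a + t)) t := by
      simpa using (h.differentiable (a + t)).hasDerivAt.comp_const_add a t
    have h3 := (h1.sub_const (F a)).sub ((hasDerivAt_id t).const_mul (deriv F a))
    rw [mul_one] at h3
    exact h3
  have := (convex_uIcc 0 s).norm_image_sub_le_of_norm_hasDerivWithin_le
    (f := fun t => F (a + t) - F a - deriv F a * t) (C := K * |s|) (x := 0) (y := s)
    (fun t _ => (hder t).hasDerivWithinAt) (fun t ht => by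
      have hts : |t| ≤ |s| := by simpa using abs_sub_left_of_mem_uIcc ht
      have := h.lipschitz_deriv (a + t) a
      rw [add_sub_cancel_left] at this
      exact this.trans (mul_le_mul_of_nonneg_left hts h.nonneg))
    left_mem_uIcc right_mem_uIcc
  simp only [add_zero, sub_self, mul_zero, sub_zero, Real.norm_eq_abs] at this
  refine this.trans (le_of_eq ?_)
  rw [mul_assoc, ← sq, sq_abs]

theorem abs_sub_linear_le (h : ForceBound F α K) (v : ℝ) : |F v - α * v| ≤ K * v ^ 2 := by
  simpa [h.zero, h.deriv_zero] using h.taylor 0 v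

theorem abs_sub_linear_le_one (h : ForceBound F α K) (v : ℝ) : |F v - α * (v - 1)| ≤ K * (v - 1) ^ 2 := by
  have := h.periodic (v - 1)
  rw [sub_add_cancel] at this
  rw [this]; exact h.abs_sub_linear_le _

theorem deriv_periodic (h : ForceBound F α K) (v : ℝ) : deriv F (v + 1) = deriv F v := by
  have : (fun v => F (v + 1)) = F := funext h.periodic
  conv_rhs => rw [← this]
  rw [deriv_comp_add_const]

theorem abs_deriv_sub_le (h : ForceBound F α K) (v : ℝ) : |deriv F v - α| ≤ K * |v| := by
  simpa [h.deriv_zero] using h.lipschitz_deriv v 0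

theorem abs_deriv_sub_le_one (h : ForceBound F α K) (v : ℝ) : |deriv F v - α| ≤ K * |v - 1| := by
  have := h.deriv_periodic (v - 1)
  rw [sub_add_cancel] at this
  rw [this]; exact h.abs_deriv_sub_le _

end ForceBound

/-- A `C⁴` increasing layer profile for the force `F`. -/
structure Layer (F φ : ℝ → ℝ) : Prop where
  smooth : ContDiff ℝ 4 φ
  eqn : ∀ x, hl φ x = F (φ x)
  bot : Tendsto φ atBot (𝓝 0)
  top : Tendsto φ atTop (𝓝 1)
  deriv_pos : ∀ x, 0 < deriv φ x

namespace Layer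

variable {F φ : ℝ → ℝ} {α K : ℝ}

theorem strictMono (hφ : Layer F φ) : StrictMono φ := strictMono_of_deriv_pos hφ.deriv_pos

theorem pos (hφ : Layer F φ) (x : ℝ) : 0 < φ x :=
  (hφ.strictMono.monotone.le_of_tendsto hφ.bot (x - 1)).trans_lt (hφ.strictMono (by linarith))

theorem lt_one (hφ : Layer F φ) (x : ℝ) : φ x < 1 :=
  (hφ.strictMono (show x < x + 1 by linarith)).trans_le (hφ.strictMono.monotone.ge_of_tendsto hφ.top _)

theorem abs_le_one (hφ : Layer F φ) (x : ℝ) : |φ x| ≤ 1 := by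
  rw [abs_of_pos (hφ.pos x)]; exact (hφ.lt_one x).le

theorem contDiff_two (hφ : Layer F φ) : ContDiff ℝ 2 φ := hφ.smooth.of_le (by norm_num)

theorem contDiff_deriv (hφ : Layer F φ) : ContDiff ℝ 3 (deriv φ) := by
  have : ContDiff ℝ (3 + 1) φ := by norm_num; exact hφ.smooth
  exact (contDiff_succ_iff_deriv.1 this).2.2

theorem contDiff_deriv_two (hφ : Layer F φ) : ContDiff ℝ 2 (deriv φ) :=
  hφ.contDiff_deriv.of_le (by norm_num)

theorem contDiff_deriv_deriv (hφ : Layer F φ) : ContDiff ℝ 2 (deriv (deriv φ)) := by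
  have : ContDiff ℝ (2 + 1) (deriv φ) := by norm_num; exact hφ.contDiff_deriv
  exact (contDiff_succ_iff_deriv.1 this).2.2

theorem differentiable (hφ : Layer F φ) : Differentiable ℝ φ := hφ.smooth.differentiable (by norm_num)

theorem differentiable_deriv (hφ : Layer F φ) : Differentiable ℝ (deriv φ) :=
  hφ.contDiff_deriv.differentiable (by norm_num)

/-- Away from the transition region the linearised force is uniformly coercive. -/
theorem exists_coercive (hF : ForceBound F α K) (hφ : Layer F φ) :
    ∃ R, 0 ≤ R ∧ ∀ x, R ≤ |x| → α / 2 ≤ deriv F (φ x) := by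
  have hc : Continuous (deriv F) := hF.contDiff_deriv.continuous
  have h1 : deriv F 1 = α := by have := hF.deriv_periodic 0; simpa [hF.deriv_zero] using this
  have hα := hF.pos
  have ht : Tendsto (fun x => deriv F (φ x)) atTop (𝓝 α) := by
    rw [← h1]; exact (hc.tendsto 1).comp hφ.top
  have hb : Tendsto (fun x => deriv F (φ x)) atBot (𝓝 α) := by
    rw [← hF.deriv_zero]; exact (hc.tendsto 0).comp hφ.bot
  obtain ⟨A, hA⟩ := eventually_atTop.1 (ht.eventually (lt_mem_nhds (show α / 2 < α by linarith)))
  obtain ⟨B, hB⟩ := eventually_atBot.1 (hb.eventually (lt_mem_nhds (show α / 2 < α by linarith)))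
  refine ⟨max 0 (max A (-B)), le_max_left _ _, fun x hx => ?_⟩
  have hx1 := (le_max_left _ _).trans ((le_max_right _ _).trans hx)
  have hx2 := (le_max_right _ _).trans ((le_max_right _ _).trans hx)
  rcases le_total 0 x with h | h
  · rw [abs_of_nonneg h] at hx1; exact (hA x hx1).le
  · rw [abs_of_nonpos h] at hx2; exact (hB x (by linarith)).le

/-- Difference quotient. -/
def quot (u : ℝ → ℝ) (h x : ℝ) : ℝ := (u (x + h) - u x) / h

theorem contDiff_quot {u : ℝ → ℝ} {n : WithTop ℕ∞} (hu : ContDiff ℝ n u) (h : ℝ) :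
    ContDiff ℝ n (quot u h) := by
  unfold quot; exact ((hu.comp (by fun_prop)).sub hu).div_const h

theorem tendsto_quot {u : ℝ → ℝ} {l : Filter ℝ} {a : ℝ} (hl : Tendsto u l (𝓝 a)) {h : ℝ}
    (hs : Tendsto (fun x => x + h) l l) : Tendsto (quot u h) l (𝓝 0) := by
  have := ((hl.comp hs).sub hl).div_const h
  rwa [sub_self, zero_div] at this

theorem quot_mem {u : ℝ → ℝ} (hu : Differentiable ℝ u) {h : ℝ} (hh : 0 < h) (x : ℝ) :
    ∃ y ∈ Ioo x (x + h), quot u h x = deriv u y := by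
  obtain ⟨y, hy, he⟩ := exists_deriv_eq_slope u (show x < x + h by linarith)
    hu.continuous.continuousOn hu.differentiableOn
  exact ⟨y, hy, by rw [he]; simp [quot]⟩

theorem tendsto_quot_zero {u : ℝ → ℝ} (hu : Differentiable ℝ u) (x : ℝ) :
    Tendsto (fun n : ℕ => quot u (1 / ((n : ℝ) + 1)) x) atTop (𝓝 (deriv u x)) := by
  have h1 := (hasDerivAt_iff_tendsto_slope_zero.1 (hu x).hasDerivAt)
  have h2 : Tendsto (fun n : ℕ => (1 / ((n : ℝ) + 1))) atTop (𝓝[≠] 0) := by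
    refine tendsto_nhdsWithin_iff.2 ⟨tendsto_one_div_add_atTop_nhds_zero_nat, ?_⟩
    exact Eventually.of_forall fun n => by
      have : (0:ℝ) < 1 / ((n : ℝ) + 1) := by positivity
      exact this.ne'
  refine (h1.comp h2).congr fun n => ?_
  simp [quot, div_eq_inv_mul]

theorem hl_quot {u : ℝ → ℝ} (hu : ContDiff ℝ 2 u) {M : ℝ} (hb : ∀ x, |u x| ≤ M) (h x : ℝ) :
    hl (quot u h) x = (hl u (x + h) - hl u x) / h := by
  have h1 : quot u h = fun y => h⁻¹ * (u (y + h) - u y) := by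
    ext y; simp [quot, div_eq_inv_mul]
  rw [h1, hl_const_mul, hl_sub, hl_comp_add, div_eq_inv_mul]
  · exact integrable_d2 (hu.comp (by fun_prop)) (fun y => hb _) x
  · exact integrable_d2 hu hb x

theorem abs_quot_le {u : ℝ → ℝ} {M : ℝ} (hb : ∀ x, |u x| ≤ M) {h : ℝ} (hh : 0 < h) (x : ℝ) :
    |quot u h x| ≤ 2 * M / h := by
  unfold quot
  rw [abs_div, abs_of_pos hh]
  gcongr
  have h1 := abs_le.1 (hb (x + h)); have h2 := abs_le.1 (hb x)
  rw [abs_le]; constructor <;> linarith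

theorem tendsto_add_atTop' (h : ℝ) : Tendsto (fun x : ℝ => x + h) atTop atTop :=
  tendsto_atTop_add_const_right _ _ tendsto_id

theorem tendsto_add_atBot' (h : ℝ) : Tendsto (fun x : ℝ => x + h) atBot atBot :=
  tendsto_atBot_add_const_right _ _ tendsto_id

/-- Quadratic decay of the derivative of the layer. -/
theorem exists_deriv_le (hF : ForceBound F α K) (hφ : Layer F φ) :
    ∃ C, 0 ≤ C ∧ ∀ x, deriv φ x ≤ C / (1 + x ^ 2) := by
  obtain ⟨R, hR0, hR⟩ := hφ.exists_coercive hF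
  obtain ⟨M, hM⟩ := (isCompact_Icc (a := -R - 2) (b := R + 2)).exists_bound_of_continuousOn
    hφ.contDiff_deriv.continuous.continuousOn
  have hM0 : 0 ≤ M := (norm_nonneg _).trans (hM 0 ⟨by linarith, by linarith⟩)
  obtain ⟨C, hC0, hC⟩ := exists_decay_of_barrier (R := R + 1) (a0 := α / 2) (K := 0) (M := M)
    (half_pos hF.pos) le_rfl hM0
  refine ⟨C, hC0, fun x => ?_⟩
  refine le_of_tendsto (tendsto_quot_zero hφ.differentiable x) (Eventually.of_forall fun n => ?_)
  set h : ℝ := 1 / ((n : ℝ) + 1) with hh_def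
  have hh : 0 < h := by positivity
  have hh1 : h ≤ 1 := by
    rw [hh_def, div_le_one (by positivity)]; linarith [Nat.cast_nonneg (α := ℝ) n]
  refine hC (quot φ h) (contDiff_quot hφ.contDiff_two h) (tendsto_quot hφ.top (tendsto_add_atTop' h))
    (tendsto_quot hφ.bot (tendsto_add_atBot' h)) ⟨_, abs_quot_le hφ.abs_le_one hh⟩ ?_ ?_ x
  · intro x hx
    obtain ⟨y, hy, he⟩ := quot_mem hφ.differentiable hh x
    rw [he]
    have := abs_le.1 hx
    exact (le_abs_self _).trans (hM y ⟨by linarith [hy.1], by linarith [hy.2]⟩)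
  · intro x hx _
    rw [hl_quot hφ.contDiff_two hφ.abs_le_one, hφ.eqn, hφ.eqn, zero_div, sub_zero]
    unfold quot
    rw [← mul_div_assoc]
    gcongr
    have hd : ∀ y, HasDerivAt (fun y => F (φ y) - α / 2 * φ y)
        (deriv F (φ y) * deriv φ y - α / 2 * deriv φ y) y := fun y =>
      ((hF.differentiable _).hasDerivAt.comp y (hφ.differentiable y).hasDerivAt).sub
        ((hφ.differentiable y).hasDerivAt.const_mul _)
    have hmono : MonotoneOn (fun y => F (φ y) - α / 2 * φ y) (Icc x (x + h)) := by
      refine monotoneOn_of_deriv_nonneg (convex_Icc _ _)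
        (fun y _ => (hd y).continuousAt.continuousWithinAt)
        (fun y _ => (hd y).differentiableAt.differentiableWithinAt) fun y hy => ?_
      rw [interior_Icc] at hy
      rw [(hd y).deriv, ← sub_mul]
      refine mul_nonneg (sub_nonneg.2 (hR y ?_)) (hφ.deriv_pos y).le
      rcases lt_abs.1 hx with h1 | h1
      · exact le_trans (by linarith [hy.1]) (le_abs_self y)
      · exact le_trans (by linarith [hy.2]) (neg_le_abs y)
    have := hmono ⟨le_rfl, by linarith⟩ ⟨by linarith, le_rfl⟩ (show x ≤ x + h by linarith)
    simp only at this
    linarith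

/-- Differentiating the layer equation. -/
theorem hl_deriv (hF : ForceBound F α K) (hφ : Layer F φ) (x : ℝ) :
    hl (deriv φ) x = deriv F (φ x) * deriv φ x := by
  obtain ⟨C, hC0, hC⟩ := hφ.exists_deriv_le hF
  have hbd : ∀ y, |deriv φ y| ≤ C := fun y => by
    rw [abs_of_pos (hφ.deriv_pos y)]
    refine (hC y).trans (div_le_self hC0 (by nlinarith [sq_nonneg y]))
  have h1 : Tendsto (fun n : ℕ => hl (quot φ (1 / ((n : ℝ) + 1))) x) atTop
      (𝓝 (deriv F (φ x) * deriv φ x)) := by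
    have hd : Differentiable ℝ (fun y => F (φ y)) := hF.differentiable.comp hφ.differentiable
    have := tendsto_quot_zero hd x
    rw [show deriv (fun y => F (φ y)) x = deriv F (φ x) * deriv φ x from
      ((hF.differentiable _).hasDerivAt.comp x (hφ.differentiable x).hasDerivAt).deriv] at this
    refine this.congr fun n => ?_
    rw [hl_quot hφ.contDiff_two hφ.abs_le_one, hφ.eqn, hφ.eqn, quot]
  refine tendsto_nhds_unique ?_ h1
  obtain ⟨M, hM⟩ := (isCompact_Icc (a := x - 1) (b := x + 2)).exists_bound_of_continuousOn
    hφ.contDiff_deriv_deriv.deriv_of_two.continuous.continuousOn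
  set D := max M (4 * C)
  refine tendsto_integral_of_dominated_convergence (fun z => D / Real.pi * (1 + z ^ 2)⁻¹)
    (fun n => (measurable_d2_div_right (contDiff_quot hφ.contDiff_two _).continuous x).aestronglyMeasurable)
    (integrable_inv_one_add_sq.const_mul _) (fun n => Eventually.of_forall fun z => ?_)
    (Eventually.of_forall fun z => ?_)
  · set h : ℝ := 1 / ((n : ℝ) + 1) with hh_def
    have hh : 0 < h := by positivity
    have hh1 : h ≤ 1 := by
      rw [hh_def, div_le_one (by positivity)]; linarith [Nat.cast_nonneg (α := ℝ) n]
    have hb : ∀ y, |quot φ h y| ≤ C := fun y => by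
      obtain ⟨t, -, he⟩ := quot_mem hφ.differentiable hh y
      rw [he]; exact hbd t
    have hb' := abs_d2_le_of_abs_le hb x z
    refine abs_d2_div_le ?_ (hb'.trans (le_max_right _ _))
    rcases le_total |z| 1 with hz | hz
    · refine (abs_d2_le_mul_sq (contDiff_quot hφ.contDiff_two h) (M := M) fun y hy => ?_).trans
        (mul_le_mul_of_nonneg_right (le_max_left _ _) (sq_nonneg _))
      have e1 : ∀ {u : ℝ → ℝ}, Differentiable ℝ u → deriv (quot u h) = quot (deriv u) h := by
        intro u hu; ext y
        have h1 : HasDerivAt (fun t => u (t + h)) (deriv u (y + h)) y :=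
          (hu (y + h)).hasDerivAt.comp_add_const y h
        exact ((h1.sub (hu y).hasDerivAt).div_const h).deriv
      rw [e1 hφ.differentiable, e1 hφ.differentiable_deriv]
      obtain ⟨t, ht, he⟩ := quot_mem (hφ.contDiff_deriv_deriv.differentiable (by norm_num)) hh y
      rw [he]
      have := abs_le.1 (hy.trans hz)
      exact hM t ⟨by linarith [ht.1], by linarith [ht.2]⟩
    · have hz2 : 1 ≤ z ^ 2 := by rw [← sq_abs]; nlinarith
      have h4 := le_max_right M (4 * C)
      have : 0 ≤ D := le_trans (by linarith) h4
      nlinarith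
  · have := fun y => tendsto_quot_zero hφ.differentiable y
    exact (((this (x + z)).add (this (x - z))).sub ((this x).const_mul 2)).div_const _

end Layer

theorem le_of_tendsto_atBot_of_deriv_le {u : ℝ → ℝ} {C a : ℝ} (hC : 0 ≤ C) (hu : Differentiable ℝ u)
    (h : ∀ y, deriv u y ≤ C / (1 + y ^ 2)) (ht : Tendsto u atBot (𝓝 a)) {x : ℝ} (hx : x < 0) :
    u x ≤ a + C / |x| := by
  have hd : ∀ y ∈ Iic x, HasDerivAt (fun y => u y + C / y) (deriv u y + C * -(y ^ 2)⁻¹) y := by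
    intro y hy
    have hy0 : y ≠ 0 := (lt_of_le_of_lt hy hx).ne
    exact (hu y).hasDerivAt.add ((hasDerivAt_inv hy0).const_mul C)
  have hanti : AntitoneOn (fun y => u y + C / y) (Iic x) := by
    refine antitoneOn_of_deriv_nonpos (convex_Iic x)
      (fun y hy => (hd y hy).continuousAt.continuousWithinAt)
      (fun y hy => (hd y (interior_subset hy)).differentiableAt.differentiableWithinAt) fun y hy => ?_
    have hy' := interior_subset hy
    have hy0 : y ≠ 0 := (lt_of_le_of_lt hy' hx).ne
    rw [(hd y hy').deriv]
    have h1 := h y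
    have h2 : C / (1 + y ^ 2) ≤ C / y ^ 2 := by
      have : 0 < y ^ 2 := by positivity
      gcongr; linarith
    rw [mul_neg, ← div_eq_mul_inv]; linarith
  have hlim : Tendsto (fun y => u y + C / y) atBot (𝓝 (a + C * 0)) :=
    ht.add (tendsto_inv_atBot_zero.const_mul C)
  rw [mul_zero, add_zero] at hlim
  have h1 : u x + C / x ≤ a := ge_of_tendsto hlim ((eventually_le_atBot x).mono fun y hy =>
    hanti hy (le_refl x) hy)
  rw [abs_of_neg hx, div_neg]; linarith

namespace Layer

variable {F φ : ℝ → ℝ} {α K : ℝ}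

/-- Algebraic tails of the layer. -/
theorem exists_tail (hF : ForceBound F α K) (hφ : Layer F φ) :
    ∃ C, 0 ≤ C ∧ (∀ x ≤ 0, φ x ≤ C / (1 + |x|)) ∧ ∀ x, 0 ≤ x → 1 - φ x ≤ C / (1 + |x|) := by
  obtain ⟨C, hC0, hC⟩ := hφ.exists_deriv_le hF
  have key : ∀ s t : ℝ, s ≤ 1 → (t ≠ 0 → s ≤ C / |t|) → s ≤ (2 * C + 2) / (1 + |t|) := by
    intro s t h1 h2
    rw [le_div_iff₀ (by positivity)]
    rcases le_total |t| 1 with ht | ht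
    · nlinarith [abs_nonneg t]
    · have ht0 : 0 < |t| := by linarith
      have := h2 (abs_pos.1 ht0)
      rw [le_div_iff₀ ht0] at this
      nlinarith
  refine ⟨2 * C + 2, by positivity, fun x hx => key _ _ (hφ.lt_one x).le fun h0 => ?_,
    fun x hx => key _ _ (by linarith [hφ.pos x]) fun h0 => ?_⟩
  · simpa using le_of_tendsto_atBot_of_deriv_le hC0 hφ.differentiable hC hφ.bot (lt_of_le_of_ne hx h0)
  · have hd : ∀ y, HasDerivAt (fun y => -φ (-y)) (deriv φ (-y)) y := fun y => by
      have := ((hφ.differentiable (-y)).hasDerivAt.comp y (hasDerivAt_neg y)).neg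
      rw [mul_neg_one, neg_neg] at this
      exact this
    have := le_of_tendsto_atBot_of_deriv_le (u := fun y => -φ (-y)) (x := -x) hC0
      (fun y => (hd y).differentiableAt)
      (fun y => by rw [(hd y).deriv]; simpa using hC (-y))
      ((hφ.top.comp tendsto_neg_atBot_atTop).neg) (by have := lt_of_le_of_ne hx h0.symm; linarith)
    simp only [neg_neg, abs_neg] at this
    linarith

theorem exists_abs_deriv_force_sub_le (hF : ForceBound F α K) (hφ : Layer F φ) :
    ∃ C, 0 ≤ C ∧ ∀ x, |deriv F (φ x) - α| ≤ C / (1 + |x|) := by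
  obtain ⟨C, hC0, h1, h2⟩ := hφ.exists_tail hF
  have hK := hF.nonneg
  refine ⟨K * C, by positivity, fun x => ?_⟩
  rw [mul_div_assoc]
  rcases le_total x 0 with hx | hx
  · refine (hF.abs_deriv_sub_le _).trans (mul_le_mul_of_nonneg_left ?_ hK)
    rw [abs_of_pos (hφ.pos x)]; exact h1 x hx
  · refine (hF.abs_deriv_sub_le_one _).trans (mul_le_mul_of_nonneg_left ?_ hK)
    rw [abs_sub_comm, abs_of_pos (by linarith [hφ.lt_one x])]; exact h2 x hx

theorem tendsto_deriv_zero (hF : ForceBound F α K) (hφ : Layer F φ) :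
    Tendsto (deriv φ) atTop (𝓝 0) ∧ Tendsto (deriv φ) atBot (𝓝 0) := by
  obtain ⟨C, hC0, hC⟩ := hφ.exists_deriv_le hF
  have h1 : Tendsto (fun x => C * bump 1 x) atTop (𝓝 0) := by
    simpa using (tendsto_bump_atTop 1).const_mul C
  have h2 : Tendsto (fun x => C * bump 1 x) atBot (𝓝 0) := by
    simpa using (tendsto_bump_atBot 1).const_mul C
  have h3 : ∀ x, deriv φ x ≤ C * bump 1 x := fun x => by
    simpa [bump, div_eq_mul_inv] using hC x
  exact ⟨squeeze_zero (fun x => (hφ.deriv_pos x).le) h3 h1,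
    squeeze_zero (fun x => (hφ.deriv_pos x).le) h3 h2⟩

theorem exists_abs_deriv_le (hF : ForceBound F α K) (hφ : Layer F φ) :
    ∃ C, 0 ≤ C ∧ ∀ x, |deriv φ x| ≤ C := by
  obtain ⟨C, hC0, hC⟩ := hφ.exists_deriv_le hF
  refine ⟨C, hC0, fun y => ?_⟩
  rw [abs_of_pos (hφ.deriv_pos y)]
  exact (hC y).trans (div_le_self hC0 (by nlinarith [sq_nonneg y]))

/-- Quadratic decay of the second derivative of the layer. -/
theorem exists_abs_deriv_deriv_le (hF : ForceBound F α K) (hφ : Layer F φ) :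
    ∃ C, 0 ≤ C ∧ ∀ x, |deriv (deriv φ) x| ≤ C / (1 + x ^ 2) := by
  obtain ⟨D, hD0, hD⟩ := hφ.exists_deriv_le hF
  have hbd : ∀ y, |deriv φ y| ≤ D := fun y => by
    rw [abs_of_pos (hφ.deriv_pos y)]
    exact (hD y).trans (div_le_self hD0 (by nlinarith [sq_nonneg y]))
  have hK := hF.nonneg
  obtain ⟨R, hR0, hR⟩ := hφ.exists_coercive hF
  obtain ⟨M, hM⟩ := (isCompact_Icc (a := -R - 2) (b := R + 2)).exists_bound_of_continuousOn
    hφ.contDiff_deriv_deriv.continuous.continuousOn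
  have hM0 : 0 ≤ M := (norm_nonneg _).trans (hM 0 ⟨by linarith, by linarith⟩)
  obtain ⟨C, hC0, hC⟩ := exists_decay_of_barrier (R := R + 1) (a0 := α / 2) (K := K * D * D) (M := M)
    (half_pos hF.pos) (by positivity) hM0
  obtain ⟨ht1, ht2⟩ := hφ.tendsto_deriv_zero hF
  have key : ∀ n : ℕ, ∀ s : ℝ, |s| = 1 → ∀ x,
      s * quot (deriv φ) (1 / ((n : ℝ) + 1)) x ≤ C / (1 + x ^ 2) := by
    intro n s hs x
    set h : ℝ := 1 / ((n : ℝ) + 1) with hh_def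
    have hh : 0 < h := by positivity
    have hh1 : h ≤ 1 := by
      rw [hh_def, div_le_one (by positivity)]; linarith [Nat.cast_nonneg (α := ℝ) n]
    have hs1 : s ≤ 1 := (le_abs_self s).trans hs.le
    have l1 := (tendsto_quot ht1 (tendsto_add_atTop' h)).const_mul s
    have l2 := (tendsto_quot ht2 (tendsto_add_atBot' h)).const_mul s
    rw [mul_zero] at l1 l2
    refine hC (fun x => s * quot (deriv φ) h x)
      (contDiff_const.mul (contDiff_quot hφ.contDiff_deriv_two h)) l1 l2 ⟨2 * D / h, fun x => ?_⟩
      ?_ ?_ x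
    · rw [abs_mul, hs, one_mul]; exact abs_quot_le hbd hh x
    · intro x hx
      obtain ⟨y, hy, he⟩ := quot_mem hφ.differentiable_deriv hh x
      have := abs_le.1 hx
      have h1 := hM y ⟨by linarith [hy.1], by linarith [hy.2]⟩
      refine (le_abs_self _).trans ?_
      rw [abs_mul, hs, one_mul, he]; exact h1
    · intro x hx hpos
      rw [hl_const_mul, hl_quot hφ.contDiff_deriv_two hbd, hφ.hl_deriv hF, hφ.hl_deriv hF]
      have hQ : α / 2 ≤ deriv F (φ (x + h)) := hR _ (by
        rcases lt_abs.1 hx with h1 | h1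
        · exact le_trans (by linarith) (le_abs_self _)
        · exact le_trans (by linarith) (neg_le_abs _))
      have e : (deriv F (φ (x + h)) * deriv φ (x + h) - deriv F (φ x) * deriv φ x) / h =
          deriv F (φ (x + h)) * quot (deriv φ) h x
            + deriv φ x * ((deriv F (φ (x + h)) - deriv F (φ x)) / h) := by
        unfold quot; field_simp; ring
      have hsrc : |(deriv F (φ (x + h)) - deriv F (φ x)) / h| ≤ K * D := by
        rw [abs_div, abs_of_pos hh, div_le_iff₀ hh]
        refine (hF.lipschitz_deriv _ _).trans ?_
        obtain ⟨y, -, he⟩ := quot_mem hφ.differentiable hh x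
        rw [quot, div_eq_iff hh.ne'] at he
        rw [he, abs_mul, abs_of_pos hh, mul_assoc]
        have := hbd y
        gcongr
      have hsrc2 : |s * (deriv φ x * ((deriv F (φ (x + h)) - deriv F (φ x)) / h))| ≤
          K * D * D / (1 + x ^ 2) := by
        rw [abs_mul, hs, one_mul, abs_mul, abs_of_pos (hφ.deriv_pos x), mul_div_assoc, mul_comm]
        exact mul_le_mul hsrc (hD x) (hφ.deriv_pos x).le (by positivity)
      rw [e, mul_add]
      have h3 := (abs_le.1 hsrc2).1
      have h4 := mul_le_mul_of_nonneg_right hQ hpos.le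
      nlinarith
  refine ⟨C, hC0, fun x => ?_⟩
  have hlim := tendsto_quot_zero hφ.differentiable_deriv x
  refine abs_le.2 ⟨?_, ?_⟩
  · have := le_of_tendsto hlim.neg (Eventually.of_forall fun n => by
      have := key n (-1) (by simp) x
      rwa [neg_one_mul] at this)
    linarith
  · exact le_of_tendsto hlim (Eventually.of_forall fun n => by
      have := key n 1 (by simp) x
      rwa [one_mul] at this)

/-- The layer is odd about its centre up to a quadratically decaying error. -/
theorem exists_abs_symm_le (hF : ForceBound F α K) (hφ : Layer F φ) :
    ∃ C, 0 ≤ C ∧ ∀ x, |φ x + φ (-x) - 1| ≤ C / (1 + x ^ 2) := by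
  obtain ⟨D, hD0, hD1, hD2⟩ := hφ.exists_tail hF
  have hK := hF.nonneg
  obtain ⟨C, hC0, hC⟩ := exists_decay_of_barrier (R := 0) (a0 := α) (K := 2 * K * D ^ 2) (M := 1)
    hF.pos (by positivity) zero_le_one
  set g : ℝ → ℝ := fun x => φ x + φ (-x) - 1 with hg
  have hcn : ContDiff ℝ 2 fun x => φ (-x) := hφ.contDiff_two.comp (by fun_prop)
  have hgs : ContDiff ℝ 2 g := (hφ.contDiff_two.add hcn).sub contDiff_const
  have hb : ∀ x, |g x| ≤ 1 := fun x => by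
    have h1 := hφ.pos x; have h2 := hφ.lt_one x; have h3 := hφ.pos (-x); have h4 := hφ.lt_one (-x)
    rw [abs_le]; constructor <;> simp only [hg] <;> linarith
  have hlg : ∀ x, hl g x = F (φ x) + F (φ (-x)) := fun x => by
    have h1 := hl_add_const (fun x => φ x + φ (-x)) (-1) x
    rw [hl_add (integrable_d2 hφ.contDiff_two hφ.abs_le_one x)
      (integrable_d2 hcn (fun y => hφ.abs_le_one (-y)) x), hl_comp_neg, hφ.eqn, hφ.eqn] at h1
    exact h1
  have half : ∀ x, 0 ≤ x → |F (φ x) + F (φ (-x)) - α * g x| ≤ 2 * K * D ^ 2 / (1 + x ^ 2) := by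
    intro x hx
    have h1 := hF.abs_sub_linear_le_one (φ x)
    have h2 := hF.abs_sub_linear_le (φ (-x))
    have h3 := hD2 x hx
    have h4 := hD1 (-x) (by linarith)
    rw [abs_neg] at h4
    have hsq : (D / (1 + |x|)) ^ 2 ≤ D ^ 2 / (1 + x ^ 2) := by
      rw [div_pow]
      gcongr
      nlinarith [abs_nonneg x, sq_abs x]
    have h5 : (φ x - 1) ^ 2 ≤ D ^ 2 / (1 + x ^ 2) := by
      refine le_trans ?_ hsq
      rw [← neg_sq]; exact pow_le_pow_left₀ (by linarith [hφ.lt_one x]) (by linarith) 2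
    have h6 : φ (-x) ^ 2 ≤ D ^ 2 / (1 + x ^ 2) :=
      le_trans (pow_le_pow_left₀ (hφ.pos _).le h4 2) hsq
    have e : F (φ x) + F (φ (-x)) - α * g x =
        (F (φ x) - α * (φ x - 1)) + (F (φ (-x)) - α * φ (-x)) := by simp only [hg]; ring
    rw [e]
    refine (abs_add_le _ _).trans ((add_le_add h1 h2).trans ?_)
    have := mul_le_mul_of_nonneg_left (add_le_add h5 h6) hK
    calc _ = K * ((φ x - 1) ^ 2 + φ (-x) ^ 2) := by ring
      _ ≤ _ := this
      _ = _ := by ring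
  have full : ∀ x, |hl g x - α * g x| ≤ 2 * K * D ^ 2 / (1 + x ^ 2) := by
    intro x
    rw [hlg]
    rcases le_total 0 x with hx | hx
    · exact half x hx
    · have := half (-x) (by linarith)
      simpa [hg, add_comm] using this
  have hneg : Tendsto (fun x => φ (-x)) atTop (𝓝 0) := hφ.bot.comp tendsto_neg_atTop_atBot
  have hneg2 : Tendsto (fun x => φ (-x)) atBot (𝓝 1) := hφ.top.comp tendsto_neg_atBot_atTop
  have t1 : Tendsto g atTop (𝓝 0) := by
    simpa [hg] using (hφ.top.add hneg).sub_const 1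
  have t2 : Tendsto g atBot (𝓝 0) := by
    simpa [hg] using (hφ.bot.add hneg2).sub_const 1
  refine ⟨C, hC0, fun x => abs_le.2 ⟨?_, ?_⟩⟩
  · have := hC (fun x => -g x) hgs.neg (by simpa using t1.neg) (by simpa using t2.neg)
      ⟨1, fun x => by rw [abs_neg]; exact hb x⟩ (fun x _ => by linarith [(abs_le.1 (hb x)).1])
      (fun x _ _ => by
        rw [hl_neg]; have := (abs_le.1 (full x)).2; linarith) x
    simp only [hg] at this ⊢
    linarith
  · exact hC g hgs t1 t2 ⟨1, hb⟩ (fun x _ => (abs_le.1 (hb x)).2)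
      (fun x _ _ => by have := (abs_le.1 (full x)).1; linarith) x

end Layer

open scoped InnerProductSpace in
/-- A weak-solvability criterion: a quadratic lower bound modulo a one-dimensional kernel gives
weak solutions of the adjoint problem. -/
theorem exists_inner_eq_of_coercive {V H : Type*} [AddCommGroup V] [Module ℝ V]
    [NormedAddCommGroup H] [InnerProductSpace ℝ H] [CompleteSpace H] (e a : V →ₗ[ℝ] H) {t f : H}
    {c : ℝ} (hc : 0 < c) (ht : t ≠ 0) (h1 : ∀ v, ⟪t, a v⟫_ℝ = 0) (h2 : ⟪f, t⟫_ℝ = 0)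
    (h3 : ∀ v, c * (‖t‖ ^ 2 * ‖e v‖ ^ 2 - ⟪t, e v⟫_ℝ ^ 2) ≤ ⟪e v, a v⟫_ℝ) :
    ∃ ζ : H, ∀ v, ⟪ζ, a v⟫_ℝ = ⟪f, e v⟫_ℝ := by
  have htn : 0 < ‖t‖ := norm_pos_iff.2 ht
  have hb : ∀ v, ‖⟪f, e v⟫_ℝ‖ ≤ ‖f‖ / (c * ‖t‖ ^ 2) * ‖a v‖ := by
    intro v
    set s : ℝ := ⟪t, e v⟫_ℝ / ‖t‖ ^ 2
    set P : H := e v - s • t with hP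
    have e1 : ⟪f, e v⟫_ℝ = ⟪f, P⟫_ℝ := by
      rw [hP, inner_sub_right, inner_smul_right, h2]; ring
    have e2 : ⟪P, a v⟫_ℝ = ⟪e v, a v⟫_ℝ := by
      rw [hP, inner_sub_left, real_inner_smul_left, h1]; ring
    have e3 : ‖t‖ ^ 2 * ‖P‖ ^ 2 = ‖t‖ ^ 2 * ‖e v‖ ^ 2 - ⟪t, e v⟫_ℝ ^ 2 := by
      rw [hP, norm_sub_sq_real, inner_smul_right, norm_smul, mul_pow, Real.norm_eq_abs, sq_abs,
        real_inner_comm]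
      simp only [s]; field_simp; ring
    have e4 : c * ‖t‖ ^ 2 * ‖P‖ ≤ ‖a v‖ := by
      rcases (norm_nonneg P).eq_or_lt with h0 | h0
      · rw [← h0, mul_zero]; exact norm_nonneg _
      · have h4 := h3 v
        rw [← e3, ← e2] at h4
        have h5 := real_inner_le_norm P (a v)
        have : ‖P‖ * (c * ‖t‖ ^ 2 * ‖P‖) ≤ ‖P‖ * ‖a v‖ := by nlinarith
        exact le_of_mul_le_mul_left this h0
    have e5 := abs_real_inner_le_norm f P
    rw [e1, Real.norm_eq_abs, div_mul_eq_mul_div, le_div_iff₀ (by positivity)]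
    nlinarith [norm_nonneg f, mul_le_mul_of_nonneg_left e4 (norm_nonneg f),
      mul_le_mul_of_nonneg_right e5 (by positivity : 0 ≤ c * ‖t‖ ^ 2)]
  let l0 : V →ₗ[ℝ] ℝ := (innerSL ℝ f).toLinearMap.comp e
  have hk : LinearMap.ker a ≤ LinearMap.ker l0 := by
    intro v hv
    rw [LinearMap.mem_ker] at hv ⊢
    have := hb v
    rw [hv, norm_zero, mul_zero, norm_le_zero_iff] at this
    exact this
  let l1 : LinearMap.range a →ₗ[ℝ] ℝ :=
    ((LinearMap.ker a).liftQ l0 hk).comp a.quotKerEquivRange.symm.toLinearMap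
  have hl1 : ∀ v, l1 ⟨a v, LinearMap.mem_range_self a v⟩ = ⟪f, e v⟫_ℝ := by
    intro v
    simp only [l1, LinearMap.comp_apply, LinearEquiv.coe_coe]
    rw [LinearMap.quotKerEquivRange_symm_apply_image, Submodule.mkQ_apply, Submodule.liftQ_apply]
    rfl
  let l2 : LinearMap.range a →L[ℝ] ℝ := l1.mkContinuous (‖f‖ / (c * ‖t‖ ^ 2)) (by
    rintro ⟨_, v, rfl⟩
    rw [hl1]; exact hb v)
  obtain ⟨g, hg, -⟩ := exists_extension_norm_eq _ l2
  refine ⟨(InnerProductSpace.toDual ℝ H).symm g, fun v => ?_⟩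
  rw [InnerProductSpace.toDual_symm_apply, ← hl1 v]
  exact hg ⟨a v, LinearMap.mem_range_self a v⟩

theorem inner_toLp {f g : ℝ → ℝ} (hf : MemLp f 2 volume) (hg : MemLp g 2 volume) :
    inner ℝ (hf.toLp f) (hg.toLp g) = ∫ x, f x * g x := by
  rw [L2.inner_def]
  refine integral_congr_ae ?_
  filter_upwards [hf.coeFn_toLp, hg.coeFn_toLp] with x h1 h2
  rw [h1, h2]; simp [mul_comm]

theorem integral_mul_sq_le {f g : ℝ → ℝ} (hf : MemLp f 2 volume) (hg : MemLp g 2 volume) :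
    |∫ x, f x * g x| ≤ √(∫ x, f x * f x) * √(∫ x, g x * g x) := by
  have := abs_real_inner_le_norm (hf.toLp f) (hg.toLp g)
  rwa [inner_toLp, norm_eq_sqrt_real_inner, norm_eq_sqrt_real_inner (hg.toLp g), inner_toLp,
    inner_toLp] at this

/-- Product integrability and Fubini for `h · hl u`. -/
theorem integral_mul_hl {h u : ℝ → ℝ} (hh : Integrable h) (hu : Continuous u) {C : ℝ}
    (hb : ∀ x, h x ≠ 0 → ∀ z, |d2 u x z| ≤ C * z ^ 2 ∧ |d2 u x z| ≤ C) :
    Integrable (fun x => h x * hl u x) ∧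
    Integrable (fun z => (∫ x, h x * d2 u x z) / (2 * Real.pi * z ^ 2)) ∧
    ∫ x, h x * hl u x = ∫ z, (∫ x, h x * d2 u x z) / (2 * Real.pi * z ^ 2) := by
  have hInt : Integrable (fun p : ℝ × ℝ => h p.1 * (d2 u p.1 p.2 / (2 * Real.pi * p.2 ^ 2)))
      (volume.prod volume) := by
    refine (hh.norm.mul_prod (integrable_inv_one_add_sq.const_mul (C / Real.pi))).mono'
      (hh.aestronglyMeasurable.comp_fst.mul (measurable_d2_div hu).aestronglyMeasurable)
      (Eventually.of_forall fun p => ?_)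
    rw [norm_mul]
    by_cases h0 : h p.1 = 0
    · simp [h0]
    · exact mul_le_mul_of_nonneg_left (abs_d2_div_le (hb _ h0 _).1 (hb _ h0 _).2) (norm_nonneg _)
  have e1 : ∀ x, ∫ z, h x * (d2 u x z / (2 * Real.pi * z ^ 2)) = h x * hl u x := fun x =>
    integral_const_mul _ _
  have e2 : ∀ z, ∫ x, h x * (d2 u x z / (2 * Real.pi * z ^ 2)) =
      (∫ x, h x * d2 u x z) / (2 * Real.pi * z ^ 2) := fun z => by
    rw [← integral_div]; simp_rw [mul_div_assoc]
  have i1 := hInt.integral_prod_left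
  have i2 := hInt.integral_prod_right
  simp only [e1, e2] at i1 i2
  refine ⟨i1, i2, ?_⟩
  simp_rw [← e1, ← e2]
  exact integral_integral_swap hInt

/-- Fubini for correlations. -/
theorem integral_shear {f g : ℝ → ℝ} (hf : Integrable f) (hg : Integrable g) :
    Integrable (fun z => ∫ x, f x * g (x + z)) ∧ ∫ z, ∫ x, f x * g (x + z) = (∫ x, f x) * ∫ x, g x := by
  have hInt : Integrable (fun p : ℝ × ℝ => f p.1 * g (p.1 + p.2)) (volume.prod volume) :=
    ((measurePreserving_prod_add volume volume).integrable_comp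
      (hf.mul_prod hg).aestronglyMeasurable).2 (hf.mul_prod hg)
  refine ⟨hInt.integral_prod_right, ?_⟩
  rw [← integral_integral_swap hInt, ← integral_mul_const]
  congr 1; ext x
  rw [integral_const_mul]
  congr 1
  exact integral_add_left_eq_self g x

theorem integral_add_sub {f g h : ℝ → ℝ} (hf : Integrable f) (hg : Integrable g) (hh : Integrable h) :
    ∫ x, (f x + g x - h x) = (∫ x, f x) + (∫ x, g x) - ∫ x, h x := by
  rw [← integral_add hf hg]; exact integral_sub (hf.add hg) hh

/-- Compactly supported `C²` functions. -/
def cc2 : Submodule ℝ (ℝ → ℝ) where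
  carrier := {η | ContDiff ℝ 2 η ∧ HasCompactSupport η}
  add_mem' h1 h2 := ⟨h1.1.add h2.1, h1.2.add h2.2⟩
  zero_mem' := ⟨contDiff_const, HasCompactSupport.zero⟩
  smul_mem' c _ h := ⟨contDiff_const.smul h.1, h.2.smul_left (f := fun _ => c)⟩

namespace cc2

variable {η : ℝ → ℝ}

theorem continuous (h : η ∈ cc2) : Continuous η := h.1.continuous

theorem exists_bound (h : η ∈ cc2) : ∃ M, ∀ x, |η x| ≤ M := h.2.exists_bound_of_continuous (continuous h)

theorem integrable (h : η ∈ cc2) : Integrable η := (continuous h).integrable_of_hasCompactSupport h.2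

theorem memLp (h : η ∈ cc2) : MemLp η 2 volume := (continuous h).memLp_of_hasCompactSupport h.2

theorem exists_support (h : η ∈ cc2) : ∃ R, 0 < R ∧ ∀ x, R < |x| → η x = 0 := by
  obtain ⟨R, hR⟩ := h.2.isCompact.isBounded.subset_closedBall 0
  refine ⟨max R 1, by positivity, fun x hx => ?_⟩
  by_contra h0
  have := hR (subset_tsupport η h0)
  rw [mem_closedBall, dist_zero_right, Real.norm_eq_abs] at this
  exact absurd (le_max_left R 1) (by linarith)

theorem exists_d2_le (h : η ∈ cc2) : ∃ C, 0 ≤ C ∧ ∀ x z, |d2 η x z| ≤ C * z ^ 2 ∧ |d2 η x z| ≤ C := by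
  obtain ⟨M, hM⟩ := exists_bound h
  obtain ⟨D, hD⟩ := (h.2.deriv.deriv).exists_bound_of_continuous h.1.continuous_deriv_deriv
  have hM0 : 0 ≤ M := (abs_nonneg _).trans (hM 0)
  refine ⟨max D (4 * M), by positivity, fun x z => ⟨?_, ?_⟩⟩
  · exact (abs_d2_le_mul_sq h.1 (M := D) fun y _ => hD y).trans
      (mul_le_mul_of_nonneg_right (le_max_left _ _) (sq_nonneg _))
  · exact (abs_d2_le_of_abs_le hM x z).trans (le_max_right _ _)

theorem integrable_d2 (h : η ∈ cc2) (x : ℝ) : Integrable fun z => d2 η x z / (2 * Real.pi * z ^ 2) := by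
  obtain ⟨M, hM⟩ := exists_bound h
  exact _root_.integrable_d2 h.1 hM x

/-- Quadratic decay of the half-Laplacian of a compactly supported function. -/
theorem exists_abs_hl_le (h : η ∈ cc2) : ∃ C, 0 ≤ C ∧ ∀ x, |hl η x| ≤ C / (1 + x ^ 2) := by
  obtain ⟨R, hR0, hR⟩ := exists_support h
  obtain ⟨C, hC0, hC⟩ := exists_d2_le h
  have hpi := Real.pi_pos
  set I := ∫ x, |η x|
  have hI : 0 ≤ I := integral_nonneg fun _ => abs_nonneg _
  have hη := (integrable h).abs
  refine ⟨max (C * (1 + (2 * R + 1) ^ 2)) (8 * I), by positivity, fun x => ?_⟩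
  rw [le_div_iff₀ (by positivity)]
  rcases le_or_gt |x| (2 * R + 1) with hx | hx
  · refine le_trans ?_ (le_max_left _ _)
    have h1 : |hl η x| ≤ C := abs_hl_le (fun z => (hC x z).1) fun z => (hC x z).2
    have h2 : x ^ 2 ≤ (2 * R + 1) ^ 2 := by rw [← sq_abs]; gcongr
    gcongr
  · refine le_trans ?_ (le_max_right _ _)
    have hx2 : 1 < x ^ 2 := by rw [← sq_abs]; nlinarith
    have key : ‖hl η x‖ ≤ ∫ z, 4 / (2 * x ^ 2) * (|η (x + z)| + |η (x - z)|) := by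
      have hmaj : Integrable fun z => 4 / (2 * x ^ 2) * (|η (x + z)| + |η (x - z)|) :=
        ((hη.comp_add_left x).add (hη.comp_sub_left x)).const_mul _
      refine norm_integral_le_of_norm_le hmaj (Eventually.of_forall fun z => ?_)
      have h0 : η x = 0 := hR x (by linarith)
      simp only [d2, h0, mul_zero, sub_zero]
      rw [norm_div, Real.norm_eq_abs, Real.norm_of_nonneg (by positivity : 0 ≤ 2 * Real.pi * z ^ 2)]
      rcases le_or_gt |z| (|x| / 2) with hz | hz
      · have t1 : R < |x + z| := by
          have := abs_sub_abs_le_abs_sub x (-z); rw [abs_neg, sub_neg_eq_add] at this; linarith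
        have t2 : R < |x - z| := by
          have := abs_sub_abs_le_abs_sub x z; linarith
        rw [hR _ t1, hR _ t2]; simp
      · have t : x ^ 2 / 4 ≤ z ^ 2 := by rw [← sq_abs x, ← sq_abs z]; nlinarith [abs_nonneg x]
        calc |η (x + z) + η (x - z)| / (2 * Real.pi * z ^ 2)
            ≤ (|η (x + z)| + |η (x - z)|) / (2 * 1 * (x ^ 2 / 4)) := by
              gcongr
              · exact abs_add_le _ _
              · linarith [Real.pi_gt_three]
          _ = _ := by field_simp
    rw [integral_const_mul, integral_add (hη.comp_add_left x) (hη.comp_sub_left x),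
      integral_add_left_eq_self (fun y => |η y|) x,
        integral_sub_left_eq_self (fun y => |η y|) volume x] at key
    have e : 4 / (2 * x ^ 2) * (I + I) = 4 * I / x ^ 2 := by field_simp; ring
    change _ ≤ 4 / (2 * x ^ 2) * (I + I) at key
    rw [e, le_div_iff₀ (by linarith), Real.norm_eq_abs] at key
    nlinarith [abs_nonneg (hl η x)]

theorem memLp_of_abs_le {f : ℝ → ℝ} (hf : Measurable f) {C : ℝ} (h : ∀ x, |f x| ≤ C / (1 + x ^ 2)) :
    Integrable f ∧ MemLp f 2 volume := by
  have hC : 0 ≤ C := by simpa using (abs_nonneg _).trans (h 0)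
  refine ⟨(integrable_inv_one_add_sq.const_mul C).mono' hf.aestronglyMeasurable
    (Eventually.of_forall h), ?_⟩
  rw [memLp_two_iff_integrable_sq hf.aestronglyMeasurable]
  refine (integrable_inv_one_add_sq.const_mul (C ^ 2)).mono' (hf.pow_const 2).aestronglyMeasurable
    (Eventually.of_forall fun x => ?_)
  rw [Real.norm_eq_abs, abs_pow]
  refine (pow_le_pow_left₀ (abs_nonneg _) (h x) 2).trans ?_
  rw [div_pow, ← div_eq_mul_inv]
  gcongr
  nlinarith [sq_nonneg x]

theorem memLp_hl (h : η ∈ cc2) : MemLp (hl η) 2 volume := by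
  obtain ⟨C, -, hC⟩ := exists_abs_hl_le h
  exact (memLp_of_abs_le (measurable_hl (continuous h)) hC).2

end cc2

/-- A continuous function vanishing with one of the factors `η, η(· + z)`. -/
theorem integrable_mul_cc2 {η θ : ℝ → ℝ} (h : η ∈ cc2) (hθ : Continuous θ) :
    Integrable fun x => η x * θ x :=
  ((cc2.continuous h).mul hθ).integrable_of_hasCompactSupport h.2.mul_right

/-- Self-adjointness of the half-Laplacian. -/
theorem integral_mul_hl_symm {η θ : ℝ → ℝ} (h : η ∈ cc2) (hθ : ContDiff ℝ 2 θ) (hi : Integrable θ)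
    {M : ℝ} (hM : ∀ x, |θ x| ≤ M) : ∫ x, θ x * hl η x = ∫ x, η x * hl θ x := by
  obtain ⟨C, -, hC⟩ := cc2.exists_d2_le h
  obtain ⟨R, -, hR⟩ := cc2.exists_support h
  obtain ⟨D, -, hD⟩ := exists_d2_bound hθ hM R
  rw [(integral_mul_hl hi (cc2.continuous h) fun x _ => hC x).2.2,
    (integral_mul_hl (cc2.integrable h) hθ.continuous fun x hx => hD x (not_lt.1 fun h' =>
      hx (hR x h'))).2.2]
  congr 1; ext z; congr 1
  have i1 := integrable_mul_cc2 h (θ := fun x => θ (x - z)) (hθ.continuous.comp (by fun_prop))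
  have i2 := integrable_mul_cc2 h (θ := fun x => θ (x + z)) (hθ.continuous.comp (by fun_prop))
  have i3 := (integrable_mul_cc2 h hθ.continuous).const_mul 2
  have j1 : Integrable fun x => θ x * η (x + z) := by
    have := i1.comp_add_right z
    simpa [mul_comm] using this
  have j2 : Integrable fun x => θ x * η (x - z) := by
    have := i2.comp_sub_right z
    simpa [mul_comm] using this
  have e1 : ∫ x, θ x * η (x + z) = ∫ x, η x * θ (x - z) := by
    rw [← integral_add_right_eq_self (fun x => η x * θ (x - z)) z]; simp [mul_comm]
  have e2 : ∫ x, θ x * η (x - z) = ∫ x, η x * θ (x + z) := by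
    rw [← integral_sub_right_eq_self (fun x => η x * θ (x + z)) z]; simp [mul_comm]
  have s1 : ∫ x, θ x * d2 η x z = (∫ x, θ x * η (x + z)) + (∫ x, θ x * η (x - z))
      - ∫ x, 2 * (η x * θ x) := by
    rw [← integral_add_sub j1 j2 i3]
    congr 1; ext x; simp only [d2]; ring
  have s2 : ∫ x, η x * d2 θ x z = (∫ x, η x * θ (x + z)) + (∫ x, η x * θ (x - z))
      - ∫ x, 2 * (η x * θ x) := by
    rw [← integral_add_sub i2 i1 i3]
    congr 1; ext x; simp only [d2]; ring
  rw [s1, s2, e1, e2]; ring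

/-- Ground-state (Jacobi) bound for the linearised operator `-hl + Q` with positive zero mode `θ`. -/
theorem ground_state_bound {θ Q : ℝ → ℝ} (hθ : ContDiff ℝ 2 θ) (hpos : ∀ x, 0 < θ x) {M : ℝ}
    (hM : ∀ x, θ x ≤ M) (hi : Integrable fun x => θ x * θ x) {B : ℝ} (hB : 0 < B)
    (hdec : ∀ x z, θ x * θ (x + z) * z ^ 2 ≤ B) (hQ : ∀ x, hl θ x = Q x * θ x)
    {η : ℝ → ℝ} (h : η ∈ cc2) :
    (Real.pi * B)⁻¹ * ((∫ x, θ x * θ x) * (∫ x, η x * η x) - (∫ x, θ x * η x) ^ 2) ≤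
      ∫ x, η x * (Q x * η x - hl η x) := by
  have hpi := Real.pi_pos
  have hc := cc2.continuous h
  have hθc := hθ.continuous
  obtain ⟨C, -, hC⟩ := cc2.exists_d2_le h
  obtain ⟨R, -, hR⟩ := cc2.exists_support h
  obtain ⟨D, -, hD⟩ := exists_d2_bound hθ (M := M) (fun x => by rw [abs_of_pos (hpos x)]; exact hM x) R
  set A : ℝ → ℝ := fun x => η x * (η x / θ x) with hA
  have hAi : Integrable A := integrable_mul_cc2 h (hc.div hθc fun x => (hpos x).ne')
  have hA0 : ∀ x, A x ≠ 0 → |x| ≤ R := fun x hx => not_lt.1 fun h' => hx (by simp [hA, hR x h'])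
  obtain ⟨a1, a2, a3⟩ := integral_mul_hl hAi hθc fun x hx => hD x (hA0 x hx)
  obtain ⟨b1, b2, b3⟩ := integral_mul_hl (cc2.integrable h) hc fun x _ => hC x
  have e0 : ∫ x, η x * (Q x * η x - hl η x) = (∫ x, A x * hl θ x) - ∫ x, η x * hl η x := by
    rw [← integral_sub a1 b1]
    congr 1; ext x; rw [hQ, hA]; have := (hpos x).ne'; field_simp
  -- correlation function
  set G : ℝ → ℝ := fun z => (∫ x, (θ x * θ x) * (η (x + z) * η (x + z)))
    + (∫ x, (η x * η x) * (θ (x + z) * θ (x + z)))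
    - 2 * ∫ x, (θ x * η x) * (θ (x + z) * η (x + z)) with hG
  have hηη : Integrable fun x => η x * η x := integrable_mul_cc2 h hc
  have hθη : Integrable fun x => θ x * η x := by simpa [mul_comm] using integrable_mul_cc2 h hθc
  obtain ⟨g1, g1'⟩ := integral_shear hi hηη
  obtain ⟨g2, g2'⟩ := integral_shear hηη hi
  obtain ⟨g3, g3'⟩ := integral_shear hθη hθη
  have hGi : Integrable G := (g1.add g2).sub (g3.const_mul 2)
  have hGe : ∫ z, G z = 2 * ((∫ x, θ x * θ x) * (∫ x, η x * η x) - (∫ x, θ x * η x) ^ 2) := by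
    have := integral_sub (g1.add g2) (g3.const_mul 2)
    simp only [Pi.add_apply] at this
    rw [hG, this, integral_add g1 g2, integral_const_mul, g1', g2', g3']; ring
  rw [e0, a3, b3, ← integral_sub a2 b2]
  calc _ = ∫ z, (2 * Real.pi * B)⁻¹ * G z := by
        rw [integral_const_mul, hGe]; field_simp
    _ ≤ _ := integral_mono (hGi.const_mul _) (a2.sub b2) fun z => ?_
  have shift : ∀ {f : ℝ → ℝ}, Continuous f → ∀ z, Continuous fun x => f (x + z) := fun hf z =>
    hf.comp (by fun_prop)
  have shift' : ∀ {f : ℝ → ℝ}, Continuous f → ∀ z, Continuous fun x => f (x - z) := fun hf z =>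
    hf.comp (by fun_prop)
  have cc : ∀ {f : ℝ → ℝ}, Continuous f → Integrable fun x => η x * f x := fun hf =>
    integrable_mul_cc2 h hf
  have hdivc : Continuous fun x => η x / θ x := hc.div hθc fun x => (hpos x).ne'
  have i1 : Integrable fun x => A x * θ (x + z) := by
    simpa [hA, mul_assoc] using cc (hdivc.mul (shift hθc z))
  have i2 : Integrable fun x => A x * θ (x - z) := by
    simpa [hA, mul_assoc] using cc (hdivc.mul (shift' hθc z))
  have i2' : Integrable fun x => A (x + z) * θ x := by simpa using i2.comp_add_right z
  have i3 : Integrable fun x => η x * η (x + z) := cc (shift hc z)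
  have i4 : Integrable fun x => η x * η (x - z) := cc (shift' hc z)
  have i5 : Integrable fun x => A x * θ x := by simpa [hA, mul_assoc] using cc (hdivc.mul hθc)
  have l1 : ∫ x, A x * d2 θ x z = (∫ x, A x * θ (x + z)) + (∫ x, A (x + z) * θ x) - 2 * ∫ x, η x * η x := by
    rw [show ∫ x, A (x + z) * θ x = ∫ x, A x * θ (x - z) by
      rw [← integral_add_right_eq_self (fun x => A x * θ (x - z)) z]; simp,
      ← integral_const_mul, ← integral_add_sub i1 i2 (hηη.const_mul 2)]
    congr 1; ext x; simp only [d2, hA]; have := (hpos x).ne'; field_simp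
  have l2 : ∫ x, η x * d2 η x z = 2 * (∫ x, η x * η (x + z)) - 2 * ∫ x, η x * η x := by
    have : ∫ x, η x * η (x + z) = ∫ x, η x * η (x - z) := by
      rw [← integral_add_right_eq_self (fun x => η x * η (x - z)) z]; simp [mul_comm]
    rw [two_mul, this]
    nth_rw 1 [← this]
    rw [← integral_const_mul, ← integral_add_sub i3 i4 (hηη.const_mul 2)]
    congr 1; ext x; simp only [d2]; ring
  simp only [Pi.sub_apply]
  rcases eq_or_ne z 0 with rfl | hz
  · simp only [hG, add_zero, ne_eq, OfNat.ofNat_ne_zero, not_false_eq_true, zero_pow, mul_zero,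
      div_zero, sub_zero]
    have t1 : ∫ x, θ x * θ x * (η x * η x) = ∫ x, η x * η x * (θ x * θ x) := by simp_rw [mul_comm]
    have t2 : ∫ x, θ x * η x * (θ x * η x) = ∫ x, η x * η x * (θ x * θ x) := by
      congr 1; ext x; ring
    rw [t1, t2]; apply le_of_eq; ring
  have hz2 : 0 < z ^ 2 := by positivity
  rw [← sub_div, l1, l2, le_div_iff₀ (by positivity), inv_mul_eq_div, div_mul_eq_mul_div,
    div_le_iff₀ (by positivity)]
  have j1 : Integrable fun x => (θ x * θ x) * (η (x + z) * η (x + z)) := by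
    have := (cc (hc.mul ((shift' hθc z).mul (shift' hθc z)))).comp_add_right z
    refine this.congr (Eventually.of_forall fun x => ?_); simp; ring
  have j2 : Integrable fun x => (η x * η x) * (θ (x + z) * θ (x + z)) := by
    refine (cc (hc.mul ((shift hθc z).mul (shift hθc z)))).congr (Eventually.of_forall fun x => ?_)
    simp; ring
  have j3 : Integrable fun x => (θ x * η x) * (θ (x + z) * η (x + z)) := by
    refine (cc (hθc.mul ((shift hθc z).mul (shift hc z)))).congr (Eventually.of_forall fun x => ?_)
    simp; ring
  have fin : G z * z ^ 2 ≤ B * ((∫ x, A x * θ (x + z)) + (∫ x, A (x + z) * θ x)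
      - 2 * ∫ x, η x * η (x + z)) := by
    rw [hG]
    simp only
    rw [← integral_const_mul, ← integral_const_mul, ← integral_add_sub j1 j2 (j3.const_mul 2),
      ← integral_add_sub i1 i2' (i3.const_mul 2), ← integral_mul_const,
      ← integral_const_mul]
    refine integral_mono (((j1.add j2).sub (j3.const_mul 2)).mul_const _)
      (((i1.add i2').sub (i3.const_mul 2)).const_mul B) fun x => ?_
    simp only [hA]
    have p1 := hpos x; have p2 := hpos (x + z)
    have e1 : θ x * θ x * (η (x + z) * η (x + z)) + η x * η x * (θ (x + z) * θ (x + z)) -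
        2 * (θ x * η x * (θ (x + z) * η (x + z))) = (θ x * η (x + z) - η x * θ (x + z)) ^ 2 := by ring
    have e2 : η x * (η x / θ x) * θ (x + z) + η (x + z) * (η (x + z) / θ (x + z)) * θ x -
        2 * (η x * η (x + z)) = (θ x * η (x + z) - η x * θ (x + z)) ^ 2 / (θ x * θ (x + z)) := by
      field_simp; ring
    rw [e1, e2, ← mul_div_assoc, le_div_iff₀ (by positivity)]
    have := mul_le_mul_of_nonneg_right (hdec x z) (sq_nonneg (θ x * η (x + z) - η x * θ (x + z)))
    linarith
  have := mul_le_mul_of_nonneg_left fin (by positivity : 0 ≤ 2 * Real.pi)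
  nlinarith

/-- Weak solvability of `-hl ζ + Q ζ = f` when `f` is orthogonal to the zero mode. -/
theorem exists_weak_corrector {θ Q f : ℝ → ℝ} (hθ : ContDiff ℝ 2 θ) (hpos : ∀ x, 0 < θ x) {M : ℝ}
    (hM : ∀ x, θ x ≤ M) (hθi : Integrable θ) {B : ℝ} (hB : 0 < B)
    (hdec : ∀ x z, θ x * θ (x + z) * z ^ 2 ≤ B) (hQc : Continuous Q)
    (hQ : ∀ x, hl θ x = Q x * θ x) (hθ2 : MemLp θ 2 volume) (hf : MemLp f 2 volume)
    (hfθ : ∫ x, f x * θ x = 0) :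
    ∃ ζ : ℝ → ℝ, MemLp ζ 2 volume ∧
      ∀ η ∈ cc2, ∫ x, ζ x * (Q x * η x - hl η x) = ∫ x, f x * η x := by
  have hmem : ∀ v : cc2, MemLp (fun x => Q x * v.1 x - hl v.1 x) 2 volume := fun v =>
    ((hQc.mul (cc2.continuous v.2)).memLp_of_hasCompactSupport v.2.2.mul_left).sub (cc2.memLp_hl v.2)
  let e : cc2 →ₗ[ℝ] Lp ℝ 2 (volume : Measure ℝ) :=
    { toFun := fun v => (cc2.memLp v.2).toLp v.1
      map_add' := fun v w => rfl
      map_smul' := fun c v => rfl }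
  let a : cc2 →ₗ[ℝ] Lp ℝ 2 (volume : Measure ℝ) :=
    { toFun := fun v => (hmem v).toLp _
      map_add' := fun v w => by
        rw [← MemLp.toLp_add]; congr 1; ext x
        have := hl_add (cc2.integrable_d2 v.2 x) (cc2.integrable_d2 w.2 x)
        simp only [Submodule.coe_add, Pi.add_apply]
        rw [show (v.1 + w.1 : ℝ → ℝ) = fun y => v.1 y + w.1 y from rfl, this]; ring
      map_smul' := fun c v => by
        rw [RingHom.id_apply, ← MemLp.toLp_const_smul]; congr 1; ext x
        have := hl_const_mul c v.1 x
        simp only [Submodule.coe_smul, Pi.smul_apply, smul_eq_mul]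
        rw [show (c • v.1 : ℝ → ℝ) = fun y => c * v.1 y from rfl, this]; ring }
  have habs : ∀ x, |θ x| ≤ M := fun x => by rw [abs_of_pos (hpos x)]; exact hM x
  have hi : Integrable fun x => θ x * θ x := by simpa [sq] using hθ2.integrable_sq
  have nsq : ∀ {u : ℝ → ℝ} (hu : MemLp u 2 volume), ‖hu.toLp u‖ ^ 2 = ∫ x, u x * u x := fun hu => by
    rw [← real_inner_self_eq_norm_sq, inner_toLp]
  have hI : 0 < ∫ x, θ x * θ x := by
    rw [integral_pos_iff_support_of_nonneg (fun x => mul_self_nonneg _) hi]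
    have : Function.support (fun x => θ x * θ x) = univ := by
      ext x; simp [(hpos x).ne']
    rw [this]; simp
  have ht : hθ2.toLp θ ≠ 0 := fun h0 => by
    have := nsq hθ2; rw [h0, norm_zero] at this
    linarith [show (0:ℝ) ^ 2 = 0 by norm_num]
  obtain ⟨ζ, hζ⟩ := exists_inner_eq_of_coercive e a (t := hθ2.toLp θ) (f := hf.toLp f)
    (c := (Real.pi * B)⁻¹) (by have := Real.pi_pos; positivity) ht
    (fun v => by
      change inner ℝ (hθ2.toLp θ) ((hmem v).toLp _) = 0
      rw [inner_toLp]
      have h1 := integral_mul_hl_symm v.2 hθ hθi habs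
      obtain ⟨D, -, hD⟩ := cc2.exists_d2_le v.2
      have h2 := (integral_mul_hl hθi (cc2.continuous v.2) fun x _ => hD x).1
      have h3 : Integrable fun x => θ x * (Q x * v.1 x) := by
        simpa [mul_comm, mul_assoc, mul_left_comm] using
          integrable_mul_cc2 v.2 (hθ.continuous.mul hQc)
      simp_rw [mul_sub]
      rw [integral_sub h3 h2, h1, sub_eq_zero]
      congr 1; ext x; rw [hQ]; ring)
    (by rw [inner_toLp, hfθ])
    (fun v => by
      change _ * (_ * ‖(cc2.memLp v.2).toLp v.1‖ ^ 2 - inner ℝ (hθ2.toLp θ) ((cc2.memLp v.2).toLp v.1) ^ 2)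
        ≤ inner ℝ ((cc2.memLp v.2).toLp v.1) ((hmem v).toLp _)
      rw [nsq, nsq, inner_toLp, inner_toLp]
      exact ground_state_bound hθ hpos hM hi hB hdec hQ v.2)
  refine ⟨ζ, Lp.memLp ζ, fun η hη => ?_⟩
  have := hζ ⟨η, hη⟩
  change inner ℝ ζ ((hmem ⟨η, hη⟩).toLp _) = inner ℝ (hf.toLp f) ((cc2.memLp hη).toLp η) at this
  rw [inner_toLp, ← Lp.toLp_coeFn ζ (Lp.memLp ζ), inner_toLp] at this
  exact this

/-- A normalised mollifier at scale `r` with `L²` norm of order `r^{-1/2}`. -/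
theorem exists_mollifier {r : ℝ} (hr : 0 < r) :
    ∃ ρ ∈ cc2, (∀ x, 0 ≤ ρ x) ∧ (∀ x, r < |x| → ρ x = 0) ∧ ∫ x, ρ x = 1 ∧ ∫ x, ρ x * ρ x ≤ r⁻¹ := by
  let b : ContDiffBump (0 : ℝ) := ⟨r / 2, r, by linarith, by linarith⟩
  have hmem : b.normed volume ∈ cc2 := ⟨b.contDiff_normed, b.hasCompactSupport_normed⟩
  refine ⟨b.normed volume, hmem, fun x => b.nonneg_normed x, fun x hx => ?_, b.integral_normed, ?_⟩
  · have : x ∉ Function.support (b.normed volume) := by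
      rw [b.support_normed_eq, mem_ball, dist_zero_right, Real.norm_eq_abs]
      exact not_lt.2 hx.le
    simpa using this
  · have hle : ∀ x, b.normed volume x ≤ r⁻¹ := fun x => by
      have := b.normed_le_div_measure_closedBall_rOut (μ := volume) 2 (by simp only [b]; linarith) x
      refine this.trans (le_of_eq ?_)
      simp [b, Real.volume_real_closedBall hr.le]
      field_simp
    calc ∫ x, b.normed volume x * b.normed volume x ≤ ∫ x, r⁻¹ * b.normed volume x :=
          integral_mono (integrable_mul_cc2 hmem (cc2.continuous hmem))
            ((cc2.integrable hmem).const_mul _)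
            fun x => mul_le_mul_of_nonneg_right (hle x) (b.nonneg_normed x)
      _ = r⁻¹ := by rw [integral_const_mul, b.integral_normed, mul_one]

/-- Convolution of a compactly supported continuous function with an element of `cc2`. -/
theorem mollify {g ρ : ℝ → ℝ} (hg : Continuous g) (hgs : HasCompactSupport g) (hρ : ρ ∈ cc2) :
    (fun x => ∫ y, g y * ρ (x - y)) ∈ cc2 ∧
    ∀ x, hl (fun x => ∫ y, g y * ρ (x - y)) x = ∫ y, g y * hl ρ (x - y) := by
  have hgi : Integrable g := hg.integrable_of_hasCompactSupport hgs
  have hconv : (fun x => ∫ y, g y * ρ (x - y)) = convolution g ρ (ContinuousLinearMap.mul ℝ ℝ) volume := by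
    ext x; rw [convolution_mul]
  refine ⟨?_, fun x => ?_⟩
  · rw [hconv]
    exact ⟨HasCompactSupport.contDiff_convolution_right _ hρ.2 hg.locallyIntegrable hρ.1,
      HasCompactSupport.convolution _ hgs hρ.2⟩
  · obtain ⟨C, -, hC⟩ := cc2.exists_d2_le hρ
    have hd2 : ∀ y z, d2 (fun y => ρ (x - y)) y z = d2 ρ (x - y) z := fun y z => by
      simp only [d2]; rw [show x - (y + z) = x - y - z by ring, show x - (y - z) = x - y + z by ring]; ring
    have key := (integral_mul_hl hgi (u := fun y => ρ (x - y))
      ((cc2.continuous hρ).comp (by fun_prop)) (C := C) fun y _ z => by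
        rw [hd2]; exact hC _ _).2.2
    have e1 : ∀ y, hl (fun y => ρ (x - y)) y = hl ρ (x - y) := fun y => by
      unfold hl; simp_rw [hd2]
    simp_rw [e1] at key
    rw [key]
    unfold hl
    congr 1; ext z; congr 1
    simp_rw [hd2]
    have hi : ∀ t : ℝ, Integrable fun y => g y * ρ (t - y) := fun t =>
      (hg.mul ((cc2.continuous hρ).comp (by fun_prop))).integrable_of_hasCompactSupport hgs.mul_right
    have := integral_add_sub (hi (x + z)) (hi (x - z)) ((hi x).const_mul 2)
    rw [integral_const_mul] at this
    unfold d2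
    rw [← this]
    congr 1; ext y
    rw [show x + z - y = x - y + z by ring, show x - z - y = x - y - z by ring]; ring

set_option maxHeartbeats 800000 in
/-- Smooth compactly supported approximate solutions, in the uniform norm, of the corrector equation. -/
theorem exists_approx_corrector {Q f ζ : ℝ → ℝ} (hζ : MemLp ζ 2 volume)
    (hw : ∀ η ∈ cc2, ∫ x, ζ x * (Q x * η x - hl η x) = ∫ x, f x * η x) (hQc : Continuous Q)
    {K A D : ℝ} (hK : ∀ x, |Q x| ≤ K) (hA : ∀ x y, |Q x - Q y| ≤ A * |x - y|)
    (hfc : Continuous f) (hD : ∀ x y, |f x - f y| ≤ D * |x - y|) {ε : ℝ} (hε : 0 < ε) :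
    ∃ Z ∈ cc2, ∀ x, |Q x * Z x - hl Z x - f x| ≤ ε := by
  have hA0 : 0 ≤ A := by simpa using (abs_nonneg _).trans (hA 1 0)
  have hD0 : 0 ≤ D := by simpa using (abs_nonneg _).trans (hD 1 0)
  set N := √(∫ x, ζ x * ζ x) with hN
  have hN0 : 0 ≤ N := Real.sqrt_nonneg _
  set s := min 1 (ε / (3 * (D + A * N + 1))) with hs
  have hs0 : 0 < s := by positivity
  have hs1 : s ≤ 1 := min_le_left _ _
  have hs2 : (D + A * N) * s ≤ ε / 3 := by
    have h1 : s ≤ ε / (3 * (D + A * N + 1)) := min_le_right _ _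
    rw [le_div_iff₀ (by positivity)] at h1
    nlinarith
  obtain ⟨ρ, hρ, hρ0, hρs, hρ1, hρ2⟩ := exists_mollifier (r := s ^ 2) (by positivity)
  set P := 2 * K ^ 2 * (∫ x, ρ x * ρ x) + 2 * ∫ x, hl ρ x * hl ρ x with hP
  have hρc := cc2.continuous hρ
  have hP0 : 0 ≤ P := by
    have h1 : 0 ≤ ∫ x, ρ x * ρ x := integral_nonneg fun _ => mul_self_nonneg _
    have h2 : 0 ≤ ∫ x, hl ρ x * hl ρ x := integral_nonneg fun _ => mul_self_nonneg _
    positivity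
  have hεP : 0 < ε / (3 * (√P + 1)) := by positivity
  obtain ⟨g, hgs, hg1, hgc, hg2⟩ := MemLp.exists_hasCompactSupport_integral_rpow_sub_le (p := 2)
    (by norm_num) (f := ζ) (μ := volume) (by simpa using hζ) (pow_pos hεP 2)
  have hg2' : MemLp g 2 volume := by simpa using hg2
  have hdiff : √(∫ x, (ζ x - g x) * (ζ x - g x)) ≤ ε / (3 * (√P + 1)) := by
    refine Real.sqrt_le_iff.2 ⟨hεP.le, le_trans (le_of_eq ?_) hg1⟩
    congr 1; ext x; rw [Real.rpow_two, Real.norm_eq_abs, sq_abs]; ring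
  obtain ⟨hZ, hlZ⟩ := mollify hgc hgs hρ
  refine ⟨_, hZ, fun x => ?_⟩
  rw [hlZ x]
  -- the test function
  set η : ℝ → ℝ := fun y => ρ (x - y) with hη
  have hηm : η ∈ cc2 := ⟨hρ.1.comp (by fun_prop),
    hρ.2.comp_homeomorph (Homeomorph.subLeft x)⟩
  have hηc := cc2.continuous hηm
  have hlη : ∀ y, hl η y = hl ρ (x - y) := fun y => by
    unfold hl; congr 1; ext z; simp only [d2, hη]
    rw [show x - (y + z) = x - y - z by ring, show x - (y - z) = x - y + z by ring]; ring
  simp_rw [← hlη]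
  have hηL := cc2.memLp hηm
  have hhL := cc2.memLp_hl hηm
  set k : ℝ → ℝ := fun y => Q x * η y - hl η y with hk
  have hkL : MemLp k 2 volume := (hηL.const_mul (Q x)).sub hhL
  have hηη : ∫ y, η y * η y = ∫ y, ρ y * ρ y :=
    integral_sub_left_eq_self (fun y => ρ y * ρ y) volume x
  have hhh : ∫ y, hl η y * hl η y = ∫ y, hl ρ y * hl ρ y := by
    simp_rw [hlη]; exact integral_sub_left_eq_self (fun y => hl ρ y * hl ρ y) volume x
  have hkk : ∫ y, k y * k y ≤ P := by
    have i1 : Integrable fun y => η y * η y := integrable_mul_cc2 hηm hηc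
    have i2 : Integrable fun y => hl η y * hl η y := by simpa [sq] using hhL.integrable_sq
    have i3 : Integrable fun y => k y * k y := by simpa [sq] using hkL.integrable_sq
    rw [hP, ← hηη, ← hhh, ← integral_const_mul, ← integral_const_mul,
      ← integral_add (i1.const_mul _) (i2.const_mul _)]
    refine integral_mono i3 ((i1.const_mul _).add (i2.const_mul _)) fun y => ?_
    have hQK : Q x ^ 2 ≤ K ^ 2 := by rw [← sq_abs]; exact pow_le_pow_left₀ (abs_nonneg _) (hK x) 2
    simp only [hk]
    nlinarith [sq_nonneg (Q x * η y + hl η y), mul_le_mul_of_nonneg_right hQK (mul_self_nonneg (η y))]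
  have ig : ∀ {u v : ℝ → ℝ}, MemLp u 2 volume → MemLp v 2 volume → Integrable fun y => u y * v y :=
    fun hu hv => hu.integrable_mul hv
  have hQη : MemLp (fun y => Q y * η y) 2 volume :=
    (hQc.mul hηc).memLp_of_hasCompactSupport hηm.2.mul_left
  have hdL : MemLp (fun y => (Q x - Q y) * η y) 2 volume := by
    have := (hηL.const_mul (Q x)).sub hQη
    refine this.congr_norm (this.1.congr ?_) ?_ <;>
      refine Eventually.of_forall fun y => ?_ <;> simp [sub_mul]
  have E1 : Q x * (∫ y, g y * η y) - ∫ y, g y * hl η y = ∫ y, g y * k y := by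
    rw [← integral_const_mul, ← integral_sub ((ig hg2' hηL).const_mul _) (ig hg2' hhL)]
    congr 1; ext y; simp only [hk]; ring
  have E2 : (∫ y, ζ y * k y) - (∫ y, g y * k y) = ∫ y, (ζ y - g y) * k y := by
    simp_rw [sub_mul]; exact (integral_sub (ig hζ hkL) (ig hg2' hkL)).symm
  have E3 : ∫ y, ζ y * k y = (∫ y, f y * η y) + ∫ y, ζ y * ((Q x - Q y) * η y) := by
    have i1 : Integrable fun y => ζ y * (Q y * η y - hl η y) := ig hζ (hQη.sub hhL)
    rw [← hw η hηm, ← integral_add i1 (ig hζ hdL)]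
    congr 1; ext y; simp only [hk]; ring
  have hη1 : ∫ y, η y = 1 := by rw [← hρ1]; exact integral_sub_left_eq_self ρ volume x
  have hη0 : ∀ y, s ^ 2 < |x - y| → η y = 0 := fun y hy => hρs _ hy
  have E4 : (∫ y, f y * η y) - f x = ∫ y, (f y - f x) * η y := by
    have i1 : Integrable fun y => f y * η y := by
      simpa [mul_comm] using integrable_mul_cc2 hηm hfc
    simp_rw [sub_mul]
    rw [integral_sub i1 ((cc2.integrable hηm).const_mul _), integral_const_mul, hη1, mul_one]
  have B1 : |∫ y, (ζ y - g y) * k y| ≤ ε / 3 := by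
    refine (integral_mul_sq_le (hζ.sub hg2') hkL).trans ?_
    have h1 : √(∫ y, k y * k y) ≤ √P := Real.sqrt_le_sqrt hkk
    calc _ ≤ ε / (3 * (√P + 1)) * √P := mul_le_mul hdiff h1 (Real.sqrt_nonneg _) hεP.le
      _ ≤ ε / (3 * (√P + 1)) * (√P + 1) := by gcongr; linarith
      _ = ε / 3 := by field_simp
  have hs21 : s ^ 2 ≤ s := by nlinarith
  have B2 : |∫ y, ζ y * ((Q x - Q y) * η y)| ≤ A * N * s := by
    refine (integral_mul_sq_le hζ hdL).trans ?_
    have h1 : √(∫ y, (Q x - Q y) * η y * ((Q x - Q y) * η y)) ≤ A * s := by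
      refine Real.sqrt_le_iff.2 ⟨by positivity, ?_⟩
      calc _ ≤ ∫ y, (A * s ^ 2) ^ 2 * (η y * η y) := by
            refine integral_mono (ig hdL hdL) ((ig hηL hηL).const_mul _) fun y => ?_
            rcases lt_or_ge (s ^ 2) |x - y| with h | h
            · simp [hη0 y h]
            · have h2 : (Q x - Q y) ^ 2 ≤ (A * s ^ 2) ^ 2 := by
                rw [← sq_abs]
                exact pow_le_pow_left₀ (abs_nonneg _)
                  ((hA x y).trans (mul_le_mul_of_nonneg_left h hA0)) 2
              have := mul_le_mul_of_nonneg_right h2 (mul_self_nonneg (η y))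
              calc _ = (Q x - Q y) ^ 2 * (η y * η y) := by ring
                _ ≤ _ := this
        _ ≤ (A * s ^ 2) ^ 2 * (s ^ 2)⁻¹ := by
            rw [integral_const_mul, hηη]; gcongr
        _ = (A * s) ^ 2 := by field_simp
    calc _ ≤ N * (A * s) := mul_le_mul_of_nonneg_left h1 hN0
      _ = _ := by ring
  have B3 : |∫ y, (f y - f x) * η y| ≤ D * s := by
    have h1 : ‖∫ y, (f y - f x) * η y‖ ≤ ∫ y, D * s * η y := by
      refine norm_integral_le_of_norm_le ((cc2.integrable hηm).const_mul _)
        (Eventually.of_forall fun y => ?_)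
      have hη0' : 0 ≤ η y := hρ0 _
      rw [norm_mul, Real.norm_eq_abs, Real.norm_of_nonneg hη0']
      rcases lt_or_ge (s ^ 2) |x - y| with h | h
      · simp [hη0 y h]
      · refine mul_le_mul_of_nonneg_right ?_ hη0'
        rw [abs_sub_comm]
        exact (hD x y).trans (mul_le_mul_of_nonneg_left (h.trans hs21) hD0)
    rwa [integral_const_mul, hη1, mul_one, Real.norm_eq_abs] at h1
  have fin : Q x * (∫ y, g y * η y) - (∫ y, g y * hl η y) - f x =
      (∫ y, (f y - f x) * η y) + (∫ y, ζ y * ((Q x - Q y) * η y)) - ∫ y, (ζ y - g y) * k y := by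
    linarith
  change |Q x * (∫ y, g y * η y) - (∫ y, g y * hl η y) - f x| ≤ ε
  rw [fin]
  have b1 := abs_le.1 B1; have b2 := abs_le.1 B2; have b3 := abs_le.1 B3
  rw [abs_le]; constructor <;> nlinarith

namespace Layer

variable {F φ : ℝ → ℝ} {α K : ℝ}

/-- First order corrector of the layer, up to an arbitrarily small uniform error. -/
theorem exists_corrector (hF : ForceBound F α K) (hφ : Layer F φ) (L : ℝ) {ε : ℝ} (hε : 0 < ε) :
    ∃ Z ∈ cc2, ∀ x, |deriv F (φ x) * Z x - hl Z x -
      (L - L / α * deriv F (φ x) - (∫ y, (deriv φ y) ^ 2)⁻¹ * L * deriv φ x)| ≤ ε := by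
  obtain ⟨C, hC0, hC⟩ := hφ.exists_deriv_le hF
  obtain ⟨D, hD0, hD⟩ := hφ.exists_abs_deriv_force_sub_le hF
  obtain ⟨E, hE0, hE⟩ := hφ.exists_abs_deriv_deriv_le hF
  obtain ⟨G, hG0, hG⟩ := hφ.exists_abs_deriv_le hF
  have hα := hF.pos
  have hK := hF.nonneg
  set θ := deriv φ with hθ
  set Q : ℝ → ℝ := fun x => deriv F (φ x) with hQ
  set I := ∫ y, (θ y) ^ 2 with hI
  set f : ℝ → ℝ := fun x => L - L / α * Q x - I⁻¹ * L * θ x with hf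
  have hθc : Continuous θ := hφ.contDiff_deriv.continuous
  have hQc : Continuous Q := hF.contDiff_deriv.continuous.comp hφ.smooth.continuous
  have hfc : Continuous f := by fun_prop
  have hθa : ∀ x, |θ x| ≤ C / (1 + x ^ 2) := fun x => by rw [abs_of_pos (hφ.deriv_pos x)]; exact hC x
  obtain ⟨hθi, hθ2⟩ := cc2.memLp_of_abs_le hθc.measurable hθa
  have hsq : Integrable fun x => θ x ^ 2 := hθ2.integrable_sq
  have hIpos : 0 < I := by
    rw [hI, integral_pos_iff_support_of_nonneg (fun x => sq_nonneg _) hsq]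
    have : Function.support (fun x => θ x ^ 2) = univ := by
      ext x; simp [(hφ.deriv_pos x).ne', hθ]
    rw [this]; simp
  have h1θ : ∫ x, θ x = 1 := by
    have := integral_of_hasDerivAt_of_tendsto (fun x => (hφ.differentiable x).hasDerivAt) hθi
      hφ.bot hφ.top
    simpa using this
  have hQb : ∀ x, |Q x| ≤ K := fun x => hF.bound1 _
  have hQθi : Integrable fun x => Q x * θ x :=
    hθi.bdd_mul hQc.aestronglyMeasurable (Eventually.of_forall hQb)
  have hQθ : ∫ x, Q x * θ x = 0 := by
    have hc := hF.smooth.continuous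
    have h1 : F 1 = 0 := by have := hF.periodic 0; simpa [hF.zero] using this
    have := integral_of_hasDerivAt_of_tendsto (f := fun x => F (φ x)) (m := 0) (n := 0)
      (fun x => (hF.differentiable (φ x)).hasDerivAt.comp x (hφ.differentiable x).hasDerivAt) hQθi
      (by have := (hc.tendsto 0).comp hφ.bot; rwa [hF.zero] at this)
      (by have := (hc.tendsto 1).comp hφ.top; rwa [h1] at this)
    simpa using this
  have hg2 : MemLp (fun x => L - L / α * Q x) 2 volume := by
    rw [memLp_two_iff_integrable_sq (by fun_prop)]
    refine (integrable_inv_one_add_sq.const_mul ((|L| / α * D) ^ 2)).mono' (by fun_prop)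
      (Eventually.of_forall fun x => ?_)
    have e : L - L / α * Q x = -(L / α) * (Q x - α) := by field_simp; ring
    have h1 : |L - L / α * Q x| ≤ |L| / α * (D / (1 + |x|)) := by
      rw [e, abs_mul, abs_neg, abs_div, abs_of_pos hα]; gcongr; exact hD x
    rw [Real.norm_of_nonneg (sq_nonneg _), ← sq_abs]
    calc |L - L / α * Q x| ^ 2 ≤ (|L| / α * (D / (1 + |x|))) ^ 2 := by gcongr
      _ = (|L| / α * D) ^ 2 * ((1 + |x|) ^ 2)⁻¹ := by field_simp
      _ ≤ _ := by
        gcongr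
        nlinarith [abs_nonneg x, sq_abs x]
  have hf2 : MemLp f 2 volume := hg2.sub (hθ2.const_mul _)
  have hfθ : ∫ x, f x * θ x = 0 := by
    have : ∀ x, f x * θ x = L * θ x - L / α * (Q x * θ x) - I⁻¹ * L * θ x ^ 2 := fun x => by
      simp only [hf]; ring
    simp_rw [this]
    have i1 : Integrable fun x => L * θ x - L / α * (Q x * θ x) :=
      (hθi.const_mul _).sub (hQθi.const_mul _)
    rw [integral_sub i1 (hsq.const_mul _),
      integral_sub (hθi.const_mul _) (hQθi.const_mul _), integral_const_mul, integral_const_mul,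
      integral_const_mul, h1θ, hQθ, ← hI]
    field_simp; ring
  have hdec : ∀ x z, θ x * θ (x + z) * z ^ 2 ≤ 2 * C ^ 2 + 1 := fun x z => by
    have h1 := hC x
    have h2 := hC (x + z)
    have h3 : θ x * θ (x + z) ≤ C / (1 + x ^ 2) * (C / (1 + (x + z) ^ 2)) :=
      mul_le_mul h1 h2 (hφ.deriv_pos _).le (by positivity)
    have h4 : z ^ 2 ≤ 2 * ((1 + x ^ 2) * (1 + (x + z) ^ 2)) := by
      nlinarith [sq_nonneg (x + (x + z)), sq_nonneg (x * (x + z))]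
    calc _ ≤ C / (1 + x ^ 2) * (C / (1 + (x + z) ^ 2)) * z ^ 2 := by gcongr
      _ ≤ C / (1 + x ^ 2) * (C / (1 + (x + z) ^ 2)) * (2 * ((1 + x ^ 2) * (1 + (x + z) ^ 2))) := by
        gcongr
      _ = 2 * C ^ 2 := by field_simp
      _ ≤ _ := by linarith
  obtain ⟨ζ, hζ, hw⟩ := exists_weak_corrector hφ.contDiff_deriv_two hφ.deriv_pos
    (fun x => (le_abs_self _).trans (hG x)) hθi (by positivity) hdec hQc (hφ.hl_deriv hF) hθ2 hf2 hfθ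
  have lipφ : ∀ x y, |φ x - φ y| ≤ G * |x - y| := fun x y => by
    simpa using convex_univ.norm_image_sub_le_of_norm_deriv_le (f := φ) (C := G) (x := y) (y := x)
      (fun x _ => hφ.differentiable x) (fun x _ => hG x) (mem_univ _) (mem_univ _)
  have lipθ : ∀ x y, |θ x - θ y| ≤ E * |x - y| := fun x y => by
    simpa using convex_univ.norm_image_sub_le_of_norm_deriv_le (f := θ) (C := E) (x := y) (y := x)
      (fun x _ => hφ.differentiable_deriv x)
      (fun x _ => (hE x).trans (div_le_self hE0 (by nlinarith))) (mem_univ _) (mem_univ _)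
  have lipQ : ∀ x y, |Q x - Q y| ≤ K * G * |x - y| := fun x y =>
    (hF.lipschitz_deriv _ _).trans (by rw [mul_assoc]; gcongr; exact lipφ x y)
  refine exists_approx_corrector hζ hw hQc hQb lipQ hfc
    (D := |L / α| * (K * G) + |I⁻¹ * L| * E) (fun x y => ?_) hε
  have : f x - f y = -(L / α) * (Q x - Q y) + -(I⁻¹ * L) * (θ x - θ y) := by simp only [hf]; ring
  rw [this]
  refine (abs_add_le _ _).trans ?_
  rw [abs_mul, abs_mul, abs_neg, abs_neg, add_mul]
  have h1 := mul_le_mul_of_nonneg_left (lipQ x y) (abs_nonneg (L / α))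
  have h2 := mul_le_mul_of_nonneg_left (lipθ x y) (abs_nonneg (I⁻¹ * L))
  rw [← mul_assoc] at h1 h2
  exact add_le_add h1 h2

/-- The corrector makes the first order residual of the travelling ansatz strictly positive as soon
as the speed exceeds the critical one. -/
theorem exists_strict_corrector (hF : ForceBound F α K) (hφ : Layer F φ) (L : ℝ) {η : ℝ}
    (hη : 0 < η) :
    ∃ Z ∈ cc2, ∃ m μ : ℝ, 0 < μ ∧ ∀ x, μ ≤ ((∫ y, (deriv φ y) ^ 2)⁻¹ * L + η) * deriv φ x - hl Z x +
      deriv F (φ x) * (Z x + m) - L := by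
  obtain ⟨R, hR0, hR⟩ := hφ.exists_coercive hF
  have hα := hF.pos
  have hK := hF.nonneg
  obtain ⟨x0, -, hx0⟩ := (isCompact_Icc (a := -R) (b := R)).exists_isMinOn ⟨0, by simp [hR0]⟩
    hφ.contDiff_deriv.continuous.continuousOn
  set d := deriv φ x0 with hd
  have hd0 : 0 < d := hφ.deriv_pos _
  set κ := η * d / (2 * (K + 1)) with hκ
  have hκ0 : 0 < κ := by positivity
  have hκK : κ * K ≤ η * d / 2 := by
    rw [hκ, div_mul_eq_mul_div, div_le_div_iff₀ (by positivity) (by positivity)]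
    nlinarith [mul_pos hη hd0]
  set μ := min (η * d / 4) (κ * α / 4) with hμ
  have hμ0 : 0 < μ := by positivity
  have hμ1 : μ ≤ η * d / 4 := min_le_left _ _
  have hμ2 : μ ≤ κ * α / 4 := min_le_right _ _
  obtain ⟨Z, hZ, h⟩ := hφ.exists_corrector hF L hμ0
  refine ⟨Z, hZ, L / α + κ, μ, hμ0, fun x => ?_⟩
  have h1 := (abs_le.1 (h x)).1
  have key : 2 * μ ≤ η * deriv φ x + κ * deriv F (φ x) := by
    have hp := hφ.deriv_pos x
    rcases le_or_gt R |x| with hx | hx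
    · nlinarith [hR x hx, mul_pos hη hp]
    · have h2 : d ≤ deriv φ x := hx0 (abs_le.1 hx.le)
      have h3 := (abs_le.1 (hF.bound1 (φ x))).1
      nlinarith
  linarith

end Layer

/-- A sum of functions converging locally uniformly together with two derivatives. -/
theorem contDiff_two_tsum_of_local {E : ℕ → ℝ → ℝ} (hE : ∀ n, ContDiff ℝ 2 (E n))
    (h : ∀ R : ℝ, ∃ u : ℕ → ℝ, Summable u ∧ ∀ n x, |x| < R →
      |E n x| ≤ u n ∧ |deriv (E n) x| ≤ u n ∧ |deriv (deriv (E n)) x| ≤ u n) :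
    ContDiff ℝ 2 (fun x => ∑' n, E n x) ∧
      (∀ x, deriv (fun x => ∑' n, E n x) x = ∑' n, deriv (E n) x) := by
  have hball : ∀ x : ℝ, x ∈ ball (0:ℝ) (|x| + 1) := fun x => by simp
  have hlt : ∀ {x R : ℝ}, x ∈ ball (0:ℝ) R → |x| < R := fun hx => by simpa using hx
  have d1 : ∀ x, HasDerivAt (fun x => ∑' n, E n x) (∑' n, deriv (E n) x) x := fun x => by
    obtain ⟨u, hu, hb⟩ := h (|x| + 1)
    exact hasDerivAt_tsum_of_isPreconnected hu isOpen_ball (convex_ball _ _).isPreconnected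
      (fun n y _ => ((hE n).differentiable (by norm_num) y).hasDerivAt)
      (fun n y hy => (hb n y (hlt hy)).2.1) (hball x)
      (.of_norm_bounded hu fun n => (hb n x (by linarith)).1) (hball x)
  have d2' : ∀ x, HasDerivAt (fun x => ∑' n, deriv (E n) x) (∑' n, deriv (deriv (E n)) x) x :=
    fun x => by
    obtain ⟨u, hu, hb⟩ := h (|x| + 1)
    exact hasDerivAt_tsum_of_isPreconnected hu isOpen_ball (convex_ball _ _).isPreconnected
      (fun n y _ => (((hE n).deriv_of_two).differentiable (by norm_num) y).hasDerivAt)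
      (fun n y hy => (hb n y (hlt hy)).2.2) (hball x)
      (.of_norm_bounded hu fun n => (hb n x (by linarith)).2.1) (hball x)
  have e1 : deriv (fun x => ∑' n, E n x) = fun x => ∑' n, deriv (E n) x := funext fun x => (d1 x).deriv
  have e2 : deriv (fun x => ∑' n, deriv (E n) x) = fun x => ∑' n, deriv (deriv (E n)) x :=
    funext fun x => (d2' x).deriv
  have c2 : Continuous fun x => ∑' n, deriv (deriv (E n)) x := by
    refine continuous_iff_continuousAt.2 fun x => ?_
    obtain ⟨u, hu, hb⟩ := h (|x| + 1)
    exact (continuousOn_tsum (fun n => (hE n).continuous_deriv_deriv.continuousOn) hu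
      fun n y hy => (hb n y (hlt hy)).2.2).continuousAt (isOpen_ball.mem_nhds (hball x))
  refine ⟨?_, fun x => (d1 x).deriv⟩
  rw [show (2 : WithTop ℕ∞) = 1 + 1 by norm_num, contDiff_succ_iff_deriv]
  refine ⟨fun x => (d1 x).differentiableAt, by simp, ?_⟩
  rw [e1, contDiff_one_iff_deriv, e2]
  exact ⟨fun x => (d2' x).differentiableAt, c2⟩

theorem div_one_add_sq_le {C a y u : ℝ} (hC : 0 ≤ C) (h : 1 + u ^ 2 ≤ a * (1 + y ^ 2)) :
    C / (1 + y ^ 2) ≤ a * C / (1 + u ^ 2) := by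
  rw [div_le_div_iff₀ (by positivity) (by positivity)]
  nlinarith [mul_le_mul_of_nonneg_left h hC]

/-- A transition profile from `0` to `1` with quadratically decaying derivatives. -/
structure Profile (ψ : ℝ → ℝ) (C : ℝ) : Prop where
  smooth : ContDiff ℝ 2 ψ
  bot : Tendsto ψ atBot (𝓝 0)
  top : Tendsto ψ atTop (𝓝 1)
  bdd : ∀ x, |ψ x| ≤ C
  bound1 : ∀ x, |deriv ψ x| ≤ C / (1 + x ^ 2)
  bound2 : ∀ x, |deriv (deriv ψ) x| ≤ C / (1 + x ^ 2)
  symm : ∀ x, |ψ x + ψ (-x) - 1| ≤ C / (1 + x ^ 2)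

/-- Two opposite translates of a profile, with the mean level removed. -/
def pair (ψ : ℝ → ℝ) (t x : ℝ) : ℝ := ψ (x + t) + ψ (x - t) - 1

namespace Profile

variable {ψ : ℝ → ℝ} {C : ℝ}

theorem nonneg (h : Profile ψ C) : 0 ≤ C := (abs_nonneg _).trans (h.bdd 0)

theorem contDiff_pair (h : Profile ψ C) (t : ℝ) : ContDiff ℝ 2 (pair ψ t) := by
  have := h.smooth
  unfold pair
  exact ((this.comp (by fun_prop)).add (this.comp (by fun_prop))).sub contDiff_const

theorem deriv_pair (h : Profile ψ C) (t : ℝ) :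
    deriv (pair ψ t) = fun x => deriv ψ (x + t) + deriv ψ (x - t) := by
  have hd := h.smooth.differentiable (by norm_num)
  ext x
  have h1 := (hd (x + t)).hasDerivAt.comp_add_const x t
  have h2 := (hd (x - t)).hasDerivAt.comp_sub_const x t
  exact ((h1.add h2).sub_const 1).deriv

theorem deriv_deriv_pair (h : Profile ψ C) (t : ℝ) :
    deriv (deriv (pair ψ t)) = fun x => deriv (deriv ψ) (x + t) + deriv (deriv ψ) (x - t) := by
  have hd := h.smooth.deriv_of_two.differentiable (by norm_num)
  rw [h.deriv_pair]
  ext x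
  have h1 := (hd (x + t)).hasDerivAt.comp_add_const x t
  have h2 := (hd (x - t)).hasDerivAt.comp_sub_const x t
  exact (h1.add h2).deriv

theorem pair_bounds (h : Profile ψ C) {t x a : ℝ}
    (ha : ∀ y, |t| - |x| ≤ |y| → 1 + t ^ 2 ≤ a * (1 + y ^ 2)) :
    |pair ψ t x| ≤ C * (1 + 2 * a * |x|) / (1 + t ^ 2) ∧
      |deriv (pair ψ t) x| ≤ 2 * a * C / (1 + t ^ 2) ∧
      |deriv (deriv (pair ψ t)) x| ≤ 2 * a * C / (1 + t ^ 2) := by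
  have hC := h.nonneg
  have hp : |t| - |x| ≤ |x + t| := by
    have := abs_sub_abs_le_abs_sub t (-x); rw [abs_neg, sub_neg_eq_add, add_comm t] at this; exact this
  have hm : |t| - |x| ≤ |x - t| := by rw [abs_sub_comm]; exact abs_sub_abs_le_abs_sub t x
  have key : ∀ s : ℝ, |s| = |t| → |ψ (s + x) - ψ s| ≤ a * C / (1 + t ^ 2) * |x| := fun s hs => by
    have := (convex_uIcc s (s + x)).norm_image_sub_le_of_norm_deriv_le (f := ψ)
      (C := a * C / (1 + t ^ 2)) (x := s) (y := s + x)
      (fun y _ => h.smooth.differentiable (by norm_num) y)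
      (fun y hy => (h.bound1 y).trans (div_one_add_sq_le hC (ha y ?_))) left_mem_uIcc right_mem_uIcc
    · simpa using this
    · have h1 : |s - y| ≤ |x| := by
        have := abs_sub_left_of_mem_uIcc hy
        rw [abs_sub_comm]; simpa using this
      have h2 := abs_sub_abs_le_abs_sub s y
      rw [← hs]; linarith
  refine ⟨?_, ?_, ?_⟩
  · have h1 := key t rfl
    have h2 := key (-t) (abs_neg t)
    have h3 := h.symm t
    have e : pair ψ t x = (ψ t + ψ (-t) - 1) + (ψ (t + x) - ψ t) + (ψ (-t + x) - ψ (-t)) := by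
      unfold pair; rw [add_comm x t, sub_eq_add_neg x t, add_comm x (-t)]; ring
    rw [e]
    refine (abs_add_three _ _ _).trans ((add_le_add (add_le_add h3 h1) h2).trans (le_of_eq ?_))
    field_simp; ring
  · rw [h.deriv_pair]
    refine (abs_add_le _ _).trans ((add_le_add ((h.bound1 _).trans (div_one_add_sq_le hC (ha _ hp)))
      ((h.bound1 _).trans (div_one_add_sq_le hC (ha _ hm)))).trans (le_of_eq ?_))
    ring
  · rw [h.deriv_deriv_pair]
    refine (abs_add_le _ _).trans ((add_le_add ((h.bound2 _).trans (div_one_add_sq_le hC (ha _ hp)))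
      ((h.bound2 _).trans (div_one_add_sq_le hC (ha _ hm)))).trans (le_of_eq ?_))
    ring

theorem peetre (t x : ℝ) : ∀ y, |t| - |x| ≤ |y| → 1 + t ^ 2 ≤ 2 * (1 + x ^ 2) * (1 + y ^ 2) := by
  intro y hy
  have h1 : |t| ^ 2 ≤ (|x| + |y|) ^ 2 := pow_le_pow_left₀ (abs_nonneg _) (by linarith) 2
  rw [sq_abs] at h1
  nlinarith [sq_abs x, sq_abs y, sq_nonneg (|x| - |y|), sq_nonneg (x * y)]

theorem far {t x : ℝ} (h : 2 * |x| ≤ |t|) :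
    ∀ y, |t| - |x| ≤ |y| → 1 + t ^ 2 ≤ 4 * (1 + y ^ 2) := by
  intro y hy
  have h1 : |t| ^ 2 ≤ (2 * |y|) ^ 2 := pow_le_pow_left₀ (abs_nonneg _) (by linarith) 2
  nlinarith [sq_abs t, sq_abs y]

/-- Integrable domination of the second difference of a pair, with quadratic decay in the distance
of the pair. -/
theorem abs_d2_pair_div_le (h : Profile ψ C) (x : ℝ) : ∃ A, 0 ≤ A ∧ ∀ t z,
    |d2 (pair ψ t) x z / (2 * Real.pi * z ^ 2)| ≤ A / (1 + t ^ 2) *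
      ((1 + z ^ 2)⁻¹ + (1 + (z + t) ^ 2)⁻¹ + (1 + (z - t) ^ 2)⁻¹) := by
  have hC := h.nonneg
  have hpi := Real.pi_gt_three
  set C2 := 4 * (3 + 2 * x ^ 2) * C with hC2
  set C0 := C * (1 + 2 * (2 * (1 + x ^ 2)) * |x|) with hC0
  have hC20 : 0 ≤ C2 := by positivity
  have hC00 : 0 ≤ C0 := by positivity
  refine ⟨C2 + 6 * C0, by positivity, fun t z => ?_⟩
  have hP : ∀ u, |pair ψ u x| ≤ C0 / (1 + u ^ 2) := fun u => (h.pair_bounds (peetre u x)).1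
  rcases le_or_gt |z| 1 with hz | hz
  · have h1 : |d2 (pair ψ t) x z| ≤ C2 / (1 + t ^ 2) * z ^ 2 := by
      refine abs_d2_le_mul_sq (h.contDiff_pair t) fun y hy => ?_
      refine (h.pair_bounds (peetre t y)).2.2.trans ?_
      have h2 : |y| ≤ |x| + 1 := by
        have := abs_sub_abs_le_abs_sub y x; linarith
      have h3 : y ^ 2 ≤ 2 * x ^ 2 + 2 := by
        have : |y| ^ 2 ≤ (|x| + 1) ^ 2 := pow_le_pow_left₀ (abs_nonneg _) h2 2
        rw [sq_abs] at this
        nlinarith [sq_abs x, sq_nonneg (|x| - 1)]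
      have : 2 * (2 * (1 + y ^ 2)) * C ≤ C2 := by rw [hC2]; nlinarith
      gcongr
    have h3 : |d2 (pair ψ t) x z / (2 * Real.pi * z ^ 2)| ≤ C2 / (1 + t ^ 2) * (1 + z ^ 2)⁻¹ := by
      have hz2 : z ^ 2 ≤ 1 := by rw [← sq_abs]; exact pow_le_one₀ (abs_nonneg _) hz
      rcases eq_or_ne z 0 with rfl | hz0
      · simp; positivity
      · have : 0 < z ^ 2 := by positivity
        rw [abs_div, abs_of_pos (by positivity : 0 < 2 * Real.pi * z ^ 2), div_le_iff₀ (by positivity)]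
        refine h1.trans ?_
        rw [mul_assoc]
        refine mul_le_mul_of_nonneg_left ?_ (by positivity)
        rw [← div_eq_inv_mul, le_div_iff₀ (by positivity)]
        nlinarith
    refine h3.trans ?_
    gcongr
    · linarith
    · have : 0 ≤ (1 + (z + t) ^ 2)⁻¹ + (1 + (z - t) ^ 2)⁻¹ := by positivity
      linarith
  · have hz2 : 1 ≤ z ^ 2 := by rw [← sq_abs]; exact one_le_pow₀ hz.le
    have e : d2 (pair ψ t) x z = pair ψ (z + t) x + pair ψ (z - t) x - 2 * pair ψ t x := by
      unfold d2 pair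
      rw [show x + z + t = x + (z + t) by ring, show x + z - t = x + (z - t) by ring,
        show x - z + t = x - (z - t) by ring, show x - z - t = x - (z + t) by ring]; ring
    have h1 : |d2 (pair ψ t) x z| ≤ C0 / (1 + (z + t) ^ 2) + C0 / (1 + (z - t) ^ 2)
        + 2 * (C0 / (1 + t ^ 2)) := by
      rw [e]
      refine (abs_sub _ _).trans (add_le_add ((abs_add_le _ _).trans (add_le_add (hP _) (hP _))) ?_)
      rw [abs_mul, abs_two]; gcongr; exact hP t
    have h2 : |d2 (pair ψ t) x z / (2 * Real.pi * z ^ 2)| ≤ (C0 / (1 + (z + t) ^ 2) +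
        C0 / (1 + (z - t) ^ 2) + 2 * (C0 / (1 + t ^ 2))) * (1 + z ^ 2)⁻¹ := by
      rw [abs_div, abs_of_pos (by positivity : 0 < 2 * Real.pi * z ^ 2), div_eq_mul_inv]
      gcongr
      nlinarith
    have prod : ∀ s : ℝ, s ^ 2 ≤ 2 * z ^ 2 + 2 * (z + s) ^ 2 →
        C0 / (1 + (z + s) ^ 2) * (1 + z ^ 2)⁻¹ ≤
        2 * C0 / (1 + s ^ 2) * ((1 + z ^ 2)⁻¹ + (1 + (z + s) ^ 2)⁻¹) := fun s hs => by
      rw [inv_eq_one_div, inv_eq_one_div, div_add_div _ _ (by positivity) (by positivity),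
        div_mul_div_comm, div_mul_div_comm, div_le_div_iff₀ (by positivity) (by positivity)]
      have : 0 ≤ C0 * ((1 + z ^ 2) * (1 + (z + s) ^ 2)) := by positivity
      nlinarith
    have p1 := prod t (by nlinarith [sq_nonneg (z + (z + t))])
    have p2 := prod (-t) (by nlinarith [sq_nonneg (z + (z - t))])
    rw [neg_sq, ← sub_eq_add_neg] at p2
    refine h2.trans ?_
    set B := (1 + t ^ 2)⁻¹
    set b0 := (1 + z ^ 2)⁻¹
    set b1 := (1 + (z + t) ^ 2)⁻¹
    set b2 := (1 + (z - t) ^ 2)⁻¹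
    have q0 : 0 ≤ B := by positivity
    have r0 : 0 ≤ b0 := by positivity
    have r1 : 0 ≤ b1 := by positivity
    have r2 : 0 ≤ b2 := by positivity
    rw [div_eq_mul_inv] at p1 p2 ⊢
    rw [div_eq_mul_inv] at p1 p2
    rw [div_eq_mul_inv C0 (1 + (z - t) ^ 2), div_eq_mul_inv C0 (1 + t ^ 2), div_eq_mul_inv]
    have w1 : 0 ≤ C0 * B := by positivity
    have w2 : 0 ≤ C2 * B * (b0 + b1 + b2) := by positivity
    nlinarith [mul_nonneg w1 r0, mul_nonneg w1 r1, mul_nonneg w1 r2]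

end Profile

/-- The sum of the inverse squares of the positive integers. -/
def invSqSum : ℝ := ∑' n : ℕ, 1 / ((n : ℝ) + 1) ^ 2

theorem summable_invSq : Summable fun n : ℕ => 1 / ((n : ℝ) + 1) ^ 2 := by
  have := (summable_nat_add_iff 1).2 (Real.summable_one_div_nat_pow.2 (by norm_num : 1 < 2))
  simpa using this

theorem div_one_add_sq_mul_le {A T : ℝ} (hA : 0 ≤ A) (hT : 0 < T) (n : ℕ) :
    A / (1 + (((n : ℝ) + 1) * T) ^ 2) ≤ A / T ^ 2 * (1 / ((n : ℝ) + 1) ^ 2) := by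
  rw [div_mul_div_comm, mul_one]
  gcongr
  nlinarith

theorem summable_div_one_add_sq {A T : ℝ} (hA : 0 ≤ A) (hT : 0 < T) :
    Summable fun n : ℕ => A / (1 + (((n : ℝ) + 1) * T) ^ 2) :=
  .of_nonneg_of_le (fun n => by positivity) (div_one_add_sq_mul_le hA hT)
    (summable_invSq.mul_left _)

/-- Summation of the quadratic decay along the lattice. -/
theorem abs_tsum_le_of_sq_decay {A T : ℝ} (hA : 0 ≤ A) (hT : 0 < T) {f : ℕ → ℝ}
    (h : ∀ n : ℕ, |f n| ≤ A / (1 + (((n : ℝ) + 1) * T) ^ 2)) : |∑' n, f n| ≤ A / T ^ 2 * invSqSum := by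
  rw [invSqSum, ← tsum_mul_left]
  exact tsum_of_norm_bounded (f := f) (summable_invSq.mul_left _).hasSum
    fun n => (h n).trans (div_one_add_sq_mul_le hA hT n)

/-- The superposition of the translates of `ψ` by the multiples of `T`, renormalised. -/
def wings (ψ : ℝ → ℝ) (T x : ℝ) : ℝ := ∑' n : ℕ, pair ψ (((n : ℝ) + 1) * T) x

namespace Profile

variable {ψ : ℝ → ℝ} {C T : ℝ}

theorem contDiff_wings (h : Profile ψ C) (hT : 0 < T) :
    ContDiff ℝ 2 (wings ψ T) ∧
      ∀ x, deriv (wings ψ T) x = ∑' n : ℕ, deriv (pair ψ (((n : ℝ) + 1) * T)) x := by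
  have hC := h.nonneg
  refine contDiff_two_tsum_of_local (fun n => h.contDiff_pair _) fun R => ?_
  set a := 2 * (1 + R ^ 2) with ha
  refine ⟨_, summable_div_one_add_sq (A := C * (1 + 2 * a * |R|) + 2 * a * C) (by positivity) hT,
    fun n x hx => ?_⟩
  have hx' : |x| ≤ |R| := hx.le.trans (le_abs_self _)
  have hx2 : x ^ 2 ≤ R ^ 2 := sq_le_sq.2 hx'
  have e1 : 2 * (1 + x ^ 2) ≤ a := by rw [ha]; linarith
  obtain ⟨h1, h2, h3⟩ := h.pair_bounds (peetre (((n : ℝ) + 1) * T) x)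
  refine ⟨h1.trans ?_, h2.trans ?_, h3.trans ?_⟩
  · gcongr
    have : C * (1 + 2 * (2 * (1 + x ^ 2)) * |x|) ≤ C * (1 + 2 * a * |R|) := by gcongr
    have : 0 ≤ 2 * a * C := by positivity
    linarith
  all_goals
    gcongr
    have : 2 * (2 * (1 + x ^ 2)) * C ≤ 2 * a * C := by gcongr
    have : 0 ≤ C * (1 + 2 * a * |R|) := by positivity
    linarith

theorem summable_pair (h : Profile ψ C) (hT : 0 < T) (x : ℝ) :
    Summable fun n : ℕ => pair ψ (((n : ℝ) + 1) * T) x :=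
  have hC := h.nonneg
  .of_norm_bounded (summable_div_one_add_sq (by positivity) hT)
    fun _ => (h.pair_bounds (peetre _ x)).1

theorem add_wings_add_period (h : Profile ψ C) (hT : 0 < T) (x : ℝ) :
    ψ (x + T) + wings ψ T (x + T) = ψ x + wings ψ T x + 1 := by
  have h1 := (h.summable_pair hT x).hasSum.tendsto_sum_nat
  have h2 := (h.summable_pair hT (x + T)).hasSum.tendsto_sum_nat
  have tel : ∀ N : ℕ, (∑ n ∈ Finset.range N, pair ψ (((n : ℝ) + 1) * T) (x + T)) -
      ∑ n ∈ Finset.range N, pair ψ (((n : ℝ) + 1) * T) x =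
      ψ (x + ((N : ℝ) + 1) * T) - ψ (x + T) + ψ x - ψ (x - N * T) := fun N => by
    induction N with
    | zero => simp
    | succ N ih =>
      rw [Finset.sum_range_succ, Finset.sum_range_succ, add_sub_add_comm, ih]
      unfold pair; push_cast
      rw [show x + T + ((N : ℝ) + 1) * T = x + ((N : ℝ) + 1 + 1) * T by ring,
        show x + T - ((N : ℝ) + 1) * T = x - N * T by ring]; ring
  have hlin : Tendsto (fun N : ℕ => (N : ℝ) * T) atTop atTop :=
    tendsto_natCast_atTop_atTop.atTop_mul_const hT
  have l1 : Tendsto (fun N : ℕ => ψ (x + ((N : ℝ) + 1) * T)) atTop (𝓝 1) :=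
    h.top.comp (by
      have := tendsto_atTop_add_const_left atTop (x + T) hlin
      refine this.congr fun N => by ring)
  have l2 : Tendsto (fun N : ℕ => ψ (x - (N : ℝ) * T)) atTop (𝓝 0) :=
    h.bot.comp (by
      simp_rw [sub_eq_add_neg]
      exact tendsto_atBot_add_const_left atTop x (tendsto_neg_atTop_atBot.comp hlin))
  have l3 := ((l1.sub_const (ψ (x + T))).add_const (ψ x)).sub l2
  have := tendsto_nhds_unique ((h2.sub h1).congr tel) l3
  unfold wings
  linarith

theorem hl_pair (h : Profile ψ C) (t x : ℝ) : hl (pair ψ t) x = hl ψ (x + t) + hl ψ (x - t) := by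
  have hs := h.smooth
  have e : pair ψ t = fun y => (ψ (y + t) + ψ (y + -t)) + (-1) := by
    ext y; unfold pair; ring_nf
  rw [e, hl_add_const, hl_add (u := fun y => ψ (y + t)) (v := fun y => ψ (y + -t)),
    hl_comp_add, hl_comp_add, sub_eq_add_neg]
  · exact integrable_d2 (hs.comp (by fun_prop)) (fun y => h.bdd (y + t)) x
  · exact integrable_d2 (hs.comp (by fun_prop)) (fun y => h.bdd (y + -t)) x

theorem hl_wings (h : Profile ψ C) (hT : 0 < T) (x : ℝ) :
    hl (wings ψ T) x = ∑' n : ℕ,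
      (hl ψ (x + ((n : ℝ) + 1) * T) + hl ψ (x - ((n : ℝ) + 1) * T)) := by
  obtain ⟨A, hA, hb⟩ := h.abs_d2_pair_div_le x
  have hg0 : Integrable fun z : ℝ => (1 + z ^ 2)⁻¹ := integrable_inv_one_add_sq
  have hg1 : ∀ t : ℝ, Integrable (fun z : ℝ => (1 + (z + t) ^ 2)⁻¹) := fun t => hg0.comp_add_right t
  have hg2 : ∀ t : ℝ, Integrable (fun z : ℝ => (1 + (z - t) ^ 2)⁻¹) := fun t => hg0.comp_sub_right t
  have hg : ∀ t : ℝ, Integrable fun z : ℝ =>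
      ((1 + z ^ 2)⁻¹ + (1 + (z + t) ^ 2)⁻¹ + (1 + (z - t) ^ 2)⁻¹) := fun t =>
    (hg0.add (hg1 t)).add (hg2 t)
  have hgi : ∀ t : ℝ, ∫ z : ℝ, ((1 + z ^ 2)⁻¹ + (1 + (z + t) ^ 2)⁻¹ + (1 + (z - t) ^ 2)⁻¹) =
      3 * Real.pi := fun t => by
    have i1 : Integrable fun z : ℝ => (1 + z ^ 2)⁻¹ + (1 + (z + t) ^ 2)⁻¹ := hg0.add (hg1 t)
    rw [integral_add i1 (hg2 t), integral_add hg0 (hg1 t),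
      integral_add_right_eq_self (fun z : ℝ => (1 + z ^ 2)⁻¹) t,
      integral_sub_right_eq_self (fun z : ℝ => (1 + z ^ 2)⁻¹) t, integral_univ_inv_one_add_sq]; ring
  have hInt : ∀ t, Integrable fun z => d2 (pair ψ t) x z / (2 * Real.pi * z ^ 2) := fun t =>
    ((hg t).const_mul _).mono'
      (measurable_d2_div_right (h.contDiff_pair t).continuous x).aestronglyMeasurable
      (Eventually.of_forall (hb t))
  have hsum := hasSum_integral_of_summable_integral_norm
    (F := fun (n : ℕ) z => d2 (pair ψ (((n : ℝ) + 1) * T)) x z / (2 * Real.pi * z ^ 2))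
    (fun n => hInt _) (by
      refine .of_nonneg_of_le (fun n => integral_nonneg fun _ => norm_nonneg _) (fun n => ?_)
        ((summable_div_one_add_sq hA hT).mul_right (3 * Real.pi))
      rw [← hgi (((n : ℝ) + 1) * T), ← integral_const_mul]
      exact integral_mono (hInt _).norm ((hg _).const_mul _) (hb _))
  have e1 : ∀ z, d2 (wings ψ T) x z / (2 * Real.pi * z ^ 2) =
      ∑' n : ℕ, d2 (pair ψ (((n : ℝ) + 1) * T)) x z / (2 * Real.pi * z ^ 2) := fun z => by
    have := ((h.summable_pair hT (x + z)).hasSum.add (h.summable_pair hT (x - z)).hasSum).sub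
      ((h.summable_pair hT x).hasSum.mul_left 2)
    exact (this.div_const _).tsum_eq.symm
  have e2 : hl (wings ψ T) x = ∫ z, ∑' n : ℕ, d2 (pair ψ (((n : ℝ) + 1) * T)) x z /
      (2 * Real.pi * z ^ 2) := integral_congr_ae (Eventually.of_forall e1)
  rw [e2, ← hsum.tsum_eq]
  exact tsum_congr fun n => h.hl_pair _ x

theorem exists_bound_sub_linear (h : Profile ψ C) (hT : 0 < T) :
    ∃ M, ∀ x, |ψ x + wings ψ T x - T⁻¹ * x| ≤ M := by
  have hc : Continuous fun x => ψ x + wings ψ T x - T⁻¹ * x := by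
    have := h.smooth.continuous
    have := (h.contDiff_wings hT).1.continuous
    fun_prop
  have hp : Function.Periodic (fun x => ψ x + wings ψ T x - T⁻¹ * x) T := fun x => by
    simp only [h.add_wings_add_period hT]; field_simp; ring
  obtain ⟨M, hM⟩ := (hp.isBounded_of_continuous hT.ne' hc).exists_norm_le
  exact ⟨M, fun x => hM _ ⟨x, rfl⟩⟩

theorem hl_add_wings (h : Profile ψ C) (hT : 0 < T) (x : ℝ) :
    hl (fun y => ψ y + wings ψ T y) x = hl ψ x + ∑' n : ℕ,
      (hl ψ (x + ((n : ℝ) + 1) * T) + hl ψ (x - ((n : ℝ) + 1) * T)) := by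
  obtain ⟨M, hM⟩ := h.exists_bound_sub_linear hT
  have i1 := integrable_d2 h.smooth h.bdd x
  have i2 : Integrable fun z => d2 (fun y => ψ y + wings ψ T y - T⁻¹ * y) x z / (2 * Real.pi * z ^ 2) :=
    integrable_d2 ((h.smooth.add (h.contDiff_wings hT).1).sub (contDiff_const.mul contDiff_id)) hM x
  rw [hl_add i1, h.hl_wings hT]
  refine (i2.sub i1).congr (Eventually.of_forall fun z => ?_)
  simp only [Pi.sub_apply, d2]; ring

end Profile

theorem exists_sq_decay_of_hasCompactSupport {f : ℝ → ℝ} (hf : Continuous f) (hs : HasCompactSupport f) :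
    ∃ C, 0 ≤ C ∧ ∀ x, |f x| ≤ C / (1 + x ^ 2) := by
  obtain ⟨C, hC⟩ := (hs.mul_right (f' := fun x => 1 + x ^ 2)).exists_bound_of_continuous (by fun_prop)
  refine ⟨C, (norm_nonneg _).trans (hC 0), fun x => ?_⟩
  have := hC x
  rw [le_div_iff₀ (by positivity)]
  simpa [abs_mul, abs_of_pos (by positivity : 0 < 1 + x ^ 2)] using this

theorem div_one_add_abs_sq_le {C : ℝ} (x : ℝ) : (C / (1 + |x|)) ^ 2 ≤ C ^ 2 / (1 + x ^ 2) := by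
  rw [div_pow]; gcongr; nlinarith [abs_nonneg x, sq_abs x]

namespace Layer

variable {F φ : ℝ → ℝ} {α K : ℝ}

/-- Small compactly supported perturbations of the layer are profiles, with uniform constants. -/
theorem exists_profile (hF : ForceBound F α K) (hφ : Layer F φ) {Z : ℝ → ℝ} (hZ : Z ∈ cc2) :
    ∃ C, 0 ≤ C ∧ (∀ x, |Z x| ≤ C ∧ |deriv Z x| ≤ C) ∧ ∀ δ ∈ Icc (0:ℝ) 1,
      Profile (fun x => φ x + δ * Z x) C ∧
      (∀ x, hl (fun x => φ x + δ * Z x) x = F (φ x) + δ * hl Z x) ∧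
      (∀ x ≤ 0, |hl (fun x => φ x + δ * Z x) x - α * (φ x + δ * Z x)| ≤ C / (1 + x ^ 2)) ∧
      (∀ x, 0 ≤ x → |hl (fun x => φ x + δ * Z x) x - α * (φ x + δ * Z x - 1)| ≤ C / (1 + x ^ 2)) := by
  obtain ⟨A1, hA1, a1⟩ := hφ.exists_deriv_le hF
  obtain ⟨A2, hA2, a2⟩ := hφ.exists_abs_deriv_deriv_le hF
  obtain ⟨A3, hA3, a3⟩ := hφ.exists_abs_symm_le hF
  obtain ⟨A4, hA4, a4, a4'⟩ := hφ.exists_tail hF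
  obtain ⟨B0, hB0, b0⟩ := exists_sq_decay_of_hasCompactSupport (cc2.continuous hZ) hZ.2
  obtain ⟨B1, hB1, b1⟩ := exists_sq_decay_of_hasCompactSupport hZ.1.deriv_of_two.continuous hZ.2.deriv
  obtain ⟨B2, hB2, b2⟩ := exists_sq_decay_of_hasCompactSupport hZ.1.continuous_deriv_deriv
    hZ.2.deriv.deriv
  obtain ⟨B3, hB3, b3⟩ := cc2.exists_abs_hl_le hZ
  have hα := hF.pos
  have hK := hF.nonneg
  set C := 1 + A1 + A2 + A3 + K * A4 ^ 2 + 2 * B0 + α * B0 + B1 + B2 + B3 with hC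
  have p1 : 0 ≤ K * A4 ^ 2 := by positivity
  have p2 : 0 ≤ α * B0 := by positivity
  have hone : ∀ x : ℝ, 1 ≤ 1 + x ^ 2 := fun x => by nlinarith
  refine ⟨C, by positivity, fun x => ⟨(b0 x).trans ((div_le_self hB0 (hone x)).trans (by linarith)),
    (b1 x).trans ((div_le_self hB1 (hone x)).trans (by linarith))⟩, fun δ hδ => ?_⟩
  obtain ⟨hδ0, hδ1⟩ := hδ
  have sm : ∀ {u B x : ℝ}, 0 ≤ B → |u| ≤ B / (1 + x ^ 2) → |δ * u| ≤ B / (1 + x ^ 2) := fun hB h => by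
    rw [abs_mul, abs_of_nonneg hδ0]
    exact (mul_le_of_le_one_left (abs_nonneg _) hδ1).trans h
  have comb : ∀ {u v B B' x : ℝ}, |u| ≤ B / (1 + x ^ 2) → |v| ≤ B' / (1 + x ^ 2) → B + B' ≤ C →
      |u + v| ≤ C / (1 + x ^ 2) := fun {u v B B' x} h1 h2 h3 => by
    refine (abs_add_le _ _).trans ((add_le_add h1 h2).trans ?_)
    rw [← add_div]; gcongr
  have hdφ := hφ.differentiable
  have hdZ : Differentiable ℝ Z := hZ.1.differentiable (by norm_num)
  have hdZ' : Differentiable ℝ (deriv Z) := hZ.1.deriv_of_two.differentiable (by norm_num)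
  have e1 : deriv (fun x => φ x + δ * Z x) = fun x => deriv φ x + δ * deriv Z x := funext fun x =>
    ((hdφ x).hasDerivAt.add ((hdZ x).hasDerivAt.const_mul δ)).deriv
  have e2 : deriv (deriv (fun x => φ x + δ * Z x)) =
      fun x => deriv (deriv φ) x + δ * deriv (deriv Z) x := by
    rw [e1]
    exact funext fun x =>
      ((hφ.differentiable_deriv x).hasDerivAt.add ((hdZ' x).hasDerivAt.const_mul δ)).deriv
  have z0 : Tendsto (fun x => δ * Z x) (cocompact ℝ) (𝓝 0) := by
    have : Tendsto Z (cocompact ℝ) (𝓝 0) := hZ.2.is_zero_at_infty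
    simpa using this.const_mul δ
  rw [cocompact_eq_atBot_atTop, tendsto_sup] at z0
  have ehl : ∀ x, hl (fun x => φ x + δ * Z x) x = F (φ x) + δ * hl Z x := fun x => by
    rw [hl_add (integrable_d2 hφ.contDiff_two hφ.abs_le_one x), hl_const_mul, hφ.eqn]
    refine ((cc2.integrable_d2 hZ x).const_mul δ).congr (Eventually.of_forall fun z => ?_)
    simp only [d2]; ring
  refine ⟨⟨hφ.contDiff_two.add (contDiff_const.mul hZ.1), ?_, ?_, fun x => ?_, fun x => ?_, fun x => ?_,
    fun x => ?_⟩, ehl, fun x hx => ?_, fun x hx => ?_⟩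
  · simpa using hφ.bot.add z0.1
  · simpa using hφ.top.add z0.2
  · refine (abs_add_le _ _).trans ((add_le_add (hφ.abs_le_one x) ((sm hB0 (b0 x)).trans
      (div_le_self hB0 (hone x)))).trans (by linarith))
  · rw [e1]
    exact comb (by rw [abs_of_pos (hφ.deriv_pos x)]; exact a1 x) (sm hB1 (b1 x)) (by linarith)
  · rw [e2]
    exact comb (a2 x) (sm hB2 (b2 x)) (by linarith)
  · have h1 : |δ * (Z x + Z (-x))| ≤ 2 * B0 / (1 + x ^ 2) := by
      refine sm (by positivity) ((abs_add_le _ _).trans ((add_le_add (b0 x) (b0 (-x))).trans (le_of_eq ?_)))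
      rw [neg_sq]; ring
    have := comb (a3 x) h1 (by linarith)
    convert this using 2; ring
  · rw [ehl, show F (φ x) + δ * hl Z x - α * (φ x + δ * Z x) =
      (F (φ x) - α * φ x) + δ * (hl Z x - α * Z x) by ring]
    have h1 : |F (φ x) - α * φ x| ≤ K * A4 ^ 2 / (1 + x ^ 2) := by
      refine (hF.abs_sub_linear_le _).trans ?_
      rw [mul_div_assoc]
      refine mul_le_mul_of_nonneg_left ?_ hK
      exact (pow_le_pow_left₀ (hφ.pos x).le (a4 x hx) 2).trans (div_one_add_abs_sq_le x)
    have h2 : |δ * (hl Z x - α * Z x)| ≤ (B3 + α * B0) / (1 + x ^ 2) := by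
      refine sm (by positivity) ((abs_sub _ _).trans ?_)
      rw [abs_mul, abs_of_pos hα, add_div, mul_div_assoc]
      exact add_le_add (b3 x) (mul_le_mul_of_nonneg_left (b0 x) hα.le)
    exact comb h1 h2 (by linarith)
  · rw [ehl, show F (φ x) + δ * hl Z x - α * (φ x + δ * Z x - 1) =
      (F (φ x) - α * (φ x - 1)) + δ * (hl Z x - α * Z x) by ring]
    have h1 : |F (φ x) - α * (φ x - 1)| ≤ K * A4 ^ 2 / (1 + x ^ 2) := by
      refine (hF.abs_sub_linear_le_one _).trans ?_
      rw [mul_div_assoc]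
      refine mul_le_mul_of_nonneg_left ?_ hK
      rw [← neg_sub, neg_sq]
      exact (pow_le_pow_left₀ (by linarith [hφ.lt_one x]) (a4' x hx) 2).trans (div_one_add_abs_sq_le x)
    have h2 : |δ * (hl Z x - α * Z x)| ≤ (B3 + α * B0) / (1 + x ^ 2) := by
      refine sm (by positivity) ((abs_sub _ _).trans ?_)
      rw [abs_mul, abs_of_pos hα, add_div, mul_div_assoc]
      exact add_le_add (b3 x) (mul_le_mul_of_nonneg_left (b0 x) hα.le)
    exact comb h1 h2 (by linarith)

end Layer

theorem Profile.wings_bounds {ψ : ℝ → ℝ} {C T x : ℝ} (h : Profile ψ C) (hT : 0 < T)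
    (hx : 2 * |x| ≤ T) :
    |wings ψ T x| ≤ C * (1 + 8 * |x|) / T ^ 2 * invSqSum ∧
      |deriv (wings ψ T) x| ≤ 8 * C / T ^ 2 * invSqSum ∧
      ∀ α, (∀ y ≤ 0, |hl ψ y - α * ψ y| ≤ C / (1 + y ^ 2)) →
        (∀ y, 0 ≤ y → |hl ψ y - α * (ψ y - 1)| ≤ C / (1 + y ^ 2)) →
        |hl (fun y => ψ y + wings ψ T y) x - hl ψ x - α * wings ψ T x| ≤ 8 * C / T ^ 2 * invSqSum := by
  have hC := h.nonneg
  have ht : ∀ n : ℕ, T ≤ ((n : ℝ) + 1) * T := fun n => by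
    nlinarith [mul_nonneg (Nat.cast_nonneg (α := ℝ) n) hT.le]
  have hfar : ∀ n : ℕ, 2 * |x| ≤ |((n : ℝ) + 1) * T| := fun n =>
    (hx.trans (ht n)).trans (le_abs_self _)
  have hpb := fun n : ℕ => h.pair_bounds (Profile.far (hfar n))
  have e8 : 2 * 4 * C = 8 * C := by ring
  have e8' : C * (1 + 2 * 4 * |x|) = C * (1 + 8 * |x|) := by ring
  rw [e8, e8'] at hpb
  refine ⟨abs_tsum_le_of_sq_decay (by positivity) hT fun n => (hpb n).1, ?_, fun α h1 h2 => ?_⟩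
  · rw [(h.contDiff_wings hT).2]
    exact abs_tsum_le_of_sq_decay (by positivity) hT fun n => (hpb n).2.1
  · have key : ∀ n : ℕ, |hl ψ (x + ((n : ℝ) + 1) * T) + hl ψ (x - ((n : ℝ) + 1) * T) -
        α * pair ψ (((n : ℝ) + 1) * T) x| ≤ 8 * C / (1 + (((n : ℝ) + 1) * T) ^ 2) := fun n => by
      set t := ((n : ℝ) + 1) * T
      have hxt := abs_le.1 (show |x| ≤ t / 2 by linarith [ht n])
      have h0 : 0 ≤ t := by linarith [ht n]
      have h3 := h2 (x + t) (by linarith)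
      have h4 := h1 (x - t) (by linarith)
      have h5 : C / (1 + (x + t) ^ 2) ≤ 4 * C / (1 + t ^ 2) := div_one_add_sq_le hC
        (by nlinarith)
      have h6 : C / (1 + (x - t) ^ 2) ≤ 4 * C / (1 + t ^ 2) := div_one_add_sq_le hC
        (by nlinarith)
      rw [show hl ψ (x + t) + hl ψ (x - t) - α * pair ψ t x =
        (hl ψ (x + t) - α * (ψ (x + t) - 1)) + (hl ψ (x - t) - α * ψ (x - t)) by unfold pair; ring]
      refine (abs_add_le _ _).trans ((add_le_add (h3.trans h5) (h4.trans h6)).trans (le_of_eq ?_))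
      ring
    have hs1 := (h.summable_pair hT x).mul_left α
    have hs2 : Summable fun n : ℕ => hl ψ (x + ((n : ℝ) + 1) * T) + hl ψ (x - ((n : ℝ) + 1) * T) -
        α * pair ψ (((n : ℝ) + 1) * T) x :=
      .of_norm_bounded (summable_div_one_add_sq (A := 8 * C) (by positivity) hT) key
    have hs3 : Summable fun n : ℕ => hl ψ (x + ((n : ℝ) + 1) * T) + hl ψ (x - ((n : ℝ) + 1) * T) := by
      simpa using hs2.add hs1
    rw [h.hl_add_wings hT, add_sub_cancel_left, wings, ← tsum_mul_left, ← hs3.tsum_sub hs1]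
    exact abs_tsum_le_of_sq_decay (by positivity) hT key

theorem invSqSum_nonneg : 0 ≤ invSqSum := tsum_nonneg fun _ => by positivity

namespace Layer

variable {F φ : ℝ → ℝ} {α K : ℝ}

set_option maxHeartbeats 800000 in
/-- Almost linear travelling supersolutions, of slope `δ q` and of speed slightly larger than
`δ c₀ L`. -/
theorem exists_travelling_supersolution (hF : ForceBound F α K) (hφ : Layer F φ) (L : ℝ) {q η : ℝ}
    (hq : 0 < q) (hη : 0 < η) :
    ∃ δ₁ > 0, ∀ δ ∈ Ioo 0 δ₁, ∃ Φ : ℝ → ℝ, ContDiff ℝ 2 Φ ∧ (∃ M, ∀ x, |Φ x - δ * q * x| ≤ M) ∧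
      ∃ μ > 0, ∀ x, μ ≤ δ * ((∫ y, (deriv φ y) ^ 2)⁻¹ * L + η) * deriv Φ x - hl Φ x - δ * L + F (Φ x) := by
  obtain ⟨Z, hZ, m, μ, hμ, hbr⟩ := hφ.exists_strict_corrector hF L hη
  obtain ⟨C, hC, hZb, hprof⟩ := hφ.exists_profile hF hZ
  obtain ⟨D, hD, hQ⟩ := hφ.exists_abs_deriv_force_sub_le hF
  set c := (∫ y, (deriv φ y) ^ 2)⁻¹ * L + η with hc
  set S := invSqSum with hS
  have hS0 : 0 ≤ S := invSqSum_nonneg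
  have hK := hF.nonneg
  set B := 8 * D * C * S * q ^ 2 + |c| * C + |c| * (8 * C * S * q ^ 2) + 8 * C * S * q ^ 2 +
    K * (C + 5 * C * S * q + |m|) ^ 2 with hB
  have hB0 : 0 ≤ B := by positivity
  refine ⟨min (min 1 q⁻¹) (μ / (2 * (B + 1))), by positivity, fun δ hδ => ?_⟩
  obtain ⟨hδ0, hδ1⟩ := hδ
  rw [lt_min_iff, lt_min_iff] at hδ1
  obtain ⟨⟨hδ1, hδq⟩, hδμ⟩ := hδ1
  set p := δ * q with hp
  have hp0 : 0 < p := by positivity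
  have hp1 : p ≤ 1 := by
    have := mul_lt_mul_of_pos_right hδq hq; rw [inv_mul_cancel₀ hq.ne'] at this; exact this.le
  have hT : 0 < p⁻¹ := by positivity
  obtain ⟨hψ, ehl, htl, htr⟩ := hprof δ ⟨hδ0.le, hδ1.le⟩
  set ψ : ℝ → ℝ := fun x => φ x + δ * Z x with hψdef
  set w := wings ψ p⁻¹ with hw
  obtain ⟨hwc, hwd⟩ := hψ.contDiff_wings hT
  obtain ⟨M, hM⟩ := hψ.exists_bound_sub_linear hT
  rw [inv_inv] at hM
  set Φ : ℝ → ℝ := fun x => ψ x + w x + δ * m with hΦ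
  have hΦc : ContDiff ℝ 2 Φ := (hψ.smooth.add hwc).add contDiff_const
  have dΦ : ∀ x, deriv Φ x = deriv φ x + δ * deriv Z x + deriv w x := fun x => by
    have h1 := (hφ.differentiable x).hasDerivAt
    have h2 := (hZ.1.differentiable (by norm_num) x).hasDerivAt
    have h3 := (hwc.differentiable (by norm_num) x).hasDerivAt
    exact (((h1.add (h2.const_mul δ)).add h3).add_const (δ * m)).deriv
  have hlΦ : ∀ x, hl Φ x = hl (fun y => ψ y + w y) x := fun x => hl_add_const _ _ _
  have core : ∀ x, 2 * |x| ≤ p⁻¹ → δ * μ / 2 ≤ δ * c * deriv Φ x - hl Φ x - δ * L + F (Φ x) := by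
    intro x hx
    obtain ⟨w1, w2, w3⟩ := hψ.wings_bounds hT hx
    have w3 := w3 α htl htr
    rw [inv_pow, div_inv_eq_mul, ← hS, ← hw] at w1 w2 w3
    have hx0 := abs_nonneg x
    have hpx : p * (2 * |x|) ≤ 1 := by
      have := mul_le_mul_of_nonneg_left hx hp0.le; rwa [mul_inv_cancel₀ hp0.ne'] at this
    have hCS : 0 ≤ C * S := by positivity
    have wa : |w x| ≤ 8 * (C * S) * p ^ 2 * (1 + |x|) := w1.trans (by
      nlinarith [mul_nonneg hCS (sq_nonneg p)])
    have wb : |w x| ≤ 5 * C * S * q * δ := w1.trans (by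
      have h1 : (1 + 8 * |x|) * p ^ 2 ≤ 5 * p := by nlinarith
      calc _ = C * S * ((1 + 8 * |x|) * p ^ 2) := by ring
        _ ≤ C * S * (5 * p) := by gcongr
        _ = _ := by rw [hp]; ring)
    obtain ⟨hz, hz'⟩ := hZb x
    set Q := deriv F (φ x) with hQdef
    have t1 : |(Q - α) * w x| ≤ 8 * D * C * S * q ^ 2 * δ ^ 2 := by
      rw [abs_mul]
      calc _ ≤ D / (1 + |x|) * (8 * (C * S) * p ^ 2 * (1 + |x|)) :=
            mul_le_mul (hQ x) wa (abs_nonneg _) (by positivity)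
        _ = 8 * D * C * S * p ^ 2 := by field_simp
        _ = _ := by rw [hp]; ring
    have t2 : |δ ^ 2 * c * deriv Z x| ≤ |c| * C * δ ^ 2 := by
      rw [abs_mul, abs_mul, abs_of_pos (by positivity : 0 < δ ^ 2)]
      calc _ ≤ δ ^ 2 * |c| * C := by gcongr
        _ = _ := by ring
    have t3 : |δ * c * deriv w x| ≤ |c| * (8 * C * S * q ^ 2) * δ ^ 2 := by
      rw [abs_mul, abs_mul, abs_of_pos hδ0]
      calc _ ≤ 1 * |c| * (8 * C * p ^ 2 * S) := by gcongr
        _ = _ := by rw [hp]; ring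
    have t4 : |hl (fun y => ψ y + w y) x - hl ψ x - α * w x| ≤ 8 * C * S * q ^ 2 * δ ^ 2 :=
      w3.trans (le_of_eq (by rw [hp]; ring))
    set s := δ * Z x + w x + δ * m with hs
    have hsb : |s| ≤ (C + 5 * C * S * q + |m|) * δ := by
      refine (abs_add_three _ _ _).trans ?_
      rw [abs_mul, abs_mul, abs_of_pos hδ0]
      linarith [mul_le_mul_of_nonneg_left hz hδ0.le]
    have t5 : |F (φ x + s) - F (φ x) - Q * s| ≤ K * (C + 5 * C * S * q + |m|) ^ 2 * δ ^ 2 := by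
      refine (hF.taylor _ _).trans ?_
      rw [mul_assoc, ← mul_pow, ← sq_abs s]
      gcongr
    have eΦ : Φ x = φ x + s := by simp only [hΦ, hψdef, hs]; ring
    have hb := mul_le_mul_of_nonneg_left (hbr x) hδ0.le
    have hfin : B * δ ^ 2 ≤ δ * μ / 2 := by
      rw [lt_div_iff₀ (by positivity)] at hδμ
      linarith [mul_le_mul_of_nonneg_left hδμ.le hδ0.le, sq_nonneg δ]
    rw [hlΦ, dΦ, eΦ]
    rw [ehl] at t4
    have t1 := abs_le.1 t1; have t2 := abs_le.1 t2; have t3 := abs_le.1 t3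
    have t4 := abs_le.1 t4; have t5 := abs_le.1 t5
    rw [hB] at hfin
    rw [hs] at t5 ⊢
    linarith
  have hper : ∀ x, Φ (x + p⁻¹) = Φ x + 1 := fun x => by
    have := hψ.add_wings_add_period hT x
    simp only [hΦ]; linarith
  have hres : Function.Periodic
      (fun x => δ * c * deriv Φ x - hl Φ x - δ * L + F (Φ x)) p⁻¹ := fun x => by
    have e1 : (fun y => Φ (y + p⁻¹)) = fun y => Φ y + 1 := funext hper
    have e2 : deriv Φ (x + p⁻¹) = deriv Φ x := by
      rw [← deriv_comp_add_const, e1, deriv_add_const]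
    have e3 : hl Φ (x + p⁻¹) = hl Φ x := by rw [← hl_comp_add, e1, hl_add_const]
    simp only [e2, e3, hper, hF.periodic]
  refine ⟨Φ, hΦc, ⟨M + |δ * m|, fun x => ?_⟩, δ * μ / 2, by positivity, fun x => ?_⟩
  · have : Φ x - p * x = (ψ x + w x - p * x) + δ * m := by simp only [hΦ]; ring
    rw [this]
    exact (abs_add_le _ _).trans (add_le_add (hM x) le_rfl)
  · have h1 := core (x - round (x / p⁻¹) * p⁻¹) (by
      have h2 := abs_sub_round (x / p⁻¹)
      have : x - round (x / p⁻¹) * p⁻¹ = (x / p⁻¹ - round (x / p⁻¹)) * p⁻¹ := by field_simp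
      rw [this, abs_mul, abs_of_pos hT]
      nlinarith)
    exact h1.trans (le_of_eq (hres.sub_int_mul_eq _))

end Layer

/-- The confining penalisation `B y² / (Y² + y²)` is almost a supersolution. -/
theorem hl_penalisation_le {B Y : ℝ} (hB : 0 ≤ B) (hY : 0 < Y) (y : ℝ) :
    hl (fun x => B - B * Y ^ 2 * bump Y x) y ≤ B / Y := by
  have h1 : hl (fun x => B - B * Y ^ 2 * bump Y x) y = -(B * Y ^ 2) * hl (bump Y) y := by
    rw [← hl_const_mul, ← hl_add_const (fun x => -(B * Y ^ 2) * bump Y x) B]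
    congr 1; ext x; ring
  have h2 := (hl_bump_bounds hY y).2
  have h3 : -hl (bump Y) y ≤ 1 / Y * (Y ^ 2)⁻¹ := by
    have := mul_le_mul_of_nonneg_left (bump_le hY y) (by positivity : 0 ≤ 1 / Y)
    linarith
  rw [h1]
  calc -(B * Y ^ 2) * hl (bump Y) y = B * Y ^ 2 * -hl (bump Y) y := by ring
    _ ≤ B * Y ^ 2 * (1 / Y * (Y ^ 2)⁻¹) := by gcongr
    _ = B / Y := by field_simp

theorem J2_mono {u v : ℝ → ℝ} (hu : Continuous u) (hv : Continuous v) {M N x : ℝ}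
    (hM : ∀ y, |u y| ≤ M) (hN : ∀ y, |v y| ≤ N) (h : ∀ y, u y ≤ v y) (hx : u x = v x) :
    J2 1 u x ≤ J2 1 v x := by
  refine setIntegral_mono_on (integrableOn_J2 hu hM x) (integrableOn_J2 hv hN x)
    (measurableSet_lt measurable_const (by fun_prop)) fun z _ => ?_
  rw [hx]
  gcongr
  exact h _

theorem Cb1.continuous {u : ℝ → ℝ → ℝ} (hu : Cb1 u) {t : ℝ} (ht : 0 ≤ t) : Continuous (u t) :=
  hu.1.comp_continuous (f := fun y => (t, y)) (by fun_prop) fun _ => ht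

set_option maxHeartbeats 1600000 in
/-- Comparison between a viscosity subsolution and a smooth strict supersolution. -/
theorem SubSolAtR1.le_of_strict_supersolution {W : ℝ → ℝ} {p L K μ : ℝ} {w U : ℝ → ℝ → ℝ}
    (hK : ∀ a b, |deriv W a - deriv W b| ≤ K * |a - b|) (hcb : Cb1 w) (hw0 : ∀ y, w 0 y = 0)
    (hw : SubSolAtR1 (Fcell1 W p L) w 1) (hU : ContDiff ℝ 2 (Function.uncurry U))
    (hUb : ∀ T, ∃ M, ∀ t ∈ Icc 0 T, ∀ y, |U t y| ≤ M) (hU0 : ∀ y, 0 ≤ U 0 y) (hμ : 0 < μ)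
    (hsup : ∀ t y, μ + hl (U t) y + L - deriv W (U t y + p * y) ≤ deriv (fun s => U s y) t)
    {t : ℝ} (ht : 0 ≤ t) (y : ℝ) : w t y ≤ U t y := by
  by_contra! hcon
  set T := t + 1 with hT
  obtain ⟨Mw, hMw⟩ := hcb.2 (T + 1) (by linarith)
  obtain ⟨MU, hMU⟩ := hUb T
  have hK0 : 0 ≤ K := by simpa using (abs_nonneg _).trans (hK 1 0)
  have hMw0 : 0 ≤ Mw := (abs_nonneg _).trans (hMw 1 ⟨by linarith, by linarith⟩ 0)
  have hMU0 : 0 ≤ MU := (abs_nonneg _).trans (hMU 0 ⟨le_rfl, by linarith⟩ 0)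
  have hdiff : ∀ s ∈ Icc 0 T, ∀ x, Real.exp (-K * s) * (w s x - U s x) ≤ Mw + MU := by
    intro s hs x
    rcases le_or_gt (w s x - U s x) 0 with h | h
    · exact (mul_nonpos_of_nonneg_of_nonpos (Real.exp_pos _).le h).trans (by positivity)
    · have h1 : Real.exp (-K * s) ≤ 1 := Real.exp_le_one_iff.2 (by nlinarith [hs.1])
      have h2 : w s x ≤ Mw := by
        rcases hs.1.eq_or_lt with h0 | h0
        · rw [← h0, hw0]; exact hMw0
        · exact (le_abs_self _).trans (hMw s ⟨h0, by linarith [hs.2]⟩ x)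
      have h3 := abs_le.1 (hMU s hs x)
      nlinarith
  set B := Mw + MU + 1 with hB
  have hB0 : 0 < B := by positivity
  set e := Real.exp (-K * t) * (w t y - U t y) with he
  have he0 : 0 < e := mul_pos (Real.exp_pos _) (by linarith)
  obtain ⟨n, hn⟩ : ∃ n : ℝ, 0 ≤ n ∧ B * Real.exp (-n) < e / 3 := by
    have h := (Real.tendsto_exp_neg_atTop_nhds_zero.const_mul B).eventually
      (gt_mem_nhds (show B * 0 < e / 3 by simpa using he0))
    exact ((eventually_ge_atTop 0).and h).exists
  obtain ⟨Y, hY0, hY1, hY2⟩ : ∃ Y : ℝ, 0 < Y ∧ B - B * Y ^ 2 * bump Y y < e / 3 ∧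
      Real.exp (K * T) * (B / Y) < μ := by
    have h1 : Tendsto (fun Y : ℝ => B * y ^ 2 * bump y Y) atTop (𝓝 (B * y ^ 2 * 0)) :=
      (tendsto_bump_atTop y).const_mul _
    have h2 : Tendsto (fun Y : ℝ => Real.exp (K * T) * (B / Y)) atTop (𝓝 (Real.exp (K * T) * 0)) :=
      (tendsto_id.const_div_atTop B).const_mul _
    obtain ⟨Y, hY, hY1, hY2⟩ := ((eventually_gt_atTop 0).and ((h1.eventually
      (gt_mem_nhds (by simpa using he0 : B * y ^ 2 * 0 < e / 3))).and
      (h2.eventually (gt_mem_nhds (by simpa using hμ))))).exists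
    refine ⟨Y, hY, lt_of_eq_of_lt ?_ hY1, hY2⟩
    have : y ^ 2 + Y ^ 2 ≠ 0 := by positivity
    have : Y ^ 2 + y ^ 2 ≠ 0 := by positivity
    unfold bump
    field_simp
    ring
  set χ : ℝ → ℝ := fun x => B - B * Y ^ 2 * bump Y x with hχ
  have hχd : ContDiff ℝ 2 χ := contDiff_const.sub (contDiff_const.mul (contDiff_bump hY0))
  have hχeq : ∀ x, χ x = B * x ^ 2 / (Y ^ 2 + x ^ 2) := fun x => by
    have : Y ^ 2 + x ^ 2 ≠ 0 := by positivity
    simp only [hχ, bump]; field_simp; ring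
  have hχ0 : ∀ x, 0 ≤ χ x := fun x => by rw [hχeq]; positivity
  have hχB : ∀ x, χ x ≤ B := fun x => by
    have := (bump_pos hY0 x).le
    have : 0 ≤ B * Y ^ 2 * bump Y x := by positivity
    simp only [hχ]; linarith
  set ζ : ℝ → ℝ := fun s => B * Real.exp (n * (s - T)) with hζ
  have hζd : ContDiff ℝ 2 ζ := by simp only [hζ]; fun_prop
  have hζ0 : ∀ s, 0 ≤ ζ s := fun s => by simp only [hζ]; positivity
  set G : ℝ × ℝ → ℝ := fun z => Real.exp (-K * z.1) * (w z.1 z.2 - U z.1 z.2) - χ z.2 - ζ z.1 with hG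
  have hGt : e / 3 < G (t, y) := by
    have : ζ t < e / 3 := by
      simp only [hζ, hT]
      convert hn.2 using 3; ring
    simp only [hG, ← he]
    have : χ y < e / 3 := hY1
    linarith
  set R := max |y| ((Mw + MU) * Y ^ 2 + 1) with hR
  have hfar : ∀ s ∈ Icc 0 T, ∀ x, R < |x| → G (s, x) ≤ 0 := by
    intro s hs x hx
    have h1 : (Mw + MU) * Y ^ 2 + 1 ≤ |x| := (le_max_right _ _).trans hx.le
    have h2 : (Mw + MU) * Y ^ 2 ≤ x ^ 2 := by
      rw [← sq_abs x]
      have : 0 ≤ (Mw + MU) * Y ^ 2 := by positivity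
      nlinarith
    have h3 : Mw + MU ≤ χ x := by
      have hx0 : 0 < |x| := by have : 0 ≤ (Mw + MU) * Y ^ 2 := by positivity
                               linarith
      have := abs_pos.1 hx0
      rw [hχeq, le_div_iff₀ (by positivity), hB]; nlinarith
    have := hdiff s hs x
    have := hζ0 s
    simp only [hG]; linarith
  obtain ⟨⟨t0, y0⟩, hmem, hmax⟩ := (isCompact_Icc (a := (0:ℝ)) (b := T)).prod
      (isCompact_Icc (a := -R) (b := R)) |>.exists_isMaxOn (f := G)
      ⟨(t, y), ⟨ht, by linarith⟩, abs_le.1 (le_max_left _ _)⟩ (by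
        have hwc : ContinuousOn (fun z : ℝ × ℝ => w z.1 z.2) (Icc 0 T ×ˢ Icc (-R) R) :=
          hcb.1.mono fun z hz => hz.1.1
        have hUc : Continuous fun z : ℝ × ℝ => U z.1 z.2 := hU.continuous
        have := hχd.continuous
        have := hζd.continuous
        exact (((by fun_prop : Continuous fun z : ℝ × ℝ => Real.exp (-K * z.1)).continuousOn.mul
          (hwc.sub hUc.continuousOn)).sub (by fun_prop)).sub (by fun_prop))
  have hGmax : ∀ s ∈ Icc 0 T, ∀ x, G (s, x) ≤ G (t0, y0) := by
    intro s hs x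
    have h0 : G (t, y) ≤ G (t0, y0) :=
      hmax (mem_prod.2 ⟨⟨ht, by linarith⟩, abs_le.1 (le_max_left _ _)⟩)
    rcases le_or_gt |x| R with h | h
    · exact hmax (mem_prod.2 ⟨hs, abs_le.1 h⟩)
    · linarith [hfar s hs x h]
  have hG0 : e / 3 < G (t0, y0) := hGt.trans_le (hGmax t ⟨ht, by linarith⟩ y)
  have ht0m : t0 ∈ Icc 0 T := hmem.1
  have ht0 : 0 < t0 := by
    refine ht0m.1.lt_of_ne fun h => ?_
    have h1 := hU0 y0
    have h2 := hχ0 y0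
    have h3 := hζ0 0
    simp only [hG] at hG0
    simp only [← h, hw0, mul_zero, Real.exp_zero] at hG0
    linarith
  have ht0T : t0 < T := by
    refine ht0m.2.lt_of_ne fun h => ?_
    have h1 := hdiff t0 ht0m y0
    have h2 := hχ0 y0
    have h3 : ζ t0 = B := by simp [hζ, h]
    simp only [hG] at hG0
    linarith
  set ϕ : ℝ → ℝ → ℝ := fun s x => U s x + Real.exp (K * s) * (G (t0, y0) + χ x + ζ s) with hϕ
  have hϕd : ContDiff ℝ 2 (Function.uncurry ϕ) := by
    have h1 : ContDiff ℝ 2 fun z : ℝ × ℝ => χ z.2 := hχd.comp contDiff_snd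
    have h2 : ContDiff ℝ 2 fun z : ℝ × ℝ => ζ z.1 := hζd.comp contDiff_fst
    exact hU.add ((by fun_prop : ContDiff ℝ 2 fun z : ℝ × ℝ => Real.exp (K * z.1)).mul
      ((contDiff_const.add h1).add h2))
  have hle : ∀ s ∈ Icc 0 T, ∀ x, w s x ≤ ϕ s x := by
    intro s hs x
    have h1 : Real.exp (-K * s) * (w s x - U s x) ≤ G (t0, y0) + χ x + ζ s := by
      have := hGmax s hs x
      simp only [hG] at this ⊢; linarith
    have h2 := mul_le_mul_of_nonneg_left h1 (Real.exp_pos (K * s)).le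
    rw [← mul_assoc, ← Real.exp_add, show K * s + -K * s = 0 by ring, Real.exp_zero, one_mul] at h2
    simp only [hϕ]; linarith
  have heq : w t0 y0 - U t0 y0 = Real.exp (K * t0) * (G (t0, y0) + χ y0 + ζ t0) := by
    simp only [hG]
    rw [sub_sub, add_assoc, sub_add_cancel, ← mul_assoc, ← Real.exp_add, show K * t0 + -K * t0 = 0 by ring,
      Real.exp_zero, one_mul]
  have heq' : w t0 y0 = ϕ t0 y0 := by simp only [hϕ]; linarith
  have hpos : 0 < w t0 y0 - U t0 y0 := by
    rw [heq]
    exact mul_pos (Real.exp_pos _) (by linarith [hχ0 y0, hζ0 t0])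
  have hUt : ContDiff ℝ 2 (U t0) := hU.comp (by fun_prop : ContDiff ℝ 2 fun x : ℝ => (t0, x))
  have hϕt : ContDiff ℝ 2 (ϕ t0) := hϕd.comp (by fun_prop : ContDiff ℝ 2 fun x : ℝ => (t0, x))
  have hUt' := hMU t0 ht0m
  have hχabs : ∀ x, |χ x| ≤ B := fun x => by rw [abs_of_nonneg (hχ0 x)]; exact hχB x
  set E := Real.exp (K * t0) with hE
  have hEpos : 0 < E := Real.exp_pos _
  have hϕb : ∀ x, |ϕ t0 x| ≤ MU + E * (|G (t0, y0)| + B + |ζ t0|) := fun x => by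
    refine (abs_add_le _ _).trans (add_le_add (hUt' x) ?_)
    rw [abs_mul, abs_of_pos hEpos]
    gcongr
    exact (abs_add_three _ _ _).trans (by gcongr; exact hχabs x)
  have hhl : hl (ϕ t0) y0 ≤ hl (U t0) y0 + E * (B / Y) := by
    have h1 : ϕ t0 = fun x => (U t0 x + E * χ x) + E * (G (t0, y0) + ζ t0) := by
      ext x; simp only [hϕ, ← hE]; ring
    have h2 := integrable_d2 (contDiff_const.mul hχd) (u := fun x => E * χ x) (M := E * B)
      (fun x => by rw [abs_mul, abs_of_pos hEpos]; gcongr; exact hχabs x) y0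
    rw [h1, hl_add_const, hl_add (integrable_d2 hUt hUt' y0) h2, hl_const_mul]
    gcongr
    exact hl_penalisation_le hB0.le hY0 y0
  set τ := min t0 (T - t0) / 2 with hτ
  have hτ0 : 0 < τ := half_pos (lt_min ht0 (by linarith))
  have hτ1 : τ < t0 := by linarith [min_le_left t0 (T - t0)]
  have hτ2 : t0 + τ ≤ T := by linarith [min_le_right t0 (T - t0)]
  have hvisc := hw t0 y0 τ ϕ ht0 hτ0 hτ1 hϕd fun s hs x _ => by
    rw [heq', sub_self]
    linarith [hle s ⟨by linarith [hs.1], by linarith [hs.2]⟩ x]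
  have hJ : J1 1 (ϕ t0) y0 + J2 1 (w t0) y0 ≤ hl (ϕ t0) y0 := by
    rw [← J1_add_J2_eq_hl hϕt hϕb]
    gcongr
    exact J2_mono (hcb.continuous ht0.le) hϕt.continuous (hMw t0 ⟨ht0, by linarith⟩) hϕb
      (hle t0 ht0m) heq'
  have hderiv : deriv (fun s => U s y0) t0 + K * (w t0 y0 - U t0 y0) ≤
      deriv (fun s => ϕ s y0) t0 := by
    have h1 : DifferentiableAt ℝ (fun s => U s y0) t0 :=
      ((hU.comp (by fun_prop : ContDiff ℝ 2 fun s : ℝ => (s, y0))).differentiable (by norm_num)) t0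
    have h2 : HasDerivAt (fun s => Real.exp (K * s)) (E * K) t0 := by
      simpa using ((hasDerivAt_id t0).const_mul K).exp
    have h3 : HasDerivAt ζ (B * (Real.exp (n * (t0 - T)) * n)) t0 := by
      simpa using (((hasDerivAt_id t0).sub_const T).const_mul n).exp.const_mul B
    have h4 := (h1.hasDerivAt.add (h2.mul (h3.const_add (G (t0, y0) + χ y0)))).deriv
    have h5 : 0 ≤ E * (B * (Real.exp (n * (t0 - T)) * n)) := by have := hn.1; positivity
    have h6 : deriv (fun s => ϕ s y0) t0 = _ := h4
    rw [h6, heq]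
    linarith
  have hlip := hK (U t0 y0 + p * y0) (w t0 y0 + p * y0)
  rw [show U t0 y0 + p * y0 - (w t0 y0 + p * y0) = -(w t0 y0 - U t0 y0) by ring, abs_neg,
    abs_of_pos hpos] at hlip
  have hlip' := (le_abs_self _).trans hlip
  have hET : E * (B / Y) ≤ Real.exp (K * T) * (B / Y) := by
    gcongr
    exact Real.exp_le_exp.2 (by nlinarith)
  have hs := hsup t0 y0
  simp only [Fcell1] at hvisc
  linarith

/-- A travelling strict supersolution of slope `P` and speed `ν` bounds the ergodic constant
from above by `P ν`. -/
theorem ErgodicLimit1.le_of_travelling_supersolution {W : ℝ → ℝ} {p L K μ P ν lam M : ℝ}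
    {w : ℝ → ℝ → ℝ} {Φ : ℝ → ℝ} (hlim : ErgodicLimit1 w lam)
    (hK : ∀ a b, |deriv W a - deriv W b| ≤ K * |a - b|)
    (hper : Function.Periodic (deriv W) 1) (hcb : Cb1 w) (hw0 : ∀ y, w 0 y = 0)
    (hw : SubSolAtR1 (Fcell1 W p L) w 1) (hp : |p| = P) (hΦ : ContDiff ℝ 2 Φ)
    (hM : ∀ x, |Φ x - P * x| ≤ M) (hμ : 0 < μ)
    (hsup : ∀ x, μ ≤ ν * deriv Φ x - hl Φ x - L + deriv W (Φ x)) : lam ≤ P * ν := by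
  obtain ⟨s, hs, hsp⟩ : ∃ s : ℝ, (s = 1 ∨ s = -1) ∧ p = s * P := by
    rcases abs_choice p with h | h
    · exact ⟨1, .inl rfl, by linarith⟩
    · exact ⟨-1, .inr rfl, by linarith⟩
  obtain ⟨k, hk⟩ := exists_nat_ge M
  set U : ℝ → ℝ → ℝ := fun t y => Φ (s * y + ν * t) - p * y + k with hU
  have hUeq : ∀ t y, U t y = (Φ (s * y + ν * t) - P * (s * y + ν * t)) + P * ν * t + k :=
    fun t y => by simp only [hU, hsp]; ring
  have hle : ∀ t, 0 ≤ t → w t 0 ≤ U t 0 := fun t ht => by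
    refine hw.le_of_strict_supersolution hK hcb hw0 ?_ ?_ ?_ hμ ?_ ht 0
    · have : ContDiff ℝ 2 fun z : ℝ × ℝ => Φ (s * z.2 + ν * z.1) := hΦ.comp (by fun_prop)
      exact (this.sub (by fun_prop)).add contDiff_const
    · refine fun T => ⟨M + |P * ν| * T + k, fun t ht y => ?_⟩
      rw [hUeq]
      refine (abs_add_three _ _ _).trans ?_
      rw [abs_mul _ t, abs_of_nonneg ht.1, Nat.abs_cast]
      gcongr
      exacts [hM _, ht.2]
    · intro y
      rw [hUeq]
      linarith [(abs_le.1 (hM (s * y + ν * 0))).1]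
    · intro t y
      have h1 : hl (U t) y = hl Φ (s * y + ν * t) := by
        have : hl (U t) y = hl (fun y => Φ (s * y + ν * t)) y := by
          unfold hl d2; congr 1; ext z; simp only [hU]; ring_nf
        rw [this]
        rcases hs with rfl | rfl
        · simpa using hl_comp_add Φ (ν * t) y
        · have := hl_comp_neg (fun y => Φ (y + ν * t)) y
          rw [hl_comp_add] at this
          simpa using this
      have h2 : deriv (fun r => U r y) t = ν * deriv Φ (s * y + ν * t) := by
        have h : HasDerivAt (fun r => s * y + ν * r) ν t := by
          simpa using ((hasDerivAt_id t).const_mul ν).const_add (s * y)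
        have h' := ((hΦ.differentiable (by norm_num) _).hasDerivAt.comp t h)
        exact ((h'.sub_const (p * y)).add_const (k : ℝ)).deriv.trans (mul_comm _ _)
      have h3 : U t y + p * y = Φ (s * y + ν * t) + k * 1 := by simp only [hU]; ring
      rw [h1, h2, h3, hper.nat_mul]
      linarith [hsup (s * y + ν * t)]
  refine le_of_forall_pos_le_add fun ε hε => ?_
  obtain ⟨T, hT⟩ := hlim 1 one_pos (ε / 2) (half_pos hε)
  set t := max T (max 1 ((M + k) / (ε / 2))) with ht
  have ht0 : 0 < t := one_pos.trans_le ((le_max_left _ _).trans (le_max_right _ _))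
  have h1 := (abs_le.1 (hT t (le_max_left _ _) 0 (by simp))).1
  have h2 : (M + k) / (ε / 2) ≤ t := (le_max_right _ _).trans (le_max_right _ _)
  rw [div_le_iff₀ (by positivity)] at h2
  have h3 : w t 0 / t ≤ P * ν + ε / 2 := by
    rw [div_le_iff₀ ht0]
    have h4 := hle t ht0.le
    rw [hUeq] at h4
    linarith [(abs_le.1 (hM (s * 0 + ν * t))).2]
  linarith

theorem AssumptionW.exists_forceBound {W : ℝ → ℝ} (hW : AssumptionW W) :
    ∃ α K, ForceBound (deriv W) α K := by
  obtain ⟨⟨β, -, hsm, -⟩, hper, hz, hpos, hα⟩ := hW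
  have hsm' : ContDiff ℝ 3 (deriv W) := by
    have : ContDiff ℝ (3 + 1) W := by norm_num; exact hsm
    exact (contDiff_succ_iff_deriv.1 this).2.2
  have hder : ∀ {f : ℝ → ℝ}, (∀ v, f (v + 1) = f v) → ∀ v, deriv f (v + 1) = deriv f v := by
    intro f hf v
    rw [← deriv_comp_add_const, funext hf]
  have hbdd : ∀ {f : ℝ → ℝ}, Continuous f → (∀ v, f (v + 1) = f v) → ∃ C, ∀ v, |f v| ≤ C := by
    intro f hc hf
    obtain ⟨C, hC⟩ := (Function.Periodic.isBounded_of_continuous (c := 1) hf one_ne_zero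
      hc).exists_norm_le
    exact ⟨C, fun v => hC _ (mem_range_self v)⟩
  have hsm2 : ContDiff ℝ 2 (deriv W) := hsm'.of_le (by norm_num)
  obtain ⟨C1, h1⟩ := hbdd hsm2.deriv_of_two.continuous (hder (hder hper))
  obtain ⟨C2, h2⟩ := hbdd hsm2.continuous_deriv_deriv (hder (hder (hder hper)))
  refine ⟨_, max C1 C2, hsm', hder hper, ?_, rfl, hα, fun v => (h1 v).trans (le_max_left _ _),
    fun v => (h2 v).trans (le_max_right _ _)⟩
  refine IsLocalMin.deriv_eq_zero (Eventually.of_forall fun v => ?_)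
  have h0 : W 0 = 0 := by simpa using hz 0
  by_cases hv : ∃ k : ℤ, v = k
  · obtain ⟨k, rfl⟩ := hv
    rw [hz, h0]
  · exact h0.trans_le (hpos v (not_exists.1 hv)).le

theorem IsPhi.layer {W φ : ℝ → ℝ} (hφ : IsPhi W φ) : Layer (deriv W) φ := by
  obtain ⟨hsm, heq, hbot, htop, -, hpos⟩ := hφ
  have hmono : Monotone φ := (strictMono_of_deriv_pos hpos).monotone
  refine ⟨hsm, fun x => ?_, hbot, htop, hpos⟩
  rw [← heq, halfLap, J1_add_J2_eq_hl (hsm.of_le (by norm_num)) (M := 1)]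
  exact fun y => abs_le.2 ⟨by linarith [hmono.le_of_tendsto hbot y], hmono.ge_of_tendsto htop y⟩

theorem ForceBound.neg {F : ℝ → ℝ} {α K : ℝ} (h : ForceBound F α K) :
    ForceBound (fun v => -F (-v)) α K := by
  have h1 : deriv (fun v => -F (-v)) = fun v => deriv F (-v) := by
    ext v; rw [deriv.fun_neg, deriv_comp_neg, neg_neg]
  refine ⟨(h.smooth.comp contDiff_neg).neg, fun v => ?_, by simp [h.zero], by simp [h1, h.deriv_zero],
    h.pos, fun v => by rw [h1]; exact h.bound1 _, fun v => ?_⟩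
  · rw [← h.periodic, neg_add, neg_add_cancel_right]
  · rw [h1, deriv_comp_neg, abs_neg]; exact h.bound2 _

namespace Layer

variable {F φ : ℝ → ℝ} {α K : ℝ}

theorem neg (hF : ForceBound F α K) (hφ : Layer F φ) :
    Layer (fun v => -F (-v)) fun x => 1 - φ (-x) := by
  refine ⟨contDiff_const.sub (hφ.smooth.comp contDiff_neg), fun x => ?_, ?_, ?_, fun x => ?_⟩
  · have h1 : (fun x => 1 - φ (-x)) = fun x => -φ (-x) + 1 := by ext; ring
    rw [h1, hl_add_const, hl_neg, hl_comp_neg, hφ.eqn, ← hF.periodic (-(1 - φ (-x)))]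
    congr 2; ring
  · simpa using (hφ.top.comp tendsto_neg_atBot_atTop).const_sub 1
  · simpa using (hφ.bot.comp tendsto_neg_atTop_atBot).const_sub 1
  · rw [deriv_const_sub, deriv_comp_neg, neg_neg]; exact hφ.deriv_pos _

theorem integral_deriv_sq_neg (φ : ℝ → ℝ) :
    ∫ x, deriv (fun x => 1 - φ (-x)) x ^ 2 = ∫ x, deriv φ x ^ 2 := by
  simp only [deriv_const_sub, deriv_comp_neg, neg_neg]
  exact integral_neg_eq_self (fun x => deriv φ x ^ 2) volume

/-- The upper half of Orowan's law, for subsolutions. -/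
theorem eventually_ergodic_lt {W : ℝ → ℝ} (hF : ForceBound (deriv W) α K)
    (hφ : Layer (deriv W) φ) (p L : ℝ) {ε : ℝ} (hε : 0 < ε) :
    ∀ᶠ δ in 𝓝[>] (0 : ℝ), ∀ w lam, Cb1 w → (∀ y, w 0 y = 0) →
      SubSolAtR1 (Fcell1 W (δ * p) (δ * L)) w 1 → ErgodicLimit1 w lam →
      lam / δ ^ 2 < (∫ x, deriv φ x ^ 2)⁻¹ * |p| * L + ε := by
  rcases eq_or_ne p 0 with rfl | hp
  · obtain ⟨v, hv⟩ : ∃ v, 0 < deriv W v := by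
      by_contra! hcon
      have h1 : deriv (deriv W) 0 = 0 := IsLocalMax.deriv_eq_zero
        (Eventually.of_forall fun v => (hcon v).trans_eq hF.zero.symm)
      exact hF.pos.ne' (hF.deriv_zero.symm.trans h1)
    have h2 : ∀ᶠ δ in 𝓝[>] (0 : ℝ), δ * L < deriv W v :=
      nhdsWithin_le_nhds (((continuous_id.mul continuous_const).tendsto' (0 : ℝ) 0
        (by simp)).eventually (gt_mem_nhds hv))
    filter_upwards [h2, self_mem_nhdsWithin] with δ hδ hδ0 w lam hcb hw0 hw hlim
    have h3 := hlim.le_of_travelling_supersolution (P := 0) (ν := 0) (M := |v|)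
      (Φ := fun _ => v) hF.lipschitz hF.periodic hcb hw0 hw (by simp) contDiff_const (by simp)
      (sub_pos.2 hδ) fun x => by
        have h4 : hl (fun _ => v) x = 0 := by simp [hl, d2, ← two_mul]
        rw [h4]
        linarith
    have h4 : lam / δ ^ 2 ≤ 0 := div_nonpos_of_nonpos_of_nonneg (by linarith) (by positivity)
    simp only [abs_zero, mul_zero, zero_mul, zero_add]
    linarith
  · have hq := abs_pos.2 hp
    obtain ⟨δ₁, hδ₁, h⟩ := hφ.exists_travelling_supersolution hF L hq
      (show 0 < ε / (2 * |p|) by positivity)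
    filter_upwards [Ioo_mem_nhdsGT hδ₁] with δ hδ w lam hcb hw0 hw hlim
    obtain ⟨Φ, hΦ, ⟨M, hM⟩, μ, hμ, hsup⟩ := h δ hδ
    have hδ0 : 0 < δ := hδ.1
    have h3 := hlim.le_of_travelling_supersolution hF.lipschitz hF.periodic hcb hw0 hw
      (by rw [abs_mul, abs_of_pos hδ0]) hΦ hM hμ hsup
    rw [div_lt_iff₀ (by positivity)]
    refine h3.trans_lt ?_
    have h4 : δ * |p| * (δ * ((∫ x, deriv φ x ^ 2)⁻¹ * L + ε / (2 * |p|))) =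
        ((∫ x, deriv φ x ^ 2)⁻¹ * |p| * L + ε / 2) * δ ^ 2 := by
      field_simp
    rw [h4]
    gcongr
    linarith

end Layer

theorem Cb1.neg {w : ℝ → ℝ → ℝ} (hw : Cb1 w) : Cb1 fun t y => -w t y :=
  ⟨hw.1.neg, fun T hT => by simpa using hw.2 T hT⟩

theorem ErgodicLimit1.neg {w : ℝ → ℝ → ℝ} {lam : ℝ} (hw : ErgodicLimit1 w lam) :
    ErgodicLimit1 (fun t y => -w t y) (-lam) := fun R hR δ hδ => by
  obtain ⟨T, hT⟩ := hw R hR δ hδ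
  refine ⟨T, fun τ hτ y hy => ?_⟩
  rw [neg_div, ← neg_sub', abs_neg]
  exact hT τ hτ y hy

theorem J1_neg (r : ℝ) (u : ℝ → ℝ) (x : ℝ) : J1 r (fun y => -u y) x = -J1 r u x := by
  unfold J1
  rw [← integral_neg]
  congr 1; ext z
  rw [deriv.fun_neg]; ring

theorem J2_neg (r : ℝ) (u : ℝ → ℝ) (x : ℝ) : J2 r (fun y => -u y) x = -J2 r u x := by
  unfold J2
  rw [← integral_neg]
  congr 1; ext z
  ring

theorem SuperSolAtR1.neg {W : ℝ → ℝ} {p L r : ℝ} {w : ℝ → ℝ → ℝ}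
    (hw : SuperSolAtR1 (Fcell1 W p L) w r) :
    SubSolAtR1 (Fcell1 (fun v => W (-v)) (-p) (-L)) (fun t y => -w t y) r := by
  intro t0 y0 τ ϕ ht0 hτ hτ0 hϕ hmax
  have h := hw t0 y0 τ (fun t y => -ϕ t y) ht0 hτ hτ0 hϕ.neg fun t ht y hy => by
    linarith [hmax t ht y hy]
  simp only [Fcell1, deriv.fun_neg, J1_neg, deriv_comp_neg, J2_neg] at h ⊢
  rw [show -(-w t0 y0 + -p * y0) = w t0 y0 + p * y0 by ring]
  linarith

/-- **Orowan's law** (Theorem 1.3).  Assume (W), `N = 1`, `g ≡ 1/π`, `σ ≡ 0`, and let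
`p0, L0 ∈ ℝ`.  Then the effective Hamiltonian `H̄` defined by the ergodicity theorem
satisfies `H̄(δp0, δL0)/δ² → c0|p0|L0` as `δ → 0⁺`, with `c0 = (∫_ℝ (φ')²)⁻¹`. -/
theorem orowans_law (W : ℝ → ℝ) (hW : AssumptionW W) (φ : ℝ → ℝ) (hφ : IsPhi W φ)
    (Hbar : ℝ → ℝ → ℝ)
    (hHbar : ∀ p L : ℝ, ∃ w : ℝ → ℝ → ℝ,
      IsSol1 (Fcell1 W p L) w ∧ ErgodicLimit1 w (Hbar p L))
    (p0 L0 : ℝ) :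
    Tendsto (fun δ : ℝ => Hbar (δ * p0) (δ * L0) / δ ^ 2) (𝓝[>] 0)
      (𝓝 ((∫ x : ℝ, (deriv φ x) ^ 2)⁻¹ * |p0| * L0)) := by
  obtain ⟨α, K, hF⟩ := hW.exists_forceBound
  have hL := hφ.layer
  have hneg : deriv (fun v => W (-v)) = fun v => -deriv W (-v) := by
    ext v; rw [deriv_comp_neg]
  refine tendsto_order.2 ⟨fun a ha => ?_, fun a ha => ?_⟩
  · have h := Layer.eventually_ergodic_lt (W := fun v => W (-v)) (hneg ▸ hF.neg) (hneg ▸ hL.neg hF)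
      (-p0) (-L0) (sub_pos.2 ha)
    filter_upwards [h] with δ hδ
    obtain ⟨w, ⟨hcb, hw0, -, hw⟩, hlim⟩ := hHbar (δ * p0) (δ * L0)
    have h1 := hδ _ _ hcb.neg (by simp [hw0])
      (by simpa only [mul_neg] using (hw 1 one_pos).neg) hlim.neg
    rw [Layer.integral_deriv_sq_neg, abs_neg, neg_div] at h1
    linarith
  · filter_upwards [hL.eventually_ergodic_lt hF p0 L0 (sub_pos.2 ha)] with δ hδ
    obtain ⟨w, ⟨hcb, hw0, hw, -⟩, hlim⟩ := hHbar (δ * p0) (δ * L0)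
    have h1 := hδ w _ hcb hw0 (hw 1 one_pos) hlim
    linarith
end
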